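/- Let p > 1 and let m ∈ L^p(Q) be a nonnegative weak solution of the Fokker–Planck equation with drift A and initial datum m₀, and define r by 1/r = 1/γ' + (1 − 1/γ')·(1/p). Then m admits a weak spatial gradient ∇m ∈ L^r(Q;ℝ^N) (i.e., there is g ∈ L^r(Q;ℝ^N) with ∫_Q m div Φ dx dt = −∫_Q g·Φ dx dt for all smooth vector fields Φ on T^N × [0,T]), and there is C > 0, depending only on T, p, N, γ' and ‖∇m₀‖_{L^∞(T^N)}, such that ‖m‖_{L^r(Q)} + ‖∇m‖_{L^r(Q)} ≤ C( E^{1/γ'} ‖m‖_{L^p(Q)}^{1/γ} + 1 ), and in addition |∫_Q m ∂_t φ dx dt| ≤ C( E^{1/γ'} ‖m‖_{L^p(Q)}^{1/γ} + 1 ) ‖∇φ‖_{L^{r'}(Q)} for every smooth φ : T^N × [0,T] → ℝ with φ(·,0) = φ(·,T) = 0, where γ and r' are the conjugate exponents of γ' and r. -/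

import Mathlib

open MeasureTheory Set Filter Topology

noncomputable section

/-- Points of `ℝ^N`.  `ℤ^N`-periodic functions on `RN N` model functions on the
flat torus `T^N`. -/
abbrev RN (N : ℕ) := Fin N → ℝ

/-- The Euclidean norm on `ℝ^N`. -/
def euclNorm {N : ℕ} (p : RN N) : ℝ := Real.sqrt (∑ i, p i ^ 2)

/-- The Euclidean inner product on `ℝ^N`. -/
def dotp {N : ℕ} (p q : RN N) : ℝ := ∑ i, p i * q i

/-- `ℤ^N`-periodicity: such functions are exactly the functions on the flat torus `T^N`. -/
def ZPeriodic {N : ℕ} {β : Type*} (u : RN N → β) : Prop :=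
  ∀ (x : RN N) (z : Fin N → ℤ), u (fun i => x i + (z i : ℝ)) = u x

/-- Partial derivative in the `i`-th coordinate direction. -/
def pd {N : ℕ} (i : Fin N) (u : RN N → ℝ) (x : RN N) : ℝ := fderiv ℝ u x (Pi.single i 1)

/-- Spatial gradient. -/
def grad {N : ℕ} (u : RN N → ℝ) (x : RN N) : RN N := fun i => pd i u x

/-- Divergence of a vector field. -/
def dive {N : ℕ} (w : RN N → RN N) (x : RN N) : ℝ := ∑ i, pd i (fun y => w y i) x

/-- Laplacian. -/
def lap {N : ℕ} (u : RN N → ℝ) (x : RN N) : ℝ := ∑ i, pd i (pd i u) x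

/-- The unit cube, a fundamental domain for the torus `T^N` (of total measure `1`,
so that the measure on the torus is the normalized one). -/
def cube (N : ℕ) : Set (RN N) := Set.Icc 0 1

/-- The space-time cylinder `Q = T^N × (0,T)`. -/
def QQ (N : ℕ) (T : ℝ) : Set (RN N × ℝ) := cube N ×ˢ Ioo 0 T

/-- Integral over `Q = T^N × (0,T)`. -/
def intQ (N : ℕ) (T : ℝ) (f : RN N → ℝ → ℝ) : ℝ := ∫ q in QQ N T, f q.1 q.2

/-- Smooth space-periodic test functions on `T^N × [0,T]`. -/
def IsTest (N : ℕ) (φ : RN N → ℝ → ℝ) : Prop :=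
  ContDiff ℝ (⊤ : ℕ∞) (fun q : RN N × ℝ => φ q.1 q.2) ∧ ∀ t, ZPeriodic fun x => φ x t

/-- The Legendre transform `L(q) = sup_p (p·q - H(p))`. -/
def Leg {N : ℕ} (H : RN N → ℝ) (q : RN N) : ℝ := sSup ((fun p => dotp p q - H p) '' Set.univ)

/-- `m L(-w/m)`, with the convention that it vanishes when `m ≤ 0` (recall that in `K`
one has `w = 0` a.e. on `{m = 0}`). -/
def mLag {N : ℕ} (L : RN N → ℝ) (mv : ℝ) (wv : RN N) : ℝ :=
  if 0 < mv then mv * L ((-mv⁻¹) • wv) else 0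

/-- `|w|^{γ'} m^{1-γ'}`, with the convention that it vanishes when `m ≤ 0`. -/
def kinQ {N : ℕ} (γ' : ℝ) (mv : ℝ) (wv : RN N) : ℝ :=
  if 0 < mv then euclNorm wv ^ γ' * mv ^ (1 - γ') else 0

/-- `F(x,m) = ∫_0^m f(x,σ) dσ`. -/
def Fint {N : ℕ} (f : RN N → ℝ → ℝ) (x : RN N) (mv : ℝ) : ℝ := ∫ σ in (0:ℝ)..mv, f x σ

/-- The convexifying term `G(x,t,m)`, as a function of `m̄(x,t)` (argument `mb`) and `m`. -/
def Gcvx (c_f α mb mv : ℝ) : ℝ :=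
  ((c_f + 1) / (α * (α + 1))) * ((mv + 1) ^ (α + 1) - (mb + 1) ^ (α + 1))
    - ((c_f + 1) / α) * (mb + 1) ^ α * (mv - mb)

/-- `g = ∂_m G`, as a function of `m̄(x,t)` (argument `mb`) and `m`. -/
def gcvx (c_f α mb mv : ℝ) : ℝ := ((c_f + 1) / α) * ((mv + 1) ^ α - (mb + 1) ^ α)

/-- The penalised Lagrangian `L_η(q) = L(q) + (η/(N+3)) |q|^{N+3}`. -/
def Lpen {N : ℕ} (L : RN N → ℝ) (η : ℝ) (q : RN N) : ℝ :=
  L q + (η / ((N : ℝ) + 3)) * euclNorm q ^ ((N : ℝ) + 3)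

/-- The penalised Hamiltonian `H_η`, the Legendre transform of `L_η`. -/
def Hpen {N : ℕ} (L : RN N → ℝ) (η : ℝ) : RN N → ℝ := Leg (Lpen L η)

/-- `g` is the weak spatial gradient of `m` on `Q`. -/
def HasWeakGradQ (N : ℕ) (T : ℝ) (m : RN N → ℝ → ℝ) (g : RN N → ℝ → RN N) : Prop :=
  ∀ Φ : RN N → ℝ → RN N, ContDiff ℝ (⊤ : ℕ∞) (fun q : RN N × ℝ => Φ q.1 q.2) →
    (∀ t, ZPeriodic fun x => Φ x t) →
    intQ N T (fun x t => m x t * dive (fun y => Φ y t) x)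
      = -intQ N T (fun x t => dotp (g x t) (Φ x t))

/-- `m` is `θ`-Hölder continuous on `T^N × [0,T]` with constant `C`. -/
def HolderOnQ (N : ℕ) (T C θ : ℝ) (m : RN N → ℝ → ℝ) : Prop :=
  ∀ x t x' t', t ∈ Icc (0:ℝ) T → t' ∈ Icc (0:ℝ) T →
    |m x t - m x' t'| ≤
      C * Real.sqrt (euclNorm (fun i => x i - x' i) ^ 2 + (t - t') ^ 2) ^ θ

/-- Membership in the constraint set `K`: `(m,w) ∈ L^{α+1}(Q) × L¹(Q;ℝ^N)`, `m ≥ 0`,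
`|w|^{γ'} m^{1-γ'} ∈ L¹(Q)`, together with the weak Fokker–Planck constraint
(with initial datum `m₀`); the field `traceId` states that `m(·,T)` is the time-`T`
trace of `m` determined by the constraint. -/
structure MemK (N : ℕ) (T α γ' : ℝ) (m₀ : RN N → ℝ)
    (m : RN N → ℝ → ℝ) (w : RN N → ℝ → RN N) : Prop where
  per_m : ∀ t, ZPeriodic fun x => m x t
  per_w : ∀ t, ZPeriodic fun x => w x t
  nonneg : ∀ x t, 0 ≤ m x t
  lp_m : IntegrableOn (fun q : RN N × ℝ => m q.1 q.2 ^ (α + 1)) (QQ N T)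
  l1_w : IntegrableOn (fun q : RN N × ℝ => w q.1 q.2) (QQ N T)
  vanish : ∀ᵐ q ∂(volume.restrict (QQ N T)), m q.1 q.2 = 0 → w q.1 q.2 = 0
  kin_int : IntegrableOn (fun q : RN N × ℝ => kinQ γ' (m q.1 q.2) (w q.1 q.2)) (QQ N T)
  traceInt : IntegrableOn (fun x => m x T) (cube N)
  fp : ∀ φ : RN N → ℝ → ℝ, IsTest N φ → (∀ x, φ x T = 0) →
    intQ N T (fun x t => m x t * deriv (φ x) t + dotp (w x t) (grad (fun y => φ y t) x)
        + m x t * lap (fun y => φ y t) x)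
      + (∫ x in cube N, m₀ x * φ x 0) = 0
  traceId : ∀ φ : RN N → ℝ → ℝ, IsTest N φ →
    intQ N T (fun x t => m x t * deriv (φ x) t + dotp (w x t) (grad (fun y => φ y t) x)
        + m x t * lap (fun y => φ y t) x)
      + (∫ x in cube N, m₀ x * φ x 0) - (∫ x in cube N, m x T * φ x T) = 0

/-- The energy functional `E` on `K`, with Lagrangian `L` and coupling antiderivative `F`. -/
def energyF (N : ℕ) (T : ℝ) (L : RN N → ℝ) (F : RN N → ℝ → ℝ) (uT : RN N → ℝ)
    (m : RN N → ℝ → ℝ) (w : RN N → ℝ → RN N) : ℝ :=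
  intQ N T (fun x t => mLag L (m x t) (w x t) - F x (m x t)) + ∫ x in cube N, uT x * m x T

/-- `(m,w)` belongs to `K` and minimises the energy over `K`. -/
def MinimisesE (N : ℕ) (T α γ' : ℝ) (m₀ : RN N → ℝ) (L : RN N → ℝ) (F : RN N → ℝ → ℝ)
    (uT : RN N → ℝ) (m : RN N → ℝ → ℝ) (w : RN N → ℝ → RN N) : Prop :=
  MemK N T α γ' m₀ m w ∧
    ∀ m' w', MemK N T α γ' m₀ m' w' → energyF N T L F uT m w ≤ energyF N T L F uT m' w'

/-- Classical solution of the MFG system `-∂_t u - Δu + H(∇u) = fc(x,t,m)`,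
`∂_t m - Δm - div(∇H(∇u) m) = 0`, `m(·,0) = m₀`, `u(·,T) = u_T`:
`u, m` are continuous on `T^N × [0,T]` together with `∂_t u, ∂_t m` and all first and
second space derivatives, and the equations hold pointwise. -/
structure ClassicalSol (N : ℕ) (T : ℝ) (H : RN N → ℝ) (fc : RN N → ℝ → ℝ → ℝ)
    (m₀ uT : RN N → ℝ) (u m : RN N → ℝ → ℝ) : Prop where
  per_u : ∀ t, ZPeriodic fun x => u x t
  per_m : ∀ t, ZPeriodic fun x => m x t
  cont_u : ContinuousOn (fun q : RN N × ℝ => u q.1 q.2) ((Set.univ : Set (RN N)) ×ˢ Icc 0 T)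
  cont_m : ContinuousOn (fun q : RN N × ℝ => m q.1 q.2) ((Set.univ : Set (RN N)) ×ˢ Icc 0 T)
  cont_ut : ContinuousOn (fun q : RN N × ℝ => deriv (u q.1) q.2)
    ((Set.univ : Set (RN N)) ×ˢ Icc 0 T)
  cont_mt : ContinuousOn (fun q : RN N × ℝ => deriv (m q.1) q.2)
    ((Set.univ : Set (RN N)) ×ˢ Icc 0 T)
  cont_du : ∀ i, ContinuousOn (fun q : RN N × ℝ => pd i (fun y => u y q.2) q.1)
    ((Set.univ : Set (RN N)) ×ˢ Icc 0 T)
  cont_dm : ∀ i, ContinuousOn (fun q : RN N × ℝ => pd i (fun y => m y q.2) q.1)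
    ((Set.univ : Set (RN N)) ×ˢ Icc 0 T)
  cont_ddu : ∀ i j, ContinuousOn (fun q : RN N × ℝ => pd i (pd j fun y => u y q.2) q.1)
    ((Set.univ : Set (RN N)) ×ˢ Icc 0 T)
  cont_ddm : ∀ i j, ContinuousOn (fun q : RN N × ℝ => pd i (pd j fun y => m y q.2) q.1)
    ((Set.univ : Set (RN N)) ×ˢ Icc 0 T)
  tdiff_u : ∀ x, ∀ t ∈ Ioo 0 T, DifferentiableAt ℝ (u x) t
  tdiff_m : ∀ x, ∀ t ∈ Ioo 0 T, DifferentiableAt ℝ (m x) t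
  xdiff_u : ∀ t ∈ Icc 0 T,
    Differentiable ℝ (fun y => u y t) ∧ ∀ i, Differentiable ℝ (pd i fun y => u y t)
  xdiff_m : ∀ t ∈ Icc 0 T,
    Differentiable ℝ (fun y => m y t) ∧ ∀ i, Differentiable ℝ (pd i fun y => m y t)
  hjb : ∀ x, ∀ t ∈ Ioo 0 T,
    -deriv (u x) t - lap (fun y => u y t) x + H (grad (fun y => u y t) x) = fc x t (m x t)
  fkp : ∀ x, ∀ t ∈ Ioo 0 T,
    deriv (m x) t - lap (fun y => m y t) x
      - dive (fun y => m y t • grad H (grad (fun z => u z t) y)) x = 0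
  init : ∀ x, m x 0 = m₀ x
  final : ∀ x, u x T = uT x

/-- Weak solution `(u,m)` (with weak spatial gradient `Du` of `u`) of the MFG system
`-∂_t u - Δu + H(∇u) = fc(x,t,m)`, `∂_t m - Δm - div(∇H(∇u) m) = 0`, `m(·,0) = m₀`,
`u(·,T) = u_T`, in the sense of Definition 3.1 of the paper. -/
structure WeakSol (N : ℕ) (T γ α : ℝ) (H : RN N → ℝ) (fc : RN N → ℝ → ℝ → ℝ)
    (m₀ uT : RN N → ℝ) (u m : RN N → ℝ → ℝ) (Du : RN N → ℝ → RN N) : Prop where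
  per_u : ∀ t, ZPeriodic fun x => u x t
  per_m : ∀ t, ZPeriodic fun x => m x t
  per_Du : ∀ t, ZPeriodic fun x => Du x t
  nonneg_m : ∀ x t, 0 ≤ m x t
  lp_m : IntegrableOn (fun q : RN N × ℝ => m q.1 q.2 ^ (α + 1)) (QQ N T)
  lq_u_sup : α < γ / N → ∃ C, ∀ᵐ q ∂(volume.restrict (QQ N T)), |u q.1 q.2| ≤ C
  lq_u_int : γ / N < α →
    IntegrableOn (fun q : RN N × ℝ =>
      |u q.1 q.2| ^ (γ * (α + 1) * (1 + (N : ℝ)) / (α * N - γ))) (QQ N T)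
  weak_grad : HasWeakGradQ N T u Du
  lγ_Du : IntegrableOn (fun q : RN N × ℝ => euclNorm (Du q.1 q.2) ^ γ) (QQ N T)
  int_mL : IntegrableOn (fun q : RN N × ℝ =>
      m q.1 q.2 * Leg H (grad H (Du q.1 q.2))) (QQ N T)
  int_mDH : IntegrableOn (fun q : RN N × ℝ => m q.1 q.2 • grad H (Du q.1 q.2)) (QQ N T)
  hjb : ∀ φ : RN N → ℝ → ℝ, IsTest N φ → (∀ x t, 0 ≤ φ x t) →
    (∃ ε > (0:ℝ), ∀ x, ∀ t ≤ ε, φ x t = 0) →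
    intQ N T (fun x t => u x t * deriv (φ x) t - u x t * lap (fun y => φ y t) x
        + (H (Du x t) - fc x t (m x t)) * φ x t)
      ≤ ∫ x in cube N, uT x * φ x T
  fkp : ∀ φ : RN N → ℝ → ℝ, IsTest N φ → (∀ x, φ x T = 0) →
    intQ N T (fun x t => m x t * deriv (φ x) t
        - dotp (m x t • grad H (Du x t)) (grad (fun y => φ y t) x)
        + m x t * lap (fun y => φ y t) x)
      + (∫ x in cube N, m₀ x * φ x 0) = 0
  energy_id : intQ N T (fun x t =>
        m x t * (-(fc x t (m x t)) + Leg H (grad H (Du x t))))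
      + (∫ x in cube N, (m x T * uT x - m₀ x * u x 0)) = 0

/-- Nonnegative weak solution of the Fokker–Planck equation
`∂_t m - Δm + div(A m) = 0` in `Q`, `m(·,0) = m₀`, with finite energy
`E = ∫_Q |A|^{γ'} m < ∞`. -/
structure FPSol (N : ℕ) (T γ' : ℝ) (m₀ : RN N → ℝ) (m : RN N → ℝ → ℝ)
    (A : RN N → ℝ → RN N) : Prop where
  per_m : ∀ t, ZPeriodic fun x => m x t
  per_A : ∀ t, ZPeriodic fun x => A x t
  nonneg : ∀ x t, 0 ≤ m x t
  int_m : IntegrableOn (fun q : RN N × ℝ => m q.1 q.2) (QQ N T)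
  int_E : IntegrableOn (fun q : RN N × ℝ => euclNorm (A q.1 q.2) ^ γ' * m q.1 q.2) (QQ N T)
  weak : ∀ φ : RN N → ℝ → ℝ, IsTest N φ → (∀ x, φ x T = 0) →
    intQ N T (fun x t => m x t * (deriv (φ x) t + lap (fun y => φ y t) x
        + dotp (A x t) (grad (fun y => φ y t) x)))
      + (∫ x in cube N, m₀ x * φ x 0) = 0

/-- Conditions on the initial datum of the Fokker–Planck equation: a periodic (i.e.
defined on the torus) Lipschitz probability density, with `‖∇m₀‖_∞ ≤ K₀`. -/
def FPData (N : ℕ) (K₀ : ℝ) (m₀ : RN N → ℝ) : Prop :=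
  ZPeriodic m₀ ∧ (∀ x, 0 ≤ m₀ x) ∧ (∫ x in cube N, m₀ x) = 1 ∧
    Differentiable ℝ m₀ ∧ ∀ x, euclNorm (grad m₀ x) ≤ K₀

open scoped ENNReal NNReal

theorem exists_stopping_cells {α ι : Type*} [MeasurableSpace α] (ν : Measure α)
    [IsFiniteMeasure ν] (idx : ℕ → α → ι) (hmeas : ∀ k n, MeasurableSet (idx k ⁻¹' {n}))
    (hnest : ∀ k z w, idx (k + 1) z = idx (k + 1) w → idx k z = idx k w)
    (v : ℕ → ℝ≥0∞) (hv0 : ∀ k, v k ≠ 0)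
    (D : ℝ≥0∞) (hD : ∀ k, v k = D * v (k + 1)) (l : ℝ≥0∞) (hl0 : l ≠ 0)
    (h0 : ν univ ≤ l * v 0) (K : ℕ) :
    ∃ S : Finset (ℕ × ι),
      (∀ q ∈ S, ∀ q' ∈ S, q ≠ q' → Disjoint (idx q.1 ⁻¹' {q.2}) (idx q'.1 ⁻¹' {q'.2})) ∧
      (∀ q ∈ S, l * v q.1 ≤ ν (idx q.1 ⁻¹' {q.2}) ∧
        ν (idx q.1 ⁻¹' {q.2}) ≤ D * (l * v q.1) ∧ ∃ z, idx q.1 z = q.2) ∧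
      ∀ z, (∀ q ∈ S, idx q.1 z ≠ q.2) → ν (idx K ⁻¹' {idx K z}) ≤ l * v K := by
  classical
  have hnest' : ∀ j k, j ≤ k → ∀ z w, idx k z = idx k w → idx j z = idx j w := by
    intro j k hjk z w
    induction k, hjk using Nat.le_induction with
    | base => exact id
    | succ k _ ih => exact fun h => ih (hnest k z w h)
  have hfin : ∀ k, {n | l * v k ≤ ν (idx k ⁻¹' {n})}.Finite := by
    intro k
    refine Measure.finite_const_le_meas_of_disjoint_iUnion ν
        (pos_iff_ne_zero.2 (mul_ne_zero hl0 (hv0 k)))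
      (fun n => hmeas k n) ?_ (measure_ne_top _ _)
    intro a b hab
    exact Disjoint.preimage _ (by simpa using hab)
  let P : ℕ × ι → Prop := fun q => q.1 ≤ K ∧ l * v q.1 < ν (idx q.1 ⁻¹' {q.2}) ∧
    ∃ z, idx q.1 z = q.2 ∧ ∀ j < q.1, ν (idx j ⁻¹' {idx j z}) ≤ l * v j
  have hPfin : {q | P q}.Finite := by
    refine ((Finset.range (K+1)).finite_toSet.biUnion
      (t := fun k => (fun n => (k, n)) '' {n | l * v k ≤ ν (idx k ⁻¹' {n})})
      (fun k _ => (hfin k).image _)).subset ?_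
    rintro ⟨k, n⟩ ⟨h1, h2, -⟩
    simp only [mem_iUnion]
    exact ⟨k, by simpa using Nat.lt_succ_of_le h1, n, h2.le, rfl⟩
  have key : ∀ q q', P q → P q' → ∀ w, idx q.1 w = q.2 → idx q'.1 w = q'.2 →
      q.1 < q'.1 → False := by
    rintro ⟨k, n⟩ ⟨k', n'⟩ ⟨_, h2, _⟩ ⟨_, _, z', hz', h3'⟩ w hw hw' hlt
    have := h3' k hlt
    rw [hnest' k k' hlt.le z' w (hz'.trans hw'.symm)] at this
    simp only at hw
    rw [hw] at this
    exact absurd h2 (not_lt.2 this)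
  refine ⟨hPfin.toFinset, ?_, ?_, ?_⟩
  · intro q hq q' hq' hne
    rw [Finite.mem_toFinset] at hq hq'
    rw [Set.disjoint_left]
    intro w hw hw'
    rcases lt_trichotomy q.1 q'.1 with h | h | h
    · exact key q q' hq hq' w hw hw' h
    · apply hne
      have e1 : idx q.1 w = q.2 := hw
      have e2 : idx q'.1 w = q'.2 := hw'
      exact Prod.ext h (by rw [← e1, ← e2, h])
    · exact key q' q hq' hq w hw' hw h
  · intro q hq
    rw [Finite.mem_toFinset] at hq
    obtain ⟨k, n⟩ := q
    obtain ⟨_, h2, z, hz, h3⟩ := hq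
    refine ⟨h2.le, ?_, z, hz⟩
    simp only at h2 h3 hz ⊢
    cases k with
    | zero => exact absurd ((measure_mono (subset_univ _)).trans h0) (not_le.2 h2)
    | succ k =>
      have := h3 k (Nat.lt_succ_self k)
      rw [hD k] at this
      calc ν (idx (k+1) ⁻¹' {n}) ≤ ν (idx k ⁻¹' {idx k z}) := by
            apply measure_mono
            intro w hw
            exact hnest k w z (Eq.trans hw hz.symm)
        _ ≤ _ := this
        _ = _ := by ring
  · intro z hz
    by_contra! hcon
    have hex : ∃ k, l * v k < ν (idx k ⁻¹' {idx k z}) := ⟨K, hcon⟩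
    refine hz (Nat.find hex, idx (Nat.find hex) z) ?_ rfl
    rw [Finite.mem_toFinset]
    exact ⟨Nat.find_min' hex hcon, Nat.find_spec hex, z, rfl,
        fun j hj => not_lt.1 (Nat.find_min hex hj)⟩

/-- Convolution on space-time. -/
def conv {N : ℕ} (K f : RN N × ℝ → ℝ) (z : RN N × ℝ) : ℝ := ∫ w, K (z - w) * f w

theorem floor_eq_floor_of_mul {a b : ℝ} (n : ℕ) (hn : 0 < n)
    (h : ⌊(n : ℝ) * a⌋ = ⌊(n : ℝ) * b⌋) : ⌊a⌋ = ⌊b⌋ := by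
  have key : ∀ a b : ℝ, ⌊(n : ℝ) * a⌋ = ⌊(n : ℝ) * b⌋ → ⌊a⌋ ≤ ⌊b⌋ := by
    intro a b h
    have h1 : ((n : ℤ) * ⌊a⌋ : ℤ) ≤ ⌊(n : ℝ) * b⌋ := by
      rw [← h, Int.le_floor]
      push_cast
      exact mul_le_mul_of_nonneg_left (Int.floor_le a) (by positivity)
    rw [Int.le_floor] at h1 ⊢
    push_cast at h1
    exact le_of_mul_le_mul_left h1 (by exact_mod_cast hn)
  exact le_antisymm (key a b h) (key b a h.symm)

/-- The index of the parabolic cell of size `l` containing `z`. -/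
def cellIdx (N : ℕ) (l : ℝ) (z : RN N × ℝ) : (Fin N → ℤ) × ℤ :=
  (fun i => ⌊z.1 i / l⌋, ⌊z.2 / l ^ 2⌋)

theorem cellIdx_preimage {N : ℕ} {l : ℝ} (hl : 0 < l) (n : (Fin N → ℤ) × ℤ) :
    cellIdx N l ⁻¹' {n} = (Set.pi univ fun i => Ico (n.1 i * l) ((n.1 i + 1) * l)) ×ˢ
      Ico (n.2 * l ^ 2) ((n.2 + 1) * l ^ 2) := by
  ext z
  have hl2 : 0 < l ^ 2 := by positivity
  simp [cellIdx, Prod.ext_iff, funext_iff, Int.floor_eq_iff, le_div_iff₀ hl, div_lt_iff₀ hl,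
    le_div_iff₀ hl2, div_lt_iff₀ hl2]

theorem measurableSet_cell {N : ℕ} {l : ℝ} (hl : 0 < l) (n : (Fin N → ℤ) × ℤ) :
    MeasurableSet (cellIdx N l ⁻¹' {n}) := by
  rw [cellIdx_preimage hl]
  exact (MeasurableSet.univ_pi fun i => measurableSet_Ico).prod measurableSet_Ico

theorem volume_cell {N : ℕ} {l : ℝ} (hl : 0 < l) (n : (Fin N → ℤ) × ℤ) :
    volume (cellIdx N l ⁻¹' {n}) = ENNReal.ofReal (l ^ (N + 2)) := by
  rw [cellIdx_preimage hl, Measure.volume_eq_prod, Measure.prod_prod, Real.volume_pi_Ico,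
    Real.volume_Ico]
  have h1 : ∀ i, (n.1 i + 1 : ℝ) * l - n.1 i * l = l := fun i => by ring
  have h2 : ((n.2 + 1 : ℝ) * l ^ 2 - n.2 * l ^ 2) = l ^ 2 := by ring
  simp only [h1, h2, Finset.prod_const, Finset.card_univ, Fintype.card_fin]
  rw [← ENNReal.ofReal_pow hl.le, ← ENNReal.ofReal_mul (by positivity), ← pow_add]

theorem cellIdx_nested {N : ℕ} {l : ℝ} {z w : RN N × ℝ}
    (h : cellIdx N (l / 2) z = cellIdx N (l / 2) w) : cellIdx N l z = cellIdx N l w := by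
  simp only [cellIdx, Prod.mk.injEq, funext_iff] at h ⊢
  refine ⟨fun i => floor_eq_floor_of_mul 2 (by norm_num) ?_,
    floor_eq_floor_of_mul 4 (by norm_num) ?_⟩
  · have := h.1 i
    convert this using 2 <;> (push_cast; field_simp)
  · have := h.2
    convert this using 2 <;> (push_cast; field_simp; try ring)

theorem abs_sub_le_of_floor_eq {a b l : ℝ} (hl : 0 < l) (h : ⌊a / l⌋ = ⌊b / l⌋) : |a - b| ≤ l := by
  have := Int.abs_sub_lt_one_of_floor_eq_floor h
  rw [← sub_div, abs_div, abs_of_pos hl, div_lt_one hl] at this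
  exact this.le

theorem dist_le_of_cellIdx_eq {N : ℕ} {l : ℝ} (hl : 0 < l) {z w : RN N × ℝ}
    (h : cellIdx N l z = cellIdx N l w) : ‖z.1 - w.1‖ ≤ l ∧ |z.2 - w.2| ≤ l ^ 2 := by
  simp only [cellIdx, Prod.mk.injEq, funext_iff] at h
  refine ⟨(pi_norm_le_iff_of_nonneg hl.le).2 fun i => abs_sub_le_of_floor_eq hl (h.1 i),
    abs_sub_le_of_floor_eq (by positivity) h.2⟩

theorem enorm_integral_mul_le {α : Type*} [MeasurableSpace α] {μ : Measure α} (f g : α → ℝ) :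
    ‖∫ w, f w * g w ∂μ‖ₑ ≤ ∫⁻ w, ‖f w‖ₑ * ‖g w‖ₑ ∂μ := by
  refine (enorm_integral_le_lintegral_enorm _).trans (le_of_eq ?_)
  simp [enorm_mul]

theorem integrable_kernel_mul {N : ℕ} {K b : RN N × ℝ → ℝ} (hK : Measurable K) {M : ℝ}
    (hM : ∀ z, |K z| ≤ M) (hb : Integrable b) (z : RN N × ℝ) :
    Integrable fun w => K (z - w) * b w :=
  hb.bdd_mul (c := M) (hK.comp (by fun_prop)).aestronglyMeasurable
      (Eventually.of_forall fun w => hM _)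

theorem lintegral_conv_le_of_integral_eq_zero {N : ℕ} {K b : RN N × ℝ → ℝ} (hK : Measurable K)
    {M : ℝ} (hM : ∀ z, |K z| ≤ M) (hb : Integrable b) (hbm : Measurable b) (hb0 : ∫ w, b w = 0)
    {Q : Set (RN N × ℝ)} (hbQ : ∀ w ∉ Q, b w = 0) (c : RN N × ℝ) (E : Set (RN N × ℝ)) {B : ℝ≥0∞}
    (hB : ∀ w ∈ Q, ∫⁻ z in E, ‖K (z - w) - K (z - c)‖ₑ ≤ B) :
    ∫⁻ z in E, ‖conv K b z‖ₑ ≤ B * ∫⁻ w, ‖b w‖ₑ := by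
  have h1 : ∀ z, conv K b z = ∫ w, (K (z - w) - K (z - c)) * b w := by
    intro z
    simp only [sub_mul]
    rw [integral_sub (integrable_kernel_mul hK hM hb z) (hb.const_mul _), integral_const_mul, hb0]
    simp [conv]
  calc ∫⁻ z in E, ‖conv K b z‖ₑ
      ≤ ∫⁻ z in E, ∫⁻ w, ‖K (z - w) - K (z - c)‖ₑ * ‖b w‖ₑ := by
        gcongr with z
        rw [h1]
        exact enorm_integral_mul_le _ _
    _ = ∫⁻ w, ∫⁻ z in E, ‖K (z - w) - K (z - c)‖ₑ * ‖b w‖ₑ := by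
        rw [lintegral_lintegral_swap]
        fun_prop
    _ ≤ ∫⁻ w, B * ‖b w‖ₑ := by
        refine lintegral_mono fun w => ?_
        rw [lintegral_mul_const _ (by fun_prop)]
        by_cases hw : w ∈ Q
        · exact mul_le_mul_left (hB w hw) _
        · simp [hbQ w hw]
    _ = _ := lintegral_const_mul _ (by fun_prop)

/-- Calderón–Zygmund kernels for the parabolic scaling, with constant `B`. -/
structure CZKernel {N : ℕ} (K : RN N × ℝ → ℝ) (B : ℝ≥0) : Prop where
  meas : Measurable K
  bdd : ∃ M, ∀ z, |K z| ≤ M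
  int : Integrable K
  l2 : ∀ g : RN N × ℝ → ℝ, Measurable g → Integrable g → (∃ M, ∀ z, |g z| ≤ M) →
    ∫⁻ z, ‖conv K g z‖ₑ ^ 2 ≤ (B : ℝ≥0∞) ^ 2 * ∫⁻ z, ‖g z‖ₑ ^ 2
  horm : ∀ l : ℝ, 0 < l → ∀ h : RN N × ℝ, ‖h.1‖ ≤ l → |h.2| ≤ l ^ 2 →
    ∫⁻ z in {z : RN N × ℝ | 2 * l < ‖z.1‖ ∨ 4 * l ^ 2 < |z.2|}, ‖K (z - h) - K z‖ₑ ≤ B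

theorem conv_add {N : ℕ} {K f g : RN N × ℝ → ℝ} (hK : Measurable K) {M : ℝ}
    (hM : ∀ z, |K z| ≤ M) (hf : Integrable f) (hg : Integrable g) (z : RN N × ℝ) :
    conv K (fun w => f w + g w) z = conv K f z + conv K g z := by
  simp only [conv, mul_add]
  exact integral_add (integrable_kernel_mul hK hM hf z) (integrable_kernel_mul hK hM hg z)

theorem conv_finset_sum {N : ℕ} {K : RN N × ℝ → ℝ} (hK : Measurable K) {M : ℝ}
    (hM : ∀ z, |K z| ≤ M) {ι : Type*} (S : Finset ι) (b : ι → RN N × ℝ → ℝ)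
    (hb : ∀ i ∈ S, Integrable (b i)) (z : RN N × ℝ) :
    conv K (fun w => ∑ i ∈ S, b i w) z = ∑ i ∈ S, conv K (b i) z := by
  simp only [conv, Finset.mul_sum]
  exact integral_finsetSum _ fun i hi => integrable_kernel_mul hK hM (hb i hi) z

theorem measurable_conv {N : ℕ} {K f : RN N × ℝ → ℝ} (hK : Measurable K) (hf : Measurable f) :
    Measurable (conv K f) := by
  have : StronglyMeasurable (Function.uncurry fun z w : RN N × ℝ => K (z - w) * f w) := by
    apply Measurable.stronglyMeasurable
    unfold Function.uncurry
    fun_prop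
  exact this.integral_prod_right.measurable

theorem volume_parabolic_box {N : ℕ} (c : RN N × ℝ) {l : ℝ} (hl : 0 < l) :
    volume {z : RN N × ℝ | ‖z.1 - c.1‖ ≤ 2 * l ∧ |z.2 - c.2| ≤ 4 * l ^ 2}
      = ENNReal.ofReal (4 ^ N * 8) * ENNReal.ofReal (l ^ (N + 2)) := by
  have : {z : RN N × ℝ | ‖z.1 - c.1‖ ≤ 2 * l ∧ |z.2 - c.2| ≤ 4 * l ^ 2}
      = Metric.closedBall c.1 (2 * l) ×ˢ Metric.closedBall c.2 (4 * l ^ 2) := by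
    ext z; simp [Metric.mem_closedBall, dist_eq_norm]
  rw [this, Measure.volume_eq_prod, Measure.prod_prod, Real.volume_pi_closedBall _ (by positivity),
    Real.volume_closedBall, ← ENNReal.ofReal_mul (by positivity),
    ← ENNReal.ofReal_mul (by positivity)]
  congr 1
  rw [Fintype.card_fin]
  ring

/-- The parabolic Calderón–Zygmund decomposition. -/
theorem exists_CZ_decomposition {N : ℕ} {f : RN N × ℝ → ℝ} (hf : Continuous f)
    (hfc : HasCompactSupport f) {s : ℝ} (hs : 0 < s) :
    ∃ (S : Finset (ℕ × ((Fin N → ℤ) × ℤ))) (len : ℕ → ℝ), (∀ k, 0 < len k) ∧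
      (∀ q ∈ S, ∀ q' ∈ S, q ≠ q' →
        Disjoint (cellIdx N (len q.1) ⁻¹' {q.2}) (cellIdx N (len q'.1) ⁻¹' {q'.2})) ∧
      (∀ q ∈ S, ENNReal.ofReal s * ENNReal.ofReal (len q.1 ^ (N + 2)) ≤
          ∫⁻ w in cellIdx N (len q.1) ⁻¹' {q.2}, ‖f w‖ₑ ∧
        ∫⁻ w in cellIdx N (len q.1) ⁻¹' {q.2}, ‖f w‖ₑ ≤
          ENNReal.ofReal (2 ^ (N + 2)) *
            (ENNReal.ofReal s * ENNReal.ofReal (len q.1 ^ (N + 2))) ∧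
        ∃ z, cellIdx N (len q.1) z = q.2) ∧
      ∀ z, (∀ q ∈ S, cellIdx N (len q.1) z ≠ q.2) → |f z| ≤ 2 * s := by
  have hfi : Integrable f := hf.integrable_of_hasCompactSupport hfc
  set I := ∫⁻ w, ‖f w‖ₑ with hI
  have hItop : I ≠ ∞ := hfi.2.ne
  set L : ℝ := max 1 (I.toReal / s) with hL
  have hL1 : 1 ≤ L := le_max_left _ _
  have hL0 : 0 < L := by linarith
  set len : ℕ → ℝ := fun k => L / 2 ^ k with hlen
  have hlpos : ∀ k, 0 < len k := fun k => by positivity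
  have hlsucc : ∀ k, len (k + 1) = len k / 2 := fun k => by simp only [hlen, pow_succ]; field_simp
  set ν : Measure (RN N × ℝ) := volume.withDensity fun w => ‖f w‖ₑ with hν
  have hνapp : ∀ k n, ν (cellIdx N (len k) ⁻¹' {n}) = ∫⁻ w in cellIdx N (len k) ⁻¹' {n}, ‖f w‖ₑ :=
    fun k n => withDensity_apply _ (measurableSet_cell (hlpos k) n)
  have : IsFiniteMeasure ν := isFiniteMeasure_withDensity hItop
  obtain ⟨δ, hδ, hunif⟩ := Metric.uniformContinuous_iff.1
    (hfc.uniformContinuous_of_continuous hf) (s / 2) (by positivity)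
  obtain ⟨K, hK⟩ : ∃ K, len K < min δ 1 := by
    have : Tendsto len atTop (𝓝 0) := by
      have := (tendsto_pow_atTop_nhds_zero_of_lt_one (r := (1/2 : ℝ)) (by norm_num)
        (by norm_num)).const_mul L
      simpa [hlen, div_eq_mul_inv] using this
    exact (this.eventually_lt_const (lt_min hδ one_pos)).exists
  obtain ⟨S, h1, h2, h3⟩ := exists_stopping_cells ν (fun k => cellIdx N (len k))
    (fun k n => measurableSet_cell (hlpos k) n)
    (fun k z w h => cellIdx_nested (by simp only [hlsucc] at h; exact h))
    (fun k => ENNReal.ofReal (len k ^ (N + 2)))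
    (fun k => by simpa using pow_pos (hlpos k) _)
    (ENNReal.ofReal (2 ^ (N + 2)))
    (fun k => by
      rw [← ENNReal.ofReal_mul (by positivity), hlsucc, ← mul_pow]
      congr 2
      ring)
    (ENNReal.ofReal s) (by simpa using hs) (by
      rw [hν, withDensity_apply _ MeasurableSet.univ, setLIntegral_univ, ← hI,
        ← ENNReal.ofReal_mul hs.le, ← ENNReal.ofReal_toReal hItop]
      apply ENNReal.ofReal_le_ofReal
      have : I.toReal / s ≤ L := le_max_right _ _
      have h5 : L ≤ L ^ (N + 2) := le_self_pow₀ hL1 (by omega)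
      have : len 0 = L := by simp [hlen]
      rw [this, mul_comm, ← div_le_iff₀ hs]
      linarith) K
  refine ⟨S, len, hlpos, h1, ?_, ?_⟩
  · simpa only [hνapp] using h2
  · intro z hz
    by_contra! hcon
    have h4 := h3 z hz
    simp only [hνapp] at h4
    have h5 : ∀ w ∈ cellIdx N (len K) ⁻¹' {cellIdx N (len K) z}, ENNReal.ofReal (3 / 2 * s)
        ≤ ‖f w‖ₑ := by
      intro w hw
      obtain ⟨d1, d2⟩ := dist_le_of_cellIdx_eq (hlpos K) hw
      have hd : dist w z < δ := by
        have e1 : len K < δ := hK.trans_le (min_le_left _ _)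
        have e2 : len K < 1 := hK.trans_le (min_le_right _ _)
        rw [Prod.dist_eq, max_lt_iff, dist_eq_norm, Real.dist_eq]
        have := hlpos K
        exact ⟨by linarith, by nlinarith⟩
      have := hunif hd
      rw [Real.dist_eq] at this
      rw [← ofReal_norm, Real.norm_eq_abs]
      apply ENNReal.ofReal_le_ofReal
      have := abs_sub_abs_le_abs_sub (f z) (f w)
      rw [abs_sub_comm] at this
      linarith
    have h6 := setLIntegral_mono' (μ := volume) (measurableSet_cell (hlpos K) _) h5
    rw [setLIntegral_const, volume_cell (hlpos K)] at h6
    have h7 := h6.trans h4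
    rw [← ENNReal.ofReal_mul (by positivity), ← ENNReal.ofReal_mul (by positivity),
      ENNReal.ofReal_le_ofReal_iff (by have := hlpos K; positivity)] at h7
    have := pow_pos (hlpos K) (N + 2)
    nlinarith

instance (N : ℕ) : (volume : Measure (RN N × ℝ)).IsAddHaarMeasure :=
  Measure.prod.instIsAddHaarMeasure volume volume

theorem integral_indicator_sub_average {α : Type*} [MeasurableSpace α] {μ : Measure α}
    {Q : Set α} (hQ : MeasurableSet Q) {f : α → ℝ} (hf : Integrable f μ) {v : ℝ} (hv : 0 < v)
    (hμ : μ Q = ENNReal.ofReal v) :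
    ∫ w, Q.indicator (fun w => f w - (∫ w in Q, f w ∂μ) / v) w ∂μ = 0 := by
  rw [integral_indicator hQ, integral_sub hf.integrableOn
    (integrableOn_const (by rw [hμ]; exact ENNReal.ofReal_ne_top)), setIntegral_const,
    Measure.real, hμ, ENNReal.toReal_ofReal hv.le, smul_eq_mul]
  field_simp
  simp

theorem lintegral_indicator_sub_average_le {α : Type*} [MeasurableSpace α] {μ : Measure α}
    {Q : Set α} (hQ : MeasurableSet Q) {f : α → ℝ} (hfm : Measurable f) {v : ℝ} (hv : 0 < v)
    (hμ : μ Q = ENNReal.ofReal v) :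
    ∫⁻ w, ‖Q.indicator (fun w => f w - (∫ w in Q, f w ∂μ) / v) w‖ₑ ∂μ
      ≤ 2 * ∫⁻ w in Q, ‖f w‖ₑ ∂μ := by
  have h0 : ENNReal.ofReal v ≠ 0 := by simpa using hv
  have h1 : ∀ w, ‖Q.indicator (fun w => f w - (∫ w in Q, f w ∂μ) / v) w‖ₑ
      = Q.indicator (fun w => ‖f w - (∫ w in Q, f w ∂μ) / v‖ₑ) w := fun w => by
    by_cases h : w ∈ Q <;> simp [h]
  simp only [h1]
  rw [lintegral_indicator hQ]
  calc ∫⁻ w in Q, ‖f w - (∫ w in Q, f w ∂μ) / v‖ₑ ∂μ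
      ≤ ∫⁻ w in Q, (‖f w‖ₑ + ‖(∫ w in Q, f w ∂μ) / v‖ₑ) ∂μ :=
        lintegral_mono fun w => enorm_sub_le
    _ = ∫⁻ w in Q, ‖f w‖ₑ ∂μ + ‖(∫ w in Q, f w ∂μ) / v‖ₑ * ENNReal.ofReal v := by
        rw [lintegral_add_left (by fun_prop), setLIntegral_const, hμ]
    _ = ∫⁻ w in Q, ‖f w‖ₑ ∂μ + ‖∫ w in Q, f w ∂μ‖ₑ := by
        congr 1
        conv_lhs => rw [← abs_of_pos hv, ← Real.norm_eq_abs, ofReal_norm, ← enorm_mul,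
          Real.norm_eq_abs, abs_of_pos hv, div_mul_cancel₀ _ hv.ne']
    _ ≤ _ := by
        rw [two_mul]
        gcongr
        exact enorm_integral_le_lintegral_enorm _

theorem CZKernel.weak {N : ℕ} {K : RN N × ℝ → ℝ} {B : ℝ≥0} (hK : CZKernel K B)
    {f : RN N × ℝ → ℝ} (hf : Continuous f) (hfc : HasCompactSupport f) {s : ℝ} (hs : 0 < s) :
    volume {z | s < |conv K f z|} * ENNReal.ofReal s ≤
      ENNReal.ofReal (12 * B ^ 2 * 2 ^ (N + 2) + 4 ^ N * 8 + 4 * B) * ∫⁻ w, ‖f w‖ₑ := by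
  classical
  obtain ⟨S, len, hlen, hdisj, hS, hoff⟩ := exists_CZ_decomposition hf hfc hs
  have hfi : Integrable f := hf.integrable_of_hasCompactSupport hfc
  set Q : ℕ × ((Fin N → ℤ) × ℤ) → Set (RN N × ℝ) := fun q => cellIdx N (len q.1) ⁻¹' {q.2} with hQ
  have hQm : ∀ q, MeasurableSet (Q q) := fun q => measurableSet_cell (hlen _) _
  set v : ℕ × ((Fin N → ℤ) × ℤ) → ℝ := fun q => len q.1 ^ (N + 2) with hv
  have hv0 : ∀ q, 0 < v q := fun q => pow_pos (hlen _) _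
  have hQv : ∀ q, volume (Q q) = ENNReal.ofReal (v q) := fun q => volume_cell (hlen _) _
  set a : ℕ × ((Fin N → ℤ) × ℤ) → ℝ := fun q => (∫ w in Q q, f w) / v q with ha
  set b : ℕ × ((Fin N → ℤ) × ℤ) → RN N × ℝ → ℝ := fun q => (Q q).indicator (fun w => f w - a q)
    with hb
  set I := ∫⁻ w, ‖f w‖ₑ with hI
  set D : ℝ := 2 ^ (N + 2) with hD
  have hD0 : 2 ≤ D := by
    rw [hD]; calc (2:ℝ) = 2 ^ 1 := by norm_num
      _ ≤ _ := pow_le_pow_right₀ (by norm_num) (by omega)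
  have hsum : ∑ q ∈ S, ∫⁻ w in Q q, ‖f w‖ₑ ≤ I := by
    rw [← lintegral_biUnion_finset (fun q hq q' hq' hne => hdisj q hq q' hq' hne)
      (fun q _ => hQm q)]
    exact setLIntegral_le_lintegral _ _
  have hbi : ∀ q, Integrable (b q) := fun q => by
    rw [hb, integrable_indicator_iff (hQm q)]
    exact hfi.integrableOn.sub (integrableOn_const (by rw [hQv]; exact ENNReal.ofReal_ne_top))
  have hbm : ∀ q, Measurable (b q) := fun q =>
    (hf.measurable.sub measurable_const).indicator (hQm q)
  have hb0 : ∀ q, ∫ w, b q w = 0 :=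
      fun q => integral_indicator_sub_average (hQm q) hfi (hv0 q) (hQv q)
  have hb1 : ∀ q, ∫⁻ w, ‖b q w‖ₑ ≤ 2 * ∫⁻ w in Q q, ‖f w‖ₑ := fun q =>
    lintegral_indicator_sub_average_le (hQm q) hf.measurable (hv0 q) (hQv q)
  have hbsum : ∑ q ∈ S, ∫⁻ w, ‖b q w‖ₑ ≤ 2 * I := by
    refine (Finset.sum_le_sum fun q _ => hb1 q).trans ?_
    rw [← Finset.mul_sum]
    gcongr
  have ha1 : ∀ q ∈ S, |a q| ≤ D * s := by
    intro q hq
    have h1 := (enorm_integral_le_lintegral_enorm (μ := volume.restrict (Q q)) f).trans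
        (hS q hq).2.1
    rw [← ENNReal.ofReal_mul hs.le, ← ENNReal.ofReal_mul (by positivity), ← ofReal_norm,
      ENNReal.ofReal_le_ofReal_iff (by have := hv0 q; positivity), Real.norm_eq_abs] at h1
    rw [ha, abs_div, abs_of_pos (hv0 q), div_le_iff₀ (hv0 q)]
    rw [mul_assoc]; exact h1
  set g : RN N × ℝ → ℝ := fun w => f w + - ∑ q ∈ S, b q w with hg
  have hsi : Integrable fun w => ∑ q ∈ S, b q w := integrable_finsetSum _ fun q _ => hbi q
  have hgi : Integrable g := hfi.add hsi.neg
  have hgm : Measurable g := hf.measurable.add (Finset.measurable_sum _ fun q _ => hbm q).neg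
  have hgb : ∀ w, |g w| ≤ D * s := by
    intro w
    by_cases hw : ∃ q ∈ S, w ∈ Q q
    · obtain ⟨q, hq, hwq⟩ := hw
      have : ∑ q ∈ S, b q w = f w - a q := by
        rw [Finset.sum_eq_single q]
        · simp [hb, hwq]
        · intro q' hq' hne
          have : w ∉ Q q' := fun h => Set.disjoint_left.1 (hdisj q' hq' q hq hne) h hwq
          simp [hb, this]
        · exact fun h => absurd hq h
      rw [hg]
      simp only [this]
      convert ha1 q hq using 2
      ring
    · push Not at hw
      have : ∑ q ∈ S, b q w = 0 := Finset.sum_eq_zero fun q hq => by simp [hb, hw q hq]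
      rw [hg]
      simp only [this, neg_zero, add_zero]
      refine (hoff w fun q hq h => hw q hq h).trans ?_
      gcongr
  have hg1 : ∫⁻ w, ‖g w‖ₑ ≤ 3 * I := by
    calc ∫⁻ w, ‖g w‖ₑ ≤ ∫⁻ w, (‖f w‖ₑ + ∑ q ∈ S, ‖b q w‖ₑ) := by
          refine lintegral_mono fun w => ?_
          refine (enorm_add_le _ _).trans ?_
          rw [enorm_neg]
          gcongr
          exact enorm_sum_le _ _
      _ = I + ∑ q ∈ S, ∫⁻ w, ‖b q w‖ₑ := by
          rw [lintegral_add_left (by fun_prop), lintegral_finsetSum]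
          exact fun q _ => (hbm q).enorm
      _ ≤ I + 2 * I := by gcongr
      _ = 3 * I := by ring
  have hg2 : ∫⁻ w, ‖g w‖ₑ ^ 2 ≤ ENNReal.ofReal (D * s) * (3 * I) := by
    calc ∫⁻ w, ‖g w‖ₑ ^ 2 ≤ ∫⁻ w, ENNReal.ofReal (D * s) * ‖g w‖ₑ := by
          refine lintegral_mono fun w => ?_
          rw [sq]
          gcongr
          rw [← ofReal_norm]
          exact ENNReal.ofReal_le_ofReal (hgb w)
      _ = ENNReal.ofReal (D * s) * ∫⁻ w, ‖g w‖ₑ := lintegral_const_mul _ (by fun_prop)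
      _ ≤ _ := by gcongr
  obtain ⟨M, hM⟩ := hK.bdd
  have hKf : ∀ z, conv K f z = conv K g z + ∑ q ∈ S, conv K (b q) z := by
    intro z
    rw [← conv_finset_sum hK.meas hM S b (fun q _ => hbi q), ← conv_add hK.meas hM hgi hsi]
    congr 1
    funext w
    simp [hg]
  choose! c hc using fun q hq => (hS q hq).2.2
  set W : ℕ × ((Fin N → ℤ) × ℤ) → Set (RN N × ℝ) := fun q =>
    {z | ‖z.1 - (c q).1‖ ≤ 2 * len q.1 ∧ |z.2 - (c q).2| ≤ 4 * len q.1 ^ 2} with hW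
  have hWm : ∀ q, MeasurableSet (W q) := fun q => by
    apply IsClosed.measurableSet
    exact (isClosed_le (f := fun z : RN N × ℝ => ‖z.1 - (c q).1‖) (g := fun _ => 2 * len q.1)
      (by fun_prop) (by fun_prop)).inter (isClosed_le (f := fun z : RN N × ℝ => |z.2 - (c q).2|)
      (g := fun _ => 4 * len q.1 ^ 2) (by fun_prop) (by fun_prop))
  set U := ⋃ q ∈ S, W q with hU
  have hUm : MeasurableSet U := Finset.measurableSet_biUnion _ fun q _ => hWm q
  set b' : RN N × ℝ → ℝ := fun z => ∑ q ∈ S, conv K (b q) z with hb'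
  have hb'm : Measurable b' := Finset.measurable_sum _ fun q _ => measurable_conv hK.meas (hbm q)
  have p1 : volume {z | s / 2 < |conv K g z|} * ENNReal.ofReal s ≤
      ENNReal.ofReal (12 * B ^ 2 * D) * I := by
    have h1 := mul_meas_ge_le_lintegral₀ (μ := volume) (f := fun z => ‖conv K g z‖ₑ ^ 2)
      (by have := measurable_conv hK.meas hgm; fun_prop) (ENNReal.ofReal (s / 2) ^ 2)
    have h2 : {z | s / 2 < |conv K g z|}
        ⊆ {z | ENNReal.ofReal (s / 2) ^ 2 ≤ ‖conv K g z‖ₑ ^ 2} := by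
      intro z hz
      simp only [mem_ofPred_eq] at hz ⊢
      gcongr
      rw [← ofReal_norm]
      exact ENNReal.ofReal_le_ofReal hz.le
    have h3 := (h1.trans (hK.l2 g hgm hgi ⟨_, hgb⟩)).trans (mul_le_mul_right hg2 _)
    have h4 : ENNReal.ofReal s = (ENNReal.ofReal (s / 2)) ^ 2 * ENNReal.ofReal (4 / s) := by
      rw [← ENNReal.ofReal_pow (by positivity), ← ENNReal.ofReal_mul (by positivity)]
      congr 1; field_simp; norm_num
    calc volume {z | s / 2 < |conv K g z|} * ENNReal.ofReal s
        ≤ ENNReal.ofReal (4 / s) * (ENNReal.ofReal (s / 2) ^ 2 *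
          volume {z | ENNReal.ofReal (s / 2) ^ 2 ≤ ‖conv K g z‖ₑ ^ 2}) := by
          rw [h4]
          calc _ = ENNReal.ofReal (4 / s) * (ENNReal.ofReal (s / 2) ^ 2 *
                volume {z | s / 2 < |conv K g z|}) := by ring
            _ ≤ _ := by gcongr
      _ ≤ ENNReal.ofReal (4 / s) * ((B:ℝ≥0∞) ^ 2 * (ENNReal.ofReal (D * s) * (3 * I))) := by gcongr
      _ = _ := by
          have : (B : ℝ≥0∞) = ENNReal.ofReal B := by simp
          have h3 : (3 : ℝ≥0∞) = ENNReal.ofReal 3 := by simp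
          rw [this, h3, ← ENNReal.ofReal_pow (by positivity), ← mul_assoc (ENNReal.ofReal (D * s)),
            ← mul_assoc, ← mul_assoc, ← ENNReal.ofReal_mul (by positivity),
            ← ENNReal.ofReal_mul (by positivity), ← ENNReal.ofReal_mul (by positivity)]
          congr 2
          field_simp
          ring
  have p2 : volume U * ENNReal.ofReal s ≤ ENNReal.ofReal (4 ^ N * 8) * I := by
    calc volume U * ENNReal.ofReal s ≤ (∑ q ∈ S, volume (W q)) * ENNReal.ofReal s := by
          gcongr
          exact measure_biUnion_finset_le _ _
      _ = ∑ q ∈ S, ENNReal.ofReal (4 ^ N * 8) * (ENNReal.ofReal s * ENNReal.ofReal (v q)) := by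
          rw [Finset.sum_mul]
          refine Finset.sum_congr rfl fun q _ => ?_
          rw [hW, volume_parabolic_box _ (hlen _)]
          ring
      _ ≤ ∑ q ∈ S, ENNReal.ofReal (4 ^ N * 8) * ∫⁻ w in Q q, ‖f w‖ₑ := by
          refine Finset.sum_le_sum fun q hq => ?_
          gcongr
          exact (hS q hq).1
      _ ≤ _ := by rw [← Finset.mul_sum]; gcongr
  have p3 : volume ({z | s / 2 < |b' z|} ∩ Uᶜ) * ENNReal.ofReal s ≤ ENNReal.ofReal (4 * B) * I := by
    have h0 : ∀ q ∈ S, ∫⁻ z in (W q)ᶜ, ‖conv K (b q) z‖ₑ ≤ B * ∫⁻ w, ‖b q w‖ₑ := by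
      intro q hq
      refine lintegral_conv_le_of_integral_eq_zero hK.meas hM (hbi q) (hbm q) (hb0 q) (Q := Q q)
        (fun w hw => by simp [hb, hw]) (c q) _ fun w hw => ?_
      obtain ⟨d1, d2⟩ := dist_le_of_cellIdx_eq (hlen q.1)
        (show cellIdx N (len q.1) w = cellIdx N (len q.1) (c q) from Eq.trans hw (hc q hq).symm)
      have h1 := hK.horm (len q.1) (hlen _) (w - c q) (by simpa using d1) (by simpa using d2)
      refine le_trans (le_of_eq ?_) h1
      have hWset : (W q)ᶜ = (fun z => z - c q) ⁻¹'
          {z : RN N × ℝ | 2 * len q.1 < ‖z.1‖ ∨ 4 * len q.1 ^ 2 < |z.2|} := by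
        ext z
        simp only [hW, mem_compl_iff, mem_ofPred_eq, mem_preimage, not_and_or, not_le, Prod.fst_sub,
          Prod.snd_sub]
      rw [hWset]
      have hmp : MeasurePreserving (fun z : RN N × ℝ => z - c q) volume volume :=
        measurePreserving_sub_right volume (c q)
      have := hmp.setLIntegral_comp_preimage_emb
          (MeasurableEquiv.subRight (c q)).measurableEmbedding
        (fun z => ‖K (z - (w - c q)) - K z‖ₑ)
          {z : RN N × ℝ | 2 * len q.1 < ‖z.1‖ ∨ 4 * len q.1 ^ 2 < |z.2|}
      rw [← this]
      refine lintegral_congr fun z => ?_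
      congr 3
      abel
    have h1 : ∫⁻ z in Uᶜ, ‖b' z‖ₑ ≤ B * (2 * I) := by
      calc ∫⁻ z in Uᶜ, ‖b' z‖ₑ ≤ ∫⁻ z in Uᶜ, ∑ q ∈ S, ‖conv K (b q) z‖ₑ :=
            lintegral_mono fun z => enorm_sum_le _ _
        _ = ∑ q ∈ S, ∫⁻ z in Uᶜ, ‖conv K (b q) z‖ₑ := lintegral_finsetSum _ fun q _ =>
            (measurable_conv hK.meas (hbm q)).enorm
        _ ≤ ∑ q ∈ S, B * ∫⁻ w, ‖b q w‖ₑ := by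
            refine Finset.sum_le_sum fun q hq => le_trans ?_ (h0 q hq)
            exact lintegral_mono_set (compl_subset_compl.2 (subset_biUnion_of_mem (u := W) hq))
        _ ≤ _ := by rw [← Finset.mul_sum]; gcongr
    have h2 := mul_meas_ge_le_lintegral₀ (μ := volume.restrict Uᶜ) (f := fun z => ‖b' z‖ₑ)
      hb'm.enorm.aemeasurable (ENNReal.ofReal (s / 2))
    rw [Measure.restrict_apply (measurableSet_le measurable_const hb'm.enorm)] at h2
    calc volume ({z | s / 2 < |b' z|} ∩ Uᶜ) * ENNReal.ofReal s
        ≤ volume ({z | ENNReal.ofReal (s / 2) ≤ ‖b' z‖ₑ} ∩ Uᶜ) * ENNReal.ofReal s := by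
          gcongr with z
          intro hz
          rw [← ofReal_norm]
          exact ENNReal.ofReal_le_ofReal (le_of_lt hz)
      _ = 2 * (ENNReal.ofReal (s / 2) * volume ({z | ENNReal.ofReal (s / 2) ≤ ‖b' z‖ₑ} ∩ Uᶜ)) := by
          have : ENNReal.ofReal s = 2 * ENNReal.ofReal (s / 2) := by
            rw [← ENNReal.ofReal_ofNat, ← ENNReal.ofReal_mul (by norm_num)]
            congr 1; ring
          rw [this]; ring
      _ ≤ 2 * (B * (2 * I)) := by exact mul_le_mul_right (h2.trans h1) _
      _ = _ := by
          rw [ENNReal.ofReal_mul (by norm_num), ENNReal.ofReal_ofNat, ENNReal.ofReal_coe_nnreal]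
          ring
  have hsub : {z | s < |conv K f z|}
      ⊆ {z | s / 2 < |conv K g z|} ∪ U ∪ ({z | s / 2 < |b' z|} ∩ Uᶜ) := by
    intro z hz
    by_cases hzU : z ∈ U
    · exact Or.inl (Or.inr hzU)
    · by_cases h1 : s / 2 < |conv K g z|
      · exact Or.inl (Or.inl h1)
      · refine Or.inr ⟨?_, hzU⟩
        simp only [mem_ofPred_eq, not_lt] at hz h1 ⊢
        rw [hKf] at hz
        have := abs_add_le (conv K g z) (∑ q ∈ S, conv K (b q) z)
        simp only [hb']
        linarith
  calc volume {z | s < |conv K f z|} * ENNReal.ofReal s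
      ≤ (volume {z | s / 2 < |conv K g z|} + volume U + volume ({z | s / 2 < |b' z|} ∩ Uᶜ))
          * ENNReal.ofReal s := by
        gcongr
        exact (measure_mono hsub).trans ((measure_union_le _ _).trans
          (add_le_add_left (measure_union_le _ _) _))
    _ ≤ ENNReal.ofReal (12 * B ^ 2 * D) * I + ENNReal.ofReal (4 ^ N * 8) * I
          + ENNReal.ofReal (4 * B) * I := by
        rw [add_mul, add_mul]
        gcongr
    _ = _ := by
        rw [← add_mul, ← add_mul, ← ENNReal.ofReal_add (by positivity) (by positivity),
          ← ENNReal.ofReal_add (by positivity) (by positivity)]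

theorem lintegral_rpow_mul_ite_le {p : ℝ} (hp : 1 < p) {a : ℝ} (ha : 0 ≤ a) :
    ∫⁻ t in Ioi (0:ℝ), ENNReal.ofReal (t ^ (p - 2)) * ENNReal.ofReal (if t < a then a else 0)
      ≤ ENNReal.ofReal (1 / (p - 1)) * ENNReal.ofReal (a ^ p) := by
  have h1 : ∀ t : ℝ, ENNReal.ofReal (t ^ (p - 2)) * ENNReal.ofReal (if t < a then a else 0)
      = (Iio a).indicator (fun t => ENNReal.ofReal a * ENNReal.ofReal (t ^ (p - 2))) t := by
    intro t
    by_cases h : t < a <;> simp [h, mul_comm]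
  simp only [h1]
  rw [setLIntegral_indicator measurableSet_Iio, lintegral_const_mul _ (by fun_prop),
    inter_comm, Ioi_inter_Iio]
  have hi : IntervalIntegrable (fun x : ℝ => x ^ (p - 2)) volume 0 a :=
    intervalIntegral.intervalIntegrable_rpow' (by linarith)
  rw [intervalIntegrable_iff_integrableOn_Ioo_of_le ha] at hi
  rw [← ofReal_integral_eq_lintegral_ofReal hi
    ((ae_restrict_iff' measurableSet_Ioo).2
        (Eventually.of_forall fun t ht => Real.rpow_nonneg ht.1.le _)),
    ← integral_Ioc_eq_integral_Ioo, ← intervalIntegral.integral_of_le ha,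
    integral_rpow (Or.inl (by linarith)), ← ENNReal.ofReal_mul ha, ← ENNReal.ofReal_mul (by
      have : 0 < p - 1 := by linarith
      positivity)]
  apply ENNReal.ofReal_le_ofReal
  rw [Real.zero_rpow (by linarith), sub_zero, show p - 2 + 1 = p - 1 by ring]
  have : a * a ^ (p - 1) = a ^ p := by
    rcases ha.eq_or_lt with rfl | ha
    · rw [zero_mul, Real.zero_rpow (by linarith)]
    · rw [← Real.rpow_one_add' ha.le (by linarith)]; congr 1; ring
  rw [← mul_div_assoc, this]
  exact le_of_eq (by ring)

theorem lintegral_rpow_mul_min_sq_le {p : ℝ} (hp : 1 < p) (hp2 : p < 2) {a : ℝ} (ha : 0 ≤ a) :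
    ∫⁻ t in Ioi (0:ℝ), ENNReal.ofReal (t ^ (p - 3)) * ENNReal.ofReal (min a t ^ 2)
      ≤ ENNReal.ofReal (1 / p + 1 / (2 - p)) * ENNReal.ofReal (a ^ p) := by
  have h2p : 0 < 2 - p := by linarith
  rcases ha.eq_or_lt with rfl | ha
  · refine le_of_eq_of_le ?_ (zero_le)
    rw [setLIntegral_congr_fun (g := fun _ => 0) measurableSet_Ioi]
    · simp
    · intro t ht
      simp [min_eq_left (le_of_lt ht : (0:ℝ) ≤ t)]
  rw [← Ioc_union_Ioi_eq_Ioi ha.le]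
  refine (lintegral_union_le _ _ _).trans ?_
  rw [ENNReal.ofReal_add (by positivity) (by positivity), add_mul]
  refine add_le_add ?_ ?_
  · have hi : IntervalIntegrable (fun x : ℝ => x ^ (p - 1)) volume 0 a :=
      intervalIntegral.intervalIntegrable_rpow' (by linarith)
    rw [intervalIntegrable_iff_integrableOn_Ioc_of_le ha.le] at hi
    calc _ = ∫⁻ t in Ioc 0 a, ENNReal.ofReal (t ^ (p - 1)) := by
          refine setLIntegral_congr_fun measurableSet_Ioc fun t ht => ?_
          rw [min_eq_right ht.2, ← ENNReal.ofReal_mul (Real.rpow_nonneg ht.1.le _),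
            ← Real.rpow_natCast, ← Real.rpow_add ht.1]
          congr 2; push_cast; ring
      _ ≤ _ := by
          rw [← ofReal_integral_eq_lintegral_ofReal hi
            ((ae_restrict_iff' measurableSet_Ioc).2
              (Eventually.of_forall fun t ht => Real.rpow_nonneg ht.1.le _)),
            ← intervalIntegral.integral_of_le ha.le,
            integral_rpow (Or.inl (by linarith)), ← ENNReal.ofReal_mul (by positivity)]
          apply ENNReal.ofReal_le_ofReal
          rw [sub_add_cancel, Real.zero_rpow (by linarith), sub_zero]
          exact le_of_eq (by ring)
  · have hi := integrableOn_Ioi_rpow_of_lt (a := p - 3) (by linarith) ha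
    calc _ = ∫⁻ t in Ioi a, ENNReal.ofReal (a ^ 2) * ENNReal.ofReal (t ^ (p - 3)) := by
          refine setLIntegral_congr_fun measurableSet_Ioi fun t ht => ?_
          rw [min_eq_left (le_of_lt ht), mul_comm]
      _ ≤ _ := by
          rw [lintegral_const_mul _ (by fun_prop), ← ofReal_integral_eq_lintegral_ofReal hi
            ((ae_restrict_iff' measurableSet_Ioi).2
              (Eventually.of_forall fun t ht => Real.rpow_nonneg (ha.trans ht).le _)),
            integral_Ioi_rpow_of_lt (by linarith) ha, ← ENNReal.ofReal_mul (by positivity),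
            ← ENNReal.ofReal_mul (by positivity)]
          apply ENNReal.ofReal_le_ofReal
          have : a ^ p = a ^ 2 * a ^ (p - 3 + 1) := by
            rw [← Real.rpow_natCast, ← Real.rpow_add ha]
            congr 1; push_cast; ring
          rw [this, show p - 3 + 1 = -(2 - p) by ring, neg_div_neg_eq]
          exact le_of_eq (by ring)

theorem meas_lt_abs_mul_sq_le {α : Type*} [MeasurableSpace α] {μ : Measure α} {h : α → ℝ}
    (hh : Measurable h) (s : ℝ) :
    μ {z | s < |h z|} * ENNReal.ofReal s ^ 2 ≤ ∫⁻ z, ‖h z‖ₑ ^ 2 ∂μ := by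
  have h1 := mul_meas_ge_le_lintegral₀ (μ := μ) (f := fun z => ‖h z‖ₑ ^ 2)
    (by fun_prop) (ENNReal.ofReal s ^ 2)
  rw [mul_comm]
  refine le_trans ?_ h1
  gcongr with z
  intro hz
  gcongr
  rw [← ofReal_norm]
  exact ENNReal.ofReal_le_ofReal (le_of_lt hz)

/-- Truncation of a real number at height `t`. -/
def clampAt (t x : ℝ) : ℝ := max (-t) (min t x)

theorem abs_clampAt {t : ℝ} (ht : 0 ≤ t) (x : ℝ) : |clampAt t x| = min |x| t := by
  unfold clampAt
  rcases le_total |x| t with h | h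
  · have := abs_le.1 h
    rw [min_eq_right this.2, max_eq_right this.1, min_eq_left h]
  · rw [min_eq_right h]
    rcases le_total 0 x with h3 | h3
    · rw [abs_of_nonneg h3] at h
      rw [min_eq_left h, max_eq_right (by linarith), abs_of_nonneg ht]
    · rw [abs_of_nonpos h3] at h
      rw [min_eq_right (by linarith), max_eq_left (by linarith), abs_neg, abs_of_nonneg ht]

theorem abs_sub_clampAt_le {t : ℝ} (ht : 0 ≤ t) (x : ℝ) :
    |x - clampAt t x| ≤ if t < |x| then |x| else 0 := by
  unfold clampAt
  split_ifs with h
  · rcases le_total 0 x with h3 | h3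
    · rw [abs_of_nonneg h3] at h ⊢
      rw [min_eq_left h.le, max_eq_right (by linarith), abs_of_nonneg] <;> linarith
    · rw [abs_of_nonpos h3] at h ⊢
      rw [min_eq_right (by linarith), max_eq_left (by linarith), abs_of_nonpos] <;> linarith
  · have := abs_le.1 (not_lt.1 h)
    rw [min_eq_right this.2, max_eq_right this.1]
    simp

@[fun_prop]
theorem continuous_clampAt : Continuous fun q : ℝ × ℝ => clampAt q.1 q.2 := by
  unfold clampAt; fun_prop

theorem clampAt_zero {t : ℝ} (ht : 0 ≤ t) : clampAt t 0 = 0 := by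
  simp [clampAt, ht]

theorem CZKernel.meas_lt_abs_conv_le {N : ℕ} {K : RN N × ℝ → ℝ} {B : ℝ≥0} (hK : CZKernel K B)
    {f : RN N × ℝ → ℝ} (hf : Continuous f) (hfc : HasCompactSupport f) {t : ℝ} (ht : 0 < t) :
    volume {z | t < |conv K f z|} ≤
      ENNReal.ofReal (2 * (12 * B ^ 2 * 2 ^ (N + 2) + 4 ^ N * 8 + 4 * B)) *
          ENNReal.ofReal (t ^ (-1 : ℝ)) *
          (∫⁻ w, ENNReal.ofReal (if t < |f w| then |f w| else 0)) +
        ENNReal.ofReal (4 * B ^ 2) * ENNReal.ofReal (t ^ (-2 : ℝ)) *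
          ∫⁻ w, ENNReal.ofReal (min |f w| t ^ 2) := by
  set f₂ : RN N × ℝ → ℝ := fun z => clampAt t (f z) with hf₂
  set f₁ : RN N × ℝ → ℝ := fun z => f z - clampAt t (f z) with hf₁
  have c2 : Continuous f₂ := by fun_prop
  have c1 : Continuous f₁ := by fun_prop
  have s2 : HasCompactSupport f₂ := hfc.comp_left (g := clampAt t) (clampAt_zero ht.le)
  have s1 : HasCompactSupport f₁ := hfc.comp_left (g := fun x => x - clampAt t x)
    (by simp [clampAt_zero ht.le])
  have i1 := c1.integrable_of_hasCompactSupport (μ := volume) s1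
  have i2 := c2.integrable_of_hasCompactSupport (μ := volume) s2
  obtain ⟨M, hM⟩ := hK.bdd
  have hsum : ∀ z, conv K f z = conv K f₁ z + conv K f₂ z := fun z => by
    rw [← conv_add hK.meas hM i1 i2]
    simp [hf₁, hf₂]
  have hsub : {z | t < |conv K f z|}
      ⊆ {z | t / 2 < |conv K f₁ z|} ∪ {z | t / 2 < |conv K f₂ z|} := by
    intro z hz
    by_contra hcon
    simp only [mem_union, mem_ofPred_eq, not_or, not_lt] at hcon hz
    rw [hsum] at hz
    have := abs_add_le (conv K f₁ z) (conv K f₂ z)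
    linarith
  have e1 : volume {z | t / 2 < |conv K f₁ z|}
      ≤ ENNReal.ofReal (2 * (12 * B ^ 2 * 2 ^ (N + 2) + 4 ^ N * 8 + 4 * B)) *
          ENNReal.ofReal (t ^ (-1 : ℝ)) *
          (∫⁻ w, ENNReal.ofReal (if t < |f w| then |f w| else 0)) := by
    have h1 := hK.weak c1 s1 (half_pos ht)
    rw [← ENNReal.le_div_iff_mul_le (by simp [ht]) (by simp)] at h1
    refine h1.trans ?_
    rw [div_eq_mul_inv, ← ENNReal.ofReal_inv_of_pos (half_pos ht), Real.rpow_neg_one, inv_div,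
      div_eq_mul_inv, ENNReal.ofReal_mul (by norm_num), ENNReal.ofReal_mul (by norm_num)]
    have : ∫⁻ w, ‖f₁ w‖ₑ ≤ ∫⁻ w, ENNReal.ofReal (if t < |f w| then |f w| else 0) := by
      refine lintegral_mono fun w => ?_
      rw [← ofReal_norm]
      exact ENNReal.ofReal_le_ofReal (abs_sub_clampAt_le ht.le _)
    calc _ ≤ ENNReal.ofReal (12 * B ^ 2 * 2 ^ (N + 2) + 4 ^ N * 8 + 4 * B) *
          (∫⁻ w, ENNReal.ofReal (if t < |f w| then |f w| else 0)) *
            (ENNReal.ofReal 2 * ENNReal.ofReal t⁻¹) := by gcongr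
      _ = _ := by ring
  have e2 : volume {z | t / 2 < |conv K f₂ z|}
      ≤ ENNReal.ofReal (4 * B ^ 2) * ENNReal.ofReal (t ^ (-2 : ℝ)) *
          ∫⁻ w, ENNReal.ofReal (min |f w| t ^ 2) := by
    have hb : ∀ z, |f₂ z| ≤ t := fun z => by rw [hf₂, abs_clampAt ht.le]; exact min_le_right _ _
    have h1 := (meas_lt_abs_mul_sq_le (μ := volume) (measurable_conv hK.meas c2.measurable)
        (t / 2)).trans
      (hK.l2 f₂ c2.measurable i2 ⟨t, hb⟩)
    rw [← ENNReal.le_div_iff_mul_le (by simp [ht]) (by simp)] at h1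
    refine h1.trans (le_of_eq ?_)
    have : ∀ w, ‖f₂ w‖ₑ ^ 2 = ENNReal.ofReal (min |f w| t ^ 2) := fun w => by
      rw [← abs_clampAt ht.le, ENNReal.ofReal_pow (abs_nonneg _), ← Real.norm_eq_abs, ofReal_norm]
    simp only [this]
    rw [← ENNReal.ofReal_pow (by positivity), div_eq_mul_inv,
      ← ENNReal.ofReal_inv_of_pos (by positivity),
      Real.rpow_neg ht.le, mul_right_comm]
    congr 1
    have h3 : (B : ℝ≥0∞) = ENNReal.ofReal B := by simp
    rw [h3, ← ENNReal.ofReal_pow (by positivity), ← ENNReal.ofReal_mul (by positivity),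
      ← ENNReal.ofReal_mul (by positivity)]
    congr 1
    rw [Real.rpow_ofNat]
    field_simp
    norm_num
  exact (measure_mono hsub).trans ((measure_union_le _ _).trans (add_le_add e1 e2))

theorem CZKernel.strong_of_lt_two {N : ℕ} {K : RN N × ℝ → ℝ} {B : ℝ≥0} (hK : CZKernel K B)
    {p : ℝ} (hp : 1 < p) (hp2 : p < 2)
    {f : RN N × ℝ → ℝ} (hf : Continuous f) (hfc : HasCompactSupport f) :
    ∫⁻ z, ‖conv K f z‖ₑ ^ p ≤
      ENNReal.ofReal (p * (2 * (12 * B ^ 2 * 2 ^ (N + 2) + 4 ^ N * 8 + 4 * B) * (1 / (p - 1)) +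
        4 * B ^ 2 * (1 / p + 1 / (2 - p)))) * ∫⁻ z, ‖f z‖ₑ ^ p := by
  have hp0 : 0 < p := by linarith
  have h1p : 0 < p - 1 := by linarith
  have h2p : 0 < 2 - p := by linarith
  have hof : ∀ h : RN N × ℝ → ℝ, ∀ z, ‖h z‖ₑ ^ p = ENNReal.ofReal (|h z| ^ p) := fun h z => by
    rw [← ENNReal.ofReal_rpow_of_nonneg (abs_nonneg _) hp0.le, ← Real.norm_eq_abs, ofReal_norm]
  simp only [hof]
  have hm := measurable_conv hK.meas hf.measurable
  rw [lintegral_rpow_eq_lintegral_meas_lt_mul _ (Eventually.of_forall fun z => abs_nonneg _)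
    (by fun_prop) hp0]
  set C₁ := 2 * (12 * (B:ℝ) ^ 2 * 2 ^ (N + 2) + 4 ^ N * 8 + 4 * B) with hC₁
  set C₂ := 4 * (B:ℝ) ^ 2 with hC₂
  have hC₁0 : 0 ≤ C₁ := by positivity
  have hC₂0 : 0 ≤ C₂ := by positivity
  have hfm := hf.measurable
  have key : ∫⁻ t in Ioi (0:ℝ), volume {z | t < |conv K f z|} * ENNReal.ofReal (t ^ (p - 1)) ≤
      ENNReal.ofReal C₁ * (∫⁻ w, ENNReal.ofReal (1 / (p - 1)) * ENNReal.ofReal (|f w| ^ p)) +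
      ENNReal.ofReal C₂ * (∫⁻ w, ENNReal.ofReal (1 / p + 1 / (2 - p)) *
          ENNReal.ofReal (|f w| ^ p)) := by
    calc _ ≤ ∫⁻ t in Ioi (0:ℝ), (ENNReal.ofReal C₁ * (∫⁻ w, ENNReal.ofReal (t ^ (p - 2)) *
            ENNReal.ofReal (if t < |f w| then |f w| else 0)) + ENNReal.ofReal C₂ *
            (∫⁻ w, ENNReal.ofReal (t ^ (p - 3)) * ENNReal.ofReal (min |f w| t ^ 2))) := by
          refine setLIntegral_mono' measurableSet_Ioi fun t ht => ?_
          refine (mul_le_mul_left (hK.meas_lt_abs_conv_le hf hfc ht) _).trans (le_of_eq ?_)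
          have r1 : t ^ (p - 2) = t ^ (-1:ℝ) * t ^ (p - 1) := by
            rw [← Real.rpow_add ht]; congr 1; ring
          have r2 : t ^ (p - 3) = t ^ (-2:ℝ) * t ^ (p - 1) := by
            rw [← Real.rpow_add ht]; congr 1; ring
          rw [lintegral_const_mul' _ _ ENNReal.ofReal_ne_top,
            lintegral_const_mul' _ _ ENNReal.ofReal_ne_top, r1, r2,
            ENNReal.ofReal_mul (Real.rpow_nonneg (le_of_lt ht) _),
            ENNReal.ofReal_mul (Real.rpow_nonneg (le_of_lt ht) _)]
          ring
      _ = ENNReal.ofReal C₁ * (∫⁻ w, ∫⁻ t in Ioi (0:ℝ), ENNReal.ofReal (t ^ (p - 2)) *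
            ENNReal.ofReal (if t < |f w| then |f w| else 0)) + ENNReal.ofReal C₂ *
            (∫⁻ w, ∫⁻ t in Ioi (0:ℝ), ENNReal.ofReal (t ^ (p - 3)) *
                ENNReal.ofReal (min |f w| t ^ 2)) := by
          have m1 : Measurable (Function.uncurry fun (t : ℝ) (w : RN N × ℝ) =>
              ENNReal.ofReal (t ^ (p - 2)) *
            ENNReal.ofReal (if t < |f w| then |f w| else 0)) := by
            unfold Function.uncurry
            refine Measurable.mul (by fun_prop) (Measurable.ennreal_ofReal ?_)
            exact Measurable.ite (measurableSet_lt (by fun_prop) (by fun_prop)) (by fun_prop)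
                (by fun_prop)
          have m2 : Measurable (Function.uncurry fun (t : ℝ) (w : RN N × ℝ) =>
              ENNReal.ofReal (t ^ (p - 3)) *
            ENNReal.ofReal (min |f w| t ^ 2)) := by
            unfold Function.uncurry
            fun_prop
          rw [lintegral_add_left (Measurable.const_mul (m1.lintegral_prod_right) _),
            lintegral_const_mul _ m1.lintegral_prod_right,
            lintegral_const_mul _ m2.lintegral_prod_right,
            lintegral_lintegral_swap m1.aemeasurable, lintegral_lintegral_swap m2.aemeasurable]
      _ ≤ _ := by
          gcongr with w w
          · exact lintegral_rpow_mul_ite_le hp (abs_nonneg _)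
          · exact lintegral_rpow_mul_min_sq_le hp hp2 (abs_nonneg _)
  refine (mul_le_mul_right key _).trans (le_of_eq ?_)
  rw [lintegral_const_mul _ (by fun_prop), lintegral_const_mul _ (by fun_prop), ← mul_assoc,
    ← mul_assoc, ← ENNReal.ofReal_mul (by positivity),
    ← ENNReal.ofReal_mul (by positivity), ← add_mul,
    ← ENNReal.ofReal_add (by positivity) (by positivity), ← mul_assoc,
    ← ENNReal.ofReal_mul (by positivity)]

theorem conv_neg_eq {N : ℕ} (K g : RN N × ℝ → ℝ) (z : RN N × ℝ) :
    conv (fun z => K (-z)) g z = conv K (fun w => g (-w)) (-z) := by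
  unfold conv
  rw [← integral_neg_eq_self (fun w => K (-z - w) * g (-w))]
  refine integral_congr_ae (Eventually.of_forall fun w => ?_)
  simp only [neg_sub, neg_neg, sub_neg_eq_add]
  congr 2
  abel

theorem CZKernel.neg {N : ℕ} {K : RN N × ℝ → ℝ} {B : ℝ≥0} (hK : CZKernel K B) :
    CZKernel (fun z => K (-z)) B where
  meas := hK.meas.comp measurable_neg
  bdd := hK.bdd.imp fun M hM z => hM _
  int := hK.int.comp_neg
  l2 := fun g hg hgi hgb => by
    simp only [conv_neg_eq]
    rw [lintegral_neg_eq_self (fun z => ‖conv K (fun w => g (-w)) z‖ₑ ^ 2)]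
    refine (hK.l2 (fun w => g (-w)) (by fun_prop) hgi.comp_neg
        (hgb.imp fun M hM z => hM _)).trans ?_
    rw [lintegral_neg_eq_self (fun z => ‖g z‖ₑ ^ 2)]
  horm := fun l hl h h1 h2 => by
    refine le_trans (le_of_eq ?_) (hK.horm l hl (-h) (by simpa using h1) (by simpa using h2))
    have hmp : MeasurePreserving (fun z : RN N × ℝ => -z) volume volume :=
      Measure.measurePreserving_neg volume
    have := hmp.setLIntegral_comp_preimage_emb (MeasurableEquiv.neg _).measurableEmbedding
      (fun z => ‖K (z - -h) - K z‖ₑ) {z : RN N × ℝ | 2 * l < ‖z.1‖ ∨ 4 * l ^ 2 < |z.2|}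
    rw [← this]
    have hs : (fun z : RN N × ℝ => -z) ⁻¹' {z : RN N × ℝ | 2 * l < ‖z.1‖ ∨ 4 * l ^ 2 < |z.2|} =
        {z : RN N × ℝ | 2 * l < ‖z.1‖ ∨ 4 * l ^ 2 < |z.2|} := by
      ext z; simp
    rw [hs]
    refine lintegral_congr fun z => ?_
    congr 3
    abel

theorem continuous_conv {N : ℕ} {K f : RN N × ℝ → ℝ} (hK : Integrable K)
    (hf : Continuous f) {M : ℝ} (hM : ∀ z, |f z| ≤ M) : Continuous (conv K f) := by
  have : conv K f = fun z => ∫ w, K w * f (z - w) := by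
    funext z
    unfold conv
    rw [← integral_sub_left_eq_self (fun w => K w * f (z - w)) volume z]
    simp
  rw [this]
  refine continuous_of_dominated (bound := fun w => |K w| * M) (fun z => ?_) (fun z => ?_)
    (hK.abs.mul_const M) (Eventually.of_forall fun w => by fun_prop)
  · exact hK.aestronglyMeasurable.mul
      (by fun_prop : Continuous fun w => f (z - w)).aestronglyMeasurable
  · refine Eventually.of_forall fun w => ?_
    rw [Real.norm_eq_abs, abs_mul]
    exact mul_le_mul_of_nonneg_left (hM _) (abs_nonneg _)

theorem integral_conv_mul {N : ℕ} {K f h : RN N × ℝ → ℝ} (hK : Measurable K) {M : ℝ}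
    (hM : ∀ z, |K z| ≤ M) (hf : Integrable f) (hh : Integrable h) :
    ∫ z, conv K f z * h z = ∫ w, f w * conv (fun z => K (-z)) h w := by
  have e1 : ∀ z, conv K f z * h z = ∫ w, K (z - w) * f w * h z := fun z => by
    rw [integral_mul_const]; rfl
  have e2 : ∀ w, f w * conv (fun z => K (-z)) h w = ∫ z, K (z - w) * f w * h z := fun w => by
    unfold conv
    rw [← integral_const_mul]
    refine integral_congr_ae (Eventually.of_forall fun z => ?_)
    simp only [neg_sub]
    ring
  simp only [e1, e2]
  rw [integral_integral_swap]
  have : Integrable (fun q : (RN N × ℝ) × (RN N × ℝ) => h q.1 * f q.2) (volume.prod volume) :=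
    hh.mul_prod hf
  have h2 : Integrable (fun q : (RN N × ℝ) × (RN N × ℝ) => K (q.1 - q.2) * (h q.1 * f q.2))
      (volume.prod volume) :=
    this.bdd_mul (c := M) (hK.comp (by fun_prop)).aestronglyMeasurable
        (Eventually.of_forall fun w => hM _)
  refine h2.congr (Eventually.of_forall fun q => ?_)
  simp only [Function.uncurry]
  ring

/-- If `X ≤ a X^{1/p'}` with `X` finite then `X ≤ a^p`. -/
theorem le_rpow_of_le_mul_rpow {X a : ℝ≥0∞} {p p' : ℝ} (hpp : p.HolderConjugate p') (hX : X ≠ ∞)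
    (h : X ≤ a * X ^ (1 / p')) : X ≤ a ^ p := by
  rcases eq_or_ne X 0 with rfl | h0
  · exact zero_le
  have h1 : X ^ (1 / p) ≤ a := by
    have hsplit : X ^ (1 / p) * X ^ (1 / p') = X := by
      rw [← ENNReal.rpow_add _ _ h0 hX, one_div, one_div, hpp.inv_add_inv_eq_one, ENNReal.rpow_one]
    have hp' := hpp.symm.pos
    have n0 : X ^ (1 / p') ≠ 0 := by simp [h0, hX]
    have nt : X ^ (1 / p') ≠ ∞ := ENNReal.rpow_ne_top_of_nonneg (by positivity) hX
    exact (ENNReal.mul_le_mul_iff_left n0 nt).1 (hsplit.le.trans h)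
  calc X = (X ^ (1 / p)) ^ p := by
        rw [← ENNReal.rpow_mul, one_div_mul_cancel hpp.pos.ne', ENNReal.rpow_one]
    _ ≤ a ^ p := by gcongr; exact hpp.pos.le

theorem CZKernel.strong_dual {N : ℕ} {K : RN N × ℝ → ℝ} {B : ℝ≥0} (hK : CZKernel K B)
    {p p' : ℝ} (hpp : p.HolderConjugate p') {C : ℝ≥0∞}
    (hC : ∀ f : RN N × ℝ → ℝ, Continuous f → HasCompactSupport f →
      ∫⁻ z, ‖conv (fun z => K (-z)) f z‖ₑ ^ p' ≤ C ^ p' * ∫⁻ z, ‖f z‖ₑ ^ p')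
    {f : RN N × ℝ → ℝ} (hf : Continuous f) (hfc : HasCompactSupport f) :
    ∫⁻ z, ‖conv K f z‖ₑ ^ p ≤ C ^ p * ∫⁻ z, ‖f z‖ₑ ^ p := by
  have hp := hpp.pos
  have hp' := hpp.symm.pos
  have hp1 := hpp.lt
  obtain ⟨M, hM⟩ := hK.bdd
  obtain ⟨Mf, hMf⟩ := hfc.exists_bound_of_continuous hf
  have hfi : Integrable f := hf.integrable_of_hasCompactSupport hfc
  have hc : Continuous (conv K f) := continuous_conv hK.int hf hMf
  set χ : ℕ → RN N × ℝ → ℝ := fun n z => max 0 (min 1 (n - ‖z‖)) with hχ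
  have χc : ∀ n, Continuous (χ n) := fun n => by fun_prop
  have χ0 : ∀ n z, 0 ≤ χ n z := fun n z => le_max_left _ _
  have χ1 : ∀ n z, χ n z ≤ 1 := fun n z => max_le zero_le_one (min_le_left _ _)
  have χs : ∀ n, HasCompactSupport (χ n) := fun n => by
    refine HasCompactSupport.of_support_subset_isCompact
        (isCompact_closedBall 0 (n:ℝ)) fun z hz => ?_
    rw [Function.mem_support] at hz
    rw [mem_closedBall_zero_iff]
    by_contra! hcon
    exact hz (max_eq_left ((min_le_right _ _).trans (by linarith)))
  have χlim : ∀ z, ∀ᶠ n in atTop, χ n z = 1 := fun z => by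
    obtain ⟨n₀, hn₀⟩ := exists_nat_ge (‖z‖ + 1)
    filter_upwards [eventually_ge_atTop n₀] with n hn
    have : (n₀:ℝ) ≤ n := by exact_mod_cast hn
    simp only [hχ]
    rw [min_eq_left (by linarith), max_eq_right zero_le_one]
  have key : ∀ n, ∫⁻ z, ENNReal.ofReal (χ n z) * ‖conv K f z‖ₑ ^ p ≤ C ^ p * ∫⁻ z, ‖f z‖ₑ ^ p := by
    intro n
    set X := ∫⁻ z, ENNReal.ofReal (χ n z) * ‖conv K f z‖ₑ ^ p with hXdef
    set h : RN N × ℝ → ℝ := fun z => χ n z *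
        (|conv K f z| ^ (p - 1) * SignType.sign (conv K f z)) with hh
    have hpowc : Continuous fun x : ℝ => |x| ^ (p - 1) * SignType.sign x := by
      have : (fun x : ℝ => |x| ^ (p - 1) * SignType.sign x) =
          fun x : ℝ => (max x 0) ^ (p - 1) - (max (-x) 0) ^ (p - 1) := by
        funext x
        rcases lt_trichotomy x 0 with hx | rfl | hx
        · rw [sign_neg hx, abs_of_neg hx, max_eq_right hx.le, max_eq_left (by linarith),
            Real.zero_rpow (by linarith)]
          simp
        · simp
        · rw [sign_pos hx, abs_of_pos hx, max_eq_left hx.le, max_eq_right (by linarith),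
            Real.zero_rpow (by linarith)]
          simp
      rw [this]
      exact ((continuous_id.max continuous_const).rpow_const fun x => Or.inr (by linarith)).sub
        ((continuous_neg.max continuous_const).rpow_const fun x => Or.inr (by linarith))
    have hhc : Continuous h := (χc n).mul (hpowc.comp hc)
    have hhs : HasCompactSupport h := (χs n).mul_right
    have hhi : Integrable h := hhc.integrable_of_hasCompactSupport hhs
    have hmul : ∀ z, conv K f z * h z = χ n z * |conv K f z| ^ p := fun z => by
      simp only [hh]
      have : conv K f z * (SignType.sign (conv K f z) : ℝ) = |conv K f z| := by
        exact self_mul_sign _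
      rw [show conv K f z * (χ n z * (|conv K f z| ^ (p - 1) * SignType.sign (conv K f z)))
        = χ n z * (|conv K f z| ^ (p - 1) *
            (conv K f z * SignType.sign (conv K f z))) by ring, this]
      congr 1
      rw [← Real.rpow_add_one' (abs_nonneg _) (by linarith)]
      congr 1; ring
    have hcp : Continuous fun z => |conv K f z| ^ p := hc.abs.rpow_const fun x => Or.inr hp.le
    have hi2 : Integrable fun z => χ n z * |conv K f z| ^ p :=
      ((χc n).mul hcp).integrable_of_hasCompactSupport (χs n).mul_right
    have hXeq : X = ENNReal.ofReal (∫ z, χ n z * |conv K f z| ^ p) := by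
      rw [ofReal_integral_eq_lintegral_ofReal hi2 (Eventually.of_forall fun z =>
        mul_nonneg (χ0 n z) (by positivity))]
      refine lintegral_congr fun z => ?_
      rw [ENNReal.ofReal_mul (χ0 n z), ← ENNReal.ofReal_rpow_of_nonneg (abs_nonneg _) hp.le,
        ← Real.norm_eq_abs, ofReal_norm]
    have hXtop : X ≠ ∞ := by rw [hXeq]; exact ENNReal.ofReal_ne_top
    have h1 : X ≤ (∫⁻ z, ‖f z‖ₑ ^ p) ^ (1 / p) *
        (∫⁻ z, ‖conv (fun z => K (-z)) h z‖ₑ ^ p') ^ (1 / p') := by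
      have e1 : X ≤ ∫⁻ w, ‖f w‖ₑ * ‖conv (fun z => K (-z)) h w‖ₑ := by
        rw [hXeq, ← integral_congr_ae (Eventually.of_forall hmul),
          integral_conv_mul hK.meas hM hfi hhi]
        refine le_trans ?_ (enorm_integral_mul_le (μ := volume) f (conv (fun z => K (-z)) h))
        rw [← ofReal_norm]
        exact ENNReal.ofReal_le_ofReal (le_abs_self _)
      refine e1.trans (ENNReal.lintegral_mul_le_Lp_mul_Lq _ hpp (by fun_prop) ?_)
      exact (measurable_conv (hK.meas.comp measurable_neg) hhc.measurable).enorm.aemeasurable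
    have h2 : ∫⁻ z, ‖h z‖ₑ ^ p' ≤ X := by
      refine lintegral_mono fun z => ?_
      have hle : ‖h z‖ₑ ^ p' ≤ ENNReal.ofReal (χ n z * |conv K f z| ^ p) := by
        rw [← ofReal_norm, ENNReal.ofReal_rpow_of_nonneg (norm_nonneg _) hp'.le]
        apply ENNReal.ofReal_le_ofReal
        have hsg : |(SignType.sign (conv K f z) : ℝ)| ≤ 1 := by
          rcases lt_trichotomy (conv K f z) 0 with hx | hx | hx
          · simp [sign_neg hx]
          · simp [hx]
          · simp [sign_pos hx]
        have hn : ‖h z‖ ≤ χ n z * |conv K f z| ^ (p - 1) := by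
          rw [Real.norm_eq_abs, hh, abs_mul, abs_mul, abs_of_nonneg (χ0 n z),
            abs_of_nonneg (by positivity : 0 ≤ |conv K f z| ^ (p-1))]
          exact mul_le_mul_of_nonneg_left (mul_le_of_le_one_right (by positivity) hsg) (χ0 n z)
        refine (Real.rpow_le_rpow (norm_nonneg _) hn hp'.le).trans ?_
        rw [Real.mul_rpow (χ0 n z) (by positivity), ← Real.rpow_mul (abs_nonneg _),
          hpp.sub_one_mul_conj]
        refine mul_le_mul_of_nonneg_right ?_ (by positivity)
        calc χ n z ^ p' ≤ χ n z ^ (1:ℝ) :=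
              Real.rpow_le_rpow_of_exponent_ge_of_imp (χ0 n z) (χ1 n z) hpp.symm.lt.le
                  (by intro _ h; exact absurd h hp'.ne')
          _ = _ := Real.rpow_one _
      refine hle.trans (le_of_eq ?_)
      rw [ENNReal.ofReal_mul (χ0 n z), ← ENNReal.ofReal_rpow_of_nonneg (abs_nonneg _) hp.le,
        ← Real.norm_eq_abs, ofReal_norm]
    have h3 : X ≤ ((∫⁻ z, ‖f z‖ₑ ^ p) ^ (1 / p) * C) * X ^ (1 / p') := by
      refine h1.trans ?_
      rw [mul_assoc]
      gcongr
      calc _ ≤ (C ^ p' * X) ^ (1 / p') := by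
            gcongr
            exact (hC h hhc hhs).trans (by gcongr)
        _ = C * X ^ (1 / p') := by
            rw [ENNReal.mul_rpow_of_nonneg _ _ (by positivity), ← ENNReal.rpow_mul,
              mul_one_div_cancel hp'.ne', ENNReal.rpow_one]
    refine (le_rpow_of_le_mul_rpow hpp hXtop h3).trans (le_of_eq ?_)
    rw [ENNReal.mul_rpow_of_nonneg _ _ hp.le, ← ENNReal.rpow_mul, one_div_mul_cancel hp.ne',
      ENNReal.rpow_one, mul_comm]
  have hF : ∫⁻ z, ‖conv K f z‖ₑ ^ p ≤
      ∫⁻ z, liminf (fun n => ENNReal.ofReal (χ n z) * ‖conv K f z‖ₑ ^ p) atTop := by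
    refine lintegral_mono fun z => ?_
    have : Tendsto (fun n => ENNReal.ofReal (χ n z) * ‖conv K f z‖ₑ ^ p) atTop
        (𝓝 (‖conv K f z‖ₑ ^ p)) :=
      tendsto_const_nhds.congr' ((χlim z).mono fun n hn => by simp [hn])
    rw [this.liminf_eq]
  refine hF.trans ((lintegral_liminf_le fun n => ?_).trans ?_)
  · have := (χc n).measurable
    have := hc.measurable
    fun_prop
  · exact liminf_le_of_le (by isBoundedDefault) fun b hb => by
      obtain ⟨n, hn⟩ := hb.exists
      exact hn.trans (key n)

/-- The Calderón–Zygmund theorem for kernels that are bounded and integrable. -/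
theorem CZKernel.exists_strong (N : ℕ) (B : ℝ≥0) {p : ℝ} (hp : 1 < p) :
    ∃ C : ℝ≥0, ∀ K : RN N × ℝ → ℝ, CZKernel K B → ∀ f : RN N × ℝ → ℝ, Continuous f →
      HasCompactSupport f → ∫⁻ z, ‖conv K f z‖ₑ ^ p ≤ (C : ℝ≥0∞) ^ p * ∫⁻ z, ‖f z‖ₑ ^ p := by
  have low : ∀ p : ℝ, 1 < p → p < 2 →
    ∃ C : ℝ≥0, ∀ K : RN N × ℝ → ℝ, CZKernel K B → ∀ f : RN N × ℝ → ℝ, Continuous f →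
      HasCompactSupport f → ∫⁻ z, ‖conv K f z‖ₑ ^ p ≤ (C : ℝ≥0∞) ^ p * ∫⁻ z, ‖f z‖ₑ ^ p := by
    intro p hp hp2
    set D : ℝ := (p * (2 * (12 * B ^ 2 * 2 ^ (N + 2) + 4 ^ N * 8 + 4 * B) * (1 / (p - 1)) +
        4 * B ^ 2 * (1 / p + 1 / (2 - p)))) with hD
    refine ⟨D.toNNReal ^ (1 / p), fun K hK f hf hfc => (hK.strong_of_lt_two hp hp2 hf hfc).trans
      (le_of_eq ?_)⟩
    rw [ENNReal.coe_rpow_of_nonneg _ (by positivity), ← ENNReal.rpow_mul,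
      one_div_mul_cancel (by linarith), ENNReal.rpow_one]
    rfl
  rcases lt_trichotomy p 2 with h | rfl | h
  · exact low p hp h
  · refine ⟨B, fun K hK f hf hfc => ?_⟩
    obtain ⟨M, hM⟩ := hfc.exists_bound_of_continuous hf
    simpa using hK.l2 f hf.measurable (hf.integrable_of_hasCompactSupport hfc) ⟨M, hM⟩
  · have hpp := Real.HolderConjugate.conjExponent hp
    have h1 : p.conjExponent < 2 := by
      rw [Real.conjExponent, div_lt_iff₀ (by linarith)]; linarith
    obtain ⟨C, hC⟩ := low p.conjExponent hpp.symm.lt h1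
    exact ⟨C, fun K hK f hf hfc => hK.strong_dual hpp (fun f hf hfc => hC _ hK.neg f hf hfc) hf hfc⟩

/-- The heat kernel of `ℝ^N` at time `a`. -/
def heatK {N : ℕ} (a : ℝ) (y : RN N) : ℝ :=
  (4 * Real.pi * a) ^ (-(N : ℝ) / 2) * Real.exp (-(∑ i, y i ^ 2) / (4 * a))

theorem heatK_nonneg {N : ℕ} {a : ℝ} (ha : 0 < a) (y : RN N) : 0 ≤ heatK a y := by
  unfold heatK; positivity

theorem integrable_heatK {N : ℕ} {a : ℝ} (ha : 0 < a) : Integrable (heatK a : RN N → ℝ) := by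
  have h := GaussianFourier.integrable_cexp_neg_mul_sum_add (ι := Fin N)
      (b := ((1 / (4 * a) : ℝ) : ℂ))
    (by rw [Complex.ofReal_re]; positivity) 0
  refine (h.norm.const_mul ((4 * Real.pi * a) ^ (-(N : ℝ) / 2))).congr (.of_forall fun y => ?_)
  simp only [heatK, Complex.norm_exp]
  congr 2
  simp only [Pi.zero_apply, zero_mul, Finset.sum_const_zero, add_zero]
  rw [← Complex.ofReal_neg, Complex.re_ofReal_mul]
  simp only [Complex.re_sum, ← Complex.ofReal_pow, Complex.ofReal_re]
  field_simp

theorem integral_cexp_mul_heatK {N : ℕ} {a : ℝ} (ha : 0 < a) (ξ : RN N) :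
    ∫ y : RN N, Complex.exp (Complex.I * (∑ i, y i * ξ i : ℝ)) * (heatK a y : ℂ)
      = Real.exp (-a * ∑ i, ξ i ^ 2) := by
  have h := GaussianFourier.integral_cexp_neg_mul_sum_add (ι := Fin N)
    (b := ((1 / (4 * a) : ℝ) : ℂ)) (by rw [Complex.ofReal_re]; positivity)
    (fun i => Complex.I * ξ i)
  have e1 : ∀ y : RN N, Complex.exp (Complex.I * (∑ i, y i * ξ i : ℝ)) * (heatK a y : ℂ)
      = ((4 * Real.pi * a) ^ (-(N : ℝ) / 2) : ℝ) *
        Complex.exp (-((1 / (4 * a) : ℝ) : ℂ) * ∑ i, (y i : ℂ) ^ 2 + ∑ i, Complex.I * ξ i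
            * y i) := by
    intro y
    rw [heatK, Complex.ofReal_mul, Complex.ofReal_exp, mul_left_comm, ← Complex.exp_add]
    congr 2
    push_cast
    rw [add_comm, Finset.mul_sum]
    congr 1
    · field_simp
    · exact Finset.sum_congr rfl fun i _ => by ring
  simp_rw [e1]
  rw [integral_const_mul, h]
  have e2 : ((Real.pi : ℂ) / ((1 / (4 * a) : ℝ) : ℂ)) ^ ((Fintype.card (Fin N) : ℂ) / 2)
      = ((4 * Real.pi * a) ^ ((N : ℝ) / 2) : ℝ) := by
    rw [← Complex.ofReal_div, Complex.ofReal_cpow (by positivity)]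
    congr 1
    · congr 1; field_simp
    · simp
  rw [e2, ← mul_assoc, ← Complex.ofReal_mul, ← Real.rpow_add (by positivity)]
  have e3 : -(N : ℝ) / 2 + (N : ℝ) / 2 = 0 := by ring
  rw [e3, Real.rpow_zero, Complex.ofReal_one, one_mul, Complex.ofReal_exp]
  congr 1
  push_cast
  simp only [mul_pow, Complex.I_sq, ← Finset.mul_sum]
  field_simp

theorem integral_heatK {N : ℕ} {a : ℝ} (ha : 0 < a) : ∫ y : RN N, heatK a y = 1 := by
  have h := integral_cexp_mul_heatK ha (0 : RN N)
  simp only [Pi.zero_apply, mul_zero, Finset.sum_const_zero, Complex.ofReal_zero, Complex.exp_zero,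
    one_mul, ne_eq, OfNat.ofNat_ne_zero, not_false_eq_true, zero_pow, Real.exp_zero,
    Complex.ofReal_one] at h
  rw [integral_complex_ofReal] at h
  exact_mod_cast h

theorem lintegral_heatK {N : ℕ} {a : ℝ} (ha : 0 < a) :
    ∫⁻ y : RN N, ENNReal.ofReal (heatK a y) = 1 := by
  rw [← ofReal_integral_eq_lintegral_ofReal (integrable_heatK ha)
    (.of_forall fun y => heatK_nonneg ha y), integral_heatK ha, ENNReal.ofReal_one]

theorem exists_one_add_pow_mul_exp_le (k : ℕ) :
    ∃ C : ℝ, 0 < C ∧ ∀ q : ℝ, 0 ≤ q → (1 + q) ^ k * Real.exp (-q / 4) ≤ C * Real.exp (-q / 8) := by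
  refine ⟨8 ^ k * (k.factorial : ℝ) * Real.exp (1 / 8), by positivity, fun q hq => ?_⟩
  have h1 := Real.pow_div_factorial_le_exp (x := (1 + q) / 8) (by positivity) k
  rw [div_le_iff₀ (by positivity), div_pow, div_le_iff₀ (by positivity)] at h1
  calc (1 + q) ^ k * Real.exp (-q / 4)
      ≤ (Real.exp ((1 + q) / 8) * k.factorial * 8 ^ k) * Real.exp (-q / 4) := by gcongr
    _ = 8 ^ k * (k.factorial : ℝ) * Real.exp (1 / 8) * (Real.exp (q / 8) * Real.exp (-q / 4)) := by
        rw [add_div, Real.exp_add]; ring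
    _ = _ := by
        rw [← Real.exp_add]
        congr 2; ring

theorem exists_poly_mul_heatK_le (N k : ℕ) :
    ∃ C : ℝ, 0 < C ∧ ∀ a : ℝ, 0 < a → ∀ y : RN N,
      (1 + (∑ i, y i ^ 2) / a) ^ k * heatK a y ≤ C * heatK (2 * a) y := by
  obtain ⟨C, hC, h⟩ := exists_one_add_pow_mul_exp_le k
  refine ⟨C * 2 ^ ((N : ℝ) / 2), by positivity, fun a ha y => ?_⟩
  have hq := h ((∑ i, y i ^ 2) / a) (by positivity)
  unfold heatK
  have e1 : -(∑ i, y i ^ 2) / (4 * a) = -((∑ i, y i ^ 2) / a) / 4 := by field_simp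
  have e2 : -(∑ i, y i ^ 2) / (4 * (2 * a)) = -((∑ i, y i ^ 2) / a) / 8 := by ring
  have e3 : (4 * Real.pi * (2 * a)) ^ (-(N : ℝ) / 2)
      = 2 ^ (-(N : ℝ) / 2) * (4 * Real.pi * a) ^ (-(N : ℝ) / 2) := by
    rw [← Real.mul_rpow (by positivity) (by positivity)]; congr 1; ring
  have e4 : (2 : ℝ) ^ ((N : ℝ) / 2) * 2 ^ (-(N : ℝ) / 2) = 1 := by
    rw [← Real.rpow_add (by norm_num)]
    have : (N : ℝ) / 2 + -(N : ℝ) / 2 = 0 := by ring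
    rw [this, Real.rpow_zero]
  rw [e1, e2, e3]
  calc _ = (4 * Real.pi * a) ^ (-(N : ℝ) / 2) *
        ((1 + (∑ i, y i ^ 2) / a) ^ k * Real.exp (-((∑ i, y i ^ 2) / a) / 4)) := by ring
    _ ≤ (4 * Real.pi * a) ^ (-(N : ℝ) / 2) * (C * Real.exp (-((∑ i, y i ^ 2) / a) / 8)) := by gcongr
    _ = C * (2 ^ ((N : ℝ) / 2) * 2 ^ (-(N : ℝ) / 2)) * ((4 * Real.pi * a) ^ (-(N : ℝ) / 2)
          * Real.exp (-((∑ i, y i ^ 2) / a) / 8)) := by rw [e4]; ring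
    _ = _ := by ring

theorem hasDerivAt_heatK_path {N : ℕ} {a α θ : ℝ} (y η : RN N) (h : 0 < a + θ * α) :
    HasDerivAt (fun θ : ℝ => heatK (a + θ * α) (fun k => y k + θ * η k))
      ((-(N : ℝ) / 2 * α / (a + θ * α) - (∑ k, 2 * (y k + θ * η k) * η k) / (4 * (a + θ * α))
        + α * (∑ k, (y k + θ * η k) ^ 2) / (4 * (a + θ * α) ^ 2)) *
        heatK (a + θ * α) (fun k => y k + θ * η k)) θ := by
  unfold heatK
  have h1 : HasDerivAt (fun θ : ℝ => a + θ * α) α θ := by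
    simpa using ((hasDerivAt_id θ).mul_const α).const_add a
  have h2 : HasDerivAt (fun θ : ℝ => (4 * Real.pi * (a + θ * α))) (4 * Real.pi * α) θ :=
    h1.const_mul _
  have h3 := h2.rpow_const (p := -(N : ℝ) / 2) (Or.inl (by positivity))
  have h4 : HasDerivAt (fun θ : ℝ => ∑ k, (y k + θ * η k) ^ 2)
      (∑ k, 2 * (y k + θ * η k) * η k) θ := by
    refine HasDerivAt.fun_sum fun k _ => ?_
    have := (((hasDerivAt_id θ).mul_const (η k)).const_add (y k)).fun_pow 2
    simpa using this
  have h5 := (h4.fun_neg.fun_div (h1.const_mul 4) (by positivity)).exp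
  refine (h3.mul h5).congr_deriv ?_
  have hne : (4 * Real.pi * (a + θ * α)) ≠ 0 := by positivity
  rw [Real.rpow_sub_one hne]
  generalize ∑ k, 2 * (y k + θ * η k) * η k = S1
  generalize ∑ k, (y k + θ * η k) ^ 2 = S2
  generalize a + θ * α = b at *
  field_simp
  ring

theorem exists_lintegral_le_of_le_poly_mul_heatK (N : ℕ) :
    ∃ C : ℝ, 0 < C ∧ ∀ a : ℝ, 0 < a → ∀ (f : RN N → ℝ) (M : ℝ), 0 ≤ M →
      (∀ y, |f y| ≤ M * ((1 + (∑ i, y i ^ 2) / a) ^ 2 * heatK a y)) →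
      ∫⁻ y, ‖f y‖ₑ ≤ ENNReal.ofReal (C * M) := by
  obtain ⟨C, hC, h⟩ := exists_poly_mul_heatK_le N 2
  refine ⟨C, hC, fun a ha f M hM hf => ?_⟩
  calc ∫⁻ y, ‖f y‖ₑ ≤ ∫⁻ y, ENNReal.ofReal (C * M) * ENNReal.ofReal (heatK (2 * a) y) := by
        refine lintegral_mono fun y => ?_
        rw [Real.enorm_eq_ofReal_abs, ← ENNReal.ofReal_mul (by positivity)]
        refine ENNReal.ofReal_le_ofReal ((hf y).trans ?_)
        calc _ ≤ M * (C * heatK (2 * a) y) := mul_le_mul_of_nonneg_left (h a ha y) hM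
          _ = _ := by ring
    _ = ENNReal.ofReal (C * M) := by
        rw [lintegral_const_mul' _ _ ENNReal.ofReal_ne_top,
          lintegral_heatK (by positivity), mul_one]

/-- The polynomial factor in the second derivatives of the heat kernel. -/
def heatP {N : ℕ} (i j : Fin N) (a : ℝ) (y : RN N) : ℝ :=
  y i * y j / (4 * a ^ 2) - (if i = j then 1 else 0) / (2 * a)

/-- The second derivatives of the heat kernel. -/
def heatH {N : ℕ} (i j : Fin N) (a : ℝ) (y : RN N) : ℝ := heatP i j a y * heatK a y

theorem abs_mul_le_sum_sq {N : ℕ} (i j : Fin N) (y : RN N) : |y i * y j| ≤ ∑ k, y k ^ 2 := by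
  have h : ∀ i, y i ^ 2 ≤ ∑ k, y k ^ 2 := fun i =>
    Finset.single_le_sum (f := fun k => y k ^ 2) (fun k _ => sq_nonneg _) (Finset.mem_univ i)
  rw [abs_le]
  constructor <;> nlinarith [h i, h j, sq_nonneg (y i + y j), sq_nonneg (y i - y j)]

theorem abs_heatP_le {N : ℕ} (i j : Fin N) {a : ℝ} (ha : 0 < a) (y : RN N) :
    |heatP i j a y| ≤ (1 + (∑ k, y k ^ 2) / a) / a := by
  have h1 := abs_mul_le_sum_sq i j y
  have h0 : 0 ≤ ∑ k, y k ^ 2 := Finset.sum_nonneg fun k _ => sq_nonneg _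
  set S := ∑ k, y k ^ 2
  have h2 : |(if i = j then (1 : ℝ) else 0) / (2 * a)| ≤ 1 / (2 * a) := by
    rw [abs_div, abs_of_pos (by positivity : (0 : ℝ) < 2 * a)]
    gcongr
    split_ifs <;> simp
  have h3 : |y i * y j / (4 * a ^ 2)| ≤ S / (4 * a ^ 2) := by
    rw [abs_div, abs_of_pos (by positivity : (0 : ℝ) < 4 * a ^ 2)]; gcongr
  refine (abs_sub _ _).trans ((add_le_add h3 h2).trans ?_)
  have : (1 + S / a) / a = S / (4 * a ^ 2) + 1 / (2 * a) + (3 * S / (4 * a ^ 2) + 1 / (2 * a)) := by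
    field_simp; ring
  rw [this]
  have : 0 ≤ 3 * S / (4 * a ^ 2) + 1 / (2 * a) := by positivity
  linarith

theorem abs_heatH_le {N : ℕ} (i j : Fin N) {a : ℝ} (ha : 0 < a) (y : RN N) :
    |heatH i j a y| ≤ 1 / a * ((1 + (∑ k, y k ^ 2) / a) * heatK a y) := by
  rw [heatH, abs_mul, abs_of_nonneg (heatK_nonneg ha y)]
  have := mul_le_mul_of_nonneg_right (abs_heatP_le i j ha y) (heatK_nonneg ha y)
  refine this.trans_eq (by ring)

theorem one_le_one_add_div {N : ℕ} {a : ℝ} (ha : 0 < a) (y : RN N) :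
    1 ≤ 1 + (∑ k, y k ^ 2) / a := by
  have : 0 ≤ (∑ k, y k ^ 2) / a := div_nonneg (Finset.sum_nonneg fun k _ => sq_nonneg _) ha.le
  linarith

theorem exists_heatH_bounds (N : ℕ) : ∃ C : ℝ, 0 < C ∧ ∀ (i j : Fin N) (a : ℝ), 0 < a →
    ∫⁻ y, ‖heatH i j a y‖ₑ ≤ ENNReal.ofReal (C * (1 / a)) ∧
    ∫⁻ y, ‖(∑ k, y k ^ 2) * heatH i j a y‖ₑ ≤ ENNReal.ofReal C := by
  obtain ⟨C, hC, h⟩ := exists_lintegral_le_of_le_poly_mul_heatK N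
  refine ⟨C, hC, fun i j a ha => ⟨h a ha _ _ (by positivity) fun y => ?_, ?_⟩⟩
  · refine (abs_heatH_le i j ha y).trans ?_
    have := one_le_one_add_div ha y
    have := heatK_nonneg ha y
    gcongr
    nlinarith
  · have := h a ha (fun y => (∑ k, y k ^ 2) * heatH i j a y) 1 zero_le_one fun y => ?_
    · simpa using this
    · rw [one_mul, abs_mul]
      have h0 : 0 ≤ ∑ k, y k ^ 2 := Finset.sum_nonneg fun k _ => sq_nonneg _
      rw [abs_of_nonneg h0]
      have h1 := one_le_one_add_div ha y
      have h2 := heatK_nonneg ha y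
      calc (∑ k, y k ^ 2) * |heatH i j a y|
          ≤ (∑ k, y k ^ 2) * (1 / a * ((1 + (∑ k, y k ^ 2) / a) * heatK a y)) := by
            gcongr; exact abs_heatH_le i j ha y
        _ = ((∑ k, y k ^ 2) / a) * ((1 + (∑ k, y k ^ 2) / a) * heatK a y) := by ring
        _ ≤ (1 + (∑ k, y k ^ 2) / a) * ((1 + (∑ k, y k ^ 2) / a) * heatK a y) := by
            gcongr; linarith
        _ = _ := by ring

/-- The derivative of `e^{-b} ∂ᵢ∂ⱼ` of the heat kernel in the parabolic direction `(α, η)`. -/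
def heatD {N : ℕ} (i j : Fin N) (α : ℝ) (η : RN N) (b : ℝ) (y : RN N) : ℝ :=
  Real.exp (-b) * (-α * heatP i j b y
    + ((η i * y j + y i * η j) / (4 * b ^ 2) - α * (y i * y j) / (2 * b ^ 3)
        + α * (if i = j then 1 else 0) / (2 * b ^ 2))
    + heatP i j b y * (-(N : ℝ) / 2 * α / b - (∑ k, 2 * y k * η k) / (4 * b)
        + α * (∑ k, y k ^ 2) / (4 * b ^ 2))) * heatK b y

theorem hasDerivAt_heatH_path {N : ℕ} (i j : Fin N) {a α θ : ℝ} (y η : RN N) (h : 0 < a + θ * α) :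
    HasDerivAt (fun θ : ℝ => Real.exp (-(a + θ * α)) * heatH i j (a + θ * α)
        (fun k => y k + θ * η k))
      (heatD i j α η (a + θ * α) (fun k => y k + θ * η k)) θ := by
  have h1 : HasDerivAt (fun θ : ℝ => a + θ * α) α θ := by
    simpa using ((hasDerivAt_id θ).mul_const α).const_add a
  have hy : ∀ k, HasDerivAt (fun θ : ℝ => y k + θ * η k) (η k) θ := fun k => by
    simpa using ((hasDerivAt_id θ).mul_const (η k)).const_add (y k)
  have hP := (((hy i).fun_mul (hy j)).fun_div ((h1.fun_pow 2).const_mul 4) (by positivity)).fun_sub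
    ((hasDerivAt_const θ (if i = j then (1 : ℝ) else 0)).fun_div (h1.const_mul 2) (by positivity))
  refine ((h1.fun_neg.exp).fun_mul (hP.fun_mul (hasDerivAt_heatK_path y η h))).congr_deriv ?_
  simp only [heatD, heatP, Nat.cast_ofNat, Nat.add_one_sub_one, pow_one]
  generalize ∑ k, 2 * (y k + θ * η k) * η k = S1
  generalize ∑ k, (y k + θ * η k) ^ 2 = S2
  generalize heatK (a + θ * α) (fun k => y k + θ * η k) = G
  generalize y i + θ * η i = yi
  generalize y j + θ * η j = yj
  generalize a + θ * α = b at *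
  field_simp
  ring

theorem abs_heatD_le {N : ℕ} (i j : Fin N) {α b l : ℝ} {η : RN N} (hl : 0 < l) (hb : l ^ 2 ≤ b)
    (hα : |α| ≤ l ^ 2) (hη : ∀ k, |η k| ≤ l) (y : RN N) :
    |heatD i j α η b y| ≤ (N + 4) * (l / (Real.sqrt b * b)) *
      ((1 + (∑ k, y k ^ 2) / b) ^ 2 * heatK b y) := by
  have hb0 : 0 < b := lt_of_lt_of_le (by positivity) hb
  set s := Real.sqrt b with hs
  have hs0 : 0 < s := Real.sqrt_pos.2 hb0
  have hss : s ^ 2 = b := Real.sq_sqrt hb0.le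
  have hls : l ≤ s := Real.le_sqrt_of_sq_le hb
  have hq := one_le_one_add_div hb0 y
  have hS0 : 0 ≤ ∑ k, y k ^ 2 := Finset.sum_nonneg fun k _ => sq_nonneg _
  have hG := heatK_nonneg hb0 y
  have hP := abs_heatP_le i j hb0 y
  have hyy := abs_mul_le_sum_sq i j y
  set Q := 1 + (∑ k, y k ^ 2) / b with hQ
  have hSQ : ∑ k, y k ^ 2 ≤ s ^ 2 * Q := by
    rw [hss, hQ]; field_simp; linarith
  have hy : ∀ k, |y k| ≤ s * Q := by
    intro k
    have h := Finset.single_le_sum (f := fun k => y k ^ 2) (fun k _ => sq_nonneg _)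
        (Finset.mem_univ k)
    have h2 : y k ^ 2 ≤ (s * Q) ^ 2 := by
      have : s ^ 2 * Q ≤ (s * Q) ^ 2 := by
        rw [mul_pow]; gcongr; nlinarith
      exact (h.trans hSQ).trans this
    exact abs_le_of_sq_le_sq h2 (by positivity)
  have hα' : |α| ≤ l * s := hα.trans (by rw [sq]; gcongr)
  have hexp : Real.exp (-b) ≤ 1 / b := by
    rw [Real.exp_neg, inv_eq_one_div]
    gcongr
    linarith [Real.add_one_le_exp b]
  have hexp1 : Real.exp (-b) ≤ 1 := by simpa using hb0.le
  have hite : |(if i = j then (1 : ℝ) else 0)| ≤ 1 := by split_ifs <;> simp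
  -- the three terms
  have t1 : Real.exp (-b) * |-α * heatP i j b y| ≤ l / (s * b) * Q ^ 2 := by
    rw [abs_mul, abs_neg]
    calc _ ≤ 1 / b * (l * s * (Q / b)) := by gcongr
      _ = l / (s * b) * Q := by rw [← hss]; field_simp
      _ ≤ _ := by gcongr; nlinarith
  have t2 : |(η i * y j + y i * η j) / (4 * b ^ 2) - α * (y i * y j) / (2 * b ^ 3)
        + α * (if i = j then 1 else 0) / (2 * b ^ 2)| ≤ 2 * (l / (s * b) * Q ^ 2) := by
    have u1 : |(η i * y j + y i * η j) / (4 * b ^ 2)| ≤ l / (s * b) * Q ^ 2 := by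
      rw [abs_div, abs_of_pos (by positivity : 0 < 4 * b ^ 2)]
      calc _ ≤ (l * (s * Q) + (s * Q) * l) / (4 * b ^ 2) := by
            gcongr
            refine (abs_add_le _ _).trans ?_
            rw [abs_mul, abs_mul]
            gcongr
            · exact hη i
            · exact hy j
            · exact hy i
            · exact hη j
        _ = 1 / 2 * (l / (s * b) * Q) := by rw [← hss]; field_simp; ring
        _ ≤ l / (s * b) * Q := by
            have : 0 ≤ l / (s * b) * Q := by positivity
            linarith
        _ ≤ _ := by gcongr; nlinarith
    have u2 : |α * (y i * y j) / (2 * b ^ 3)| ≤ 1 / 2 * (l / (s * b) * Q ^ 2) := by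
      rw [abs_div, abs_of_pos (by positivity : 0 < 2 * b ^ 3), abs_mul]
      calc _ ≤ (l * s * (s ^ 2 * Q)) / (2 * b ^ 3) := by
            gcongr; exact hyy.trans hSQ
        _ = 1 / 2 * (l / (s * b) * Q) := by rw [← hss]; field_simp
        _ ≤ _ := by gcongr; nlinarith
    have u3 : |α * (if i = j then 1 else 0) / (2 * b ^ 2)| ≤ 1 / 2 * (l / (s * b) * Q ^ 2) := by
      rw [abs_div, abs_of_pos (by positivity : 0 < 2 * b ^ 2), abs_mul]
      calc _ ≤ (l * s * 1) / (2 * b ^ 2) := by gcongr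
        _ = 1 / 2 * (l / (s * b) * 1) := by rw [← hss]; field_simp
        _ ≤ _ := by gcongr; nlinarith
    refine (abs_add_le _ _).trans ?_
    have := abs_sub ((η i * y j + y i * η j) / (4 * b ^ 2)) (α * (y i * y j) / (2 * b ^ 3))
    linarith
  have t3 : |-(N : ℝ) / 2 * α / b - (∑ k, 2 * y k * η k) / (4 * b)
        + α * (∑ k, y k ^ 2) / (4 * b ^ 2)| ≤ (N + 1) * (l / s) * Q := by
    have u1 : |-(N : ℝ) / 2 * α / b| ≤ N / 2 * (l / s) * Q := by
      rw [abs_div, abs_of_pos hb0, abs_mul, abs_div, abs_neg, Nat.abs_cast, abs_two]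
      calc _ ≤ (N : ℝ) / 2 * (l * s) / b := by gcongr
        _ = (N : ℝ) / 2 * (l / s) * 1 := by rw [← hss]; field_simp
        _ ≤ _ := by gcongr
    have u2 : |(∑ k, 2 * y k * η k) / (4 * b)| ≤ N / 2 * (l / s) * Q := by
      rw [abs_div, abs_of_pos (by positivity : 0 < 4 * b)]
      have : |∑ k, 2 * y k * η k| ≤ N * (2 * (s * Q) * l) := by
        refine (Finset.abs_sum_le_sum_abs _ _).trans ?_
        refine (Finset.sum_le_card_nsmul _ _ (2 * (s * Q) * l) fun k _ => ?_).trans_eq (by simp)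
        rw [abs_mul, abs_mul, abs_two]
        gcongr
        · exact hy k
        · exact hη k
      calc _ ≤ N * (2 * (s * Q) * l) / (4 * b) := by gcongr
        _ = _ := by rw [← hss]; field_simp; ring
    have u3 : |α * (∑ k, y k ^ 2) / (4 * b ^ 2)| ≤ 1 * (l / s) * Q := by
      rw [abs_div, abs_of_pos (by positivity : 0 < 4 * b ^ 2), abs_mul, abs_of_nonneg hS0]
      calc _ ≤ (l * s * (s ^ 2 * Q)) / (4 * b ^ 2) := by gcongr
        _ = 1 / 4 * ((l / s) * Q) := by rw [← hss]; field_simp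
        _ ≤ _ := by
            have : 0 ≤ (l / s) * Q := by positivity
            linarith
    refine (abs_add_le _ _).trans ?_
    have := abs_sub (-(N : ℝ) / 2 * α / b) ((∑ k, 2 * y k * η k) / (4 * b))
    linarith
  rw [heatD, abs_mul, abs_of_nonneg hG, mul_add, mul_add]
  have key : |Real.exp (-b) * (-α * heatP i j b y) +
        Real.exp (-b) * ((η i * y j + y i * η j) / (4 * b ^ 2) - α * (y i * y j) / (2 * b ^ 3)
        + α * (if i = j then 1 else 0) / (2 * b ^ 2)) +
        Real.exp (-b) * (heatP i j b y * (-(N : ℝ) / 2 * α / b - (∑ k, 2 * y k * η k) / (4 * b)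
        + α * (∑ k, y k ^ 2) / (4 * b ^ 2)))| ≤ (N + 4) * (l / (s * b)) * Q ^ 2 := by
    refine (abs_add_three _ _ _).trans ?_
    rw [abs_mul, abs_mul (Real.exp (-b)), abs_mul (Real.exp (-b)), abs_of_pos (Real.exp_pos _)]
    have v2 := mul_le_mul hexp1 t2 (abs_nonneg _) zero_le_one
    have v3 : Real.exp (-b) * |heatP i j b y *
        (-(N : ℝ) / 2 * α / b - (∑ k, 2 * y k * η k) / (4 * b)
        + α * (∑ k, y k ^ 2) / (4 * b ^ 2))| ≤ (N + 1) * (l / (s * b) * Q ^ 2) := by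
      rw [abs_mul]
      calc _ ≤ 1 * (Q / b * ((N + 1) * (l / s) * Q)) := by gcongr
        _ = _ := by field_simp
    linarith
  calc _ ≤ (N + 4) * (l / (s * b)) * Q ^ 2 * heatK b y := by gcongr
    _ = _ := by ring

theorem measurable_heatK {N : ℕ} : Measurable fun q : ℝ × RN N => heatK q.1 q.2 := by
  unfold heatK; fun_prop

theorem measurable_heatH {N : ℕ} (i j : Fin N) :
    Measurable fun q : ℝ × RN N => heatH i j q.1 q.2 := by
  unfold heatH heatP
  have := measurable_heatK (N := N)
  fun_prop

theorem measurable_heatD {N : ℕ} (i j : Fin N) (α : ℝ) (η : RN N) :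
    Measurable fun q : ℝ × RN N => heatD i j α η q.1 q.2 := by
  unfold heatD heatP
  have := measurable_heatK (N := N)
  fun_prop

theorem continuousOn_heatD_path {N : ℕ} (i j : Fin N) {a α : ℝ} (y η : RN N)
    (h : ∀ θ ∈ Icc (0 : ℝ) 1, 0 < a + θ * α) :
    ContinuousOn (fun θ : ℝ => heatD i j α η (a + θ * α) (fun k => y k + θ * η k)) (Icc 0 1) := by
  unfold heatD heatP heatK
  intro θ hθ
  have h0 := h θ hθ
  have h1 : 4 * Real.pi * (a + θ * α) ≠ 0 := by positivity
  have h2 : 2 * (a + θ * α) ≠ 0 := by positivity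
  have h3 : 4 * (a + θ * α) ≠ 0 := by positivity
  have h4 : 4 * (a + θ * α) ^ 2 ≠ 0 := by positivity
  have h5 : 2 * (a + θ * α) ^ 2 ≠ 0 := by positivity
  have h6 : 2 * (a + θ * α) ^ 3 ≠ 0 := by positivity
  refine ContinuousAt.continuousWithinAt ?_
  fun_prop (disch := first | assumption | exact Or.inl (by assumption) | exact h0.ne')

theorem exists_lintegral_heatH_sub_le (N : ℕ) :
    ∃ C : ℝ, 0 < C ∧ ∀ (i j : Fin N) (a α l : ℝ) (η : RN N),
    0 < l → 4 * l ^ 2 ≤ a → |α| ≤ l ^ 2 → (∀ k, |η k| ≤ l) →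
    ∫⁻ y, ‖Real.exp (-(a + α)) * heatH i j (a + α) (y + η) - Real.exp (-a) * heatH i j a y‖ₑ
      ≤ ENNReal.ofReal (C * (l * a ^ (-(3 : ℝ) / 2))) := by
  obtain ⟨C, hC, h⟩ := exists_lintegral_le_of_le_poly_mul_heatK N
  refine ⟨C * (2 * (N + 4)), by positivity, fun i j a α l η hl ha hα hη => ?_⟩
  have ha0 : 0 < a := lt_of_lt_of_le (by positivity) ha
  have hpath : ∀ θ ∈ Icc (0 : ℝ) 1, 3 / 4 * a ≤ a + θ * α := by
    intro θ hθ
    have : |θ * α| ≤ l ^ 2 := by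
      rw [abs_mul, abs_of_nonneg hθ.1]
      calc _ ≤ 1 * l ^ 2 := by gcongr; exact hθ.2
        _ = _ := one_mul _
    have := neg_le_of_abs_le this
    linarith
  have hpos : ∀ θ ∈ Icc (0 : ℝ) 1, 0 < a + θ * α := fun θ hθ =>
    lt_of_lt_of_le (by positivity) (hpath θ hθ)
  have hpt : ∀ y : RN N, ‖Real.exp (-(a + α)) * heatH i j (a + α) (y + η)
      - Real.exp (-a) * heatH i j a y‖ₑ
      ≤ ∫⁻ θ in Icc (0 : ℝ) 1, ‖heatD i j α η (a + θ * α) (y + θ • η)‖ₑ := by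
    intro y
    have hc := continuousOn_heatD_path i j y η hpos
    have := intervalIntegral.integral_eq_sub_of_hasDerivAt (a := 0) (b := 1)
      (f := fun θ : ℝ => Real.exp (-(a + θ * α)) * heatH i j (a + θ * α) (fun k => y k + θ * η k))
      (f' := fun θ : ℝ => heatD i j α η (a + θ * α) (fun k => y k + θ * η k))
      (fun θ hθ => hasDerivAt_heatH_path i j y η (hpos θ (by simpa using hθ)))
      (ContinuousOn.intervalIntegrable (by simpa using hc))
    simp only [one_mul, zero_mul, add_zero] at this
    have e : (fun k => y k + η k) = y + η := rfl
    rw [e] at this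
    rw [← this, intervalIntegral.integral_of_le zero_le_one, ← integral_Icc_eq_integral_Ioc]
    exact enorm_integral_le_lintegral_enorm _
  have hmeas : Measurable (Function.uncurry fun (y : RN N) (θ : ℝ) =>
      ‖heatD i j α η (a + θ * α) (y + θ • η)‖ₑ) := by
    refine ((measurable_heatD i j α η).comp (g := fun q : ℝ × RN N => heatD i j α η q.1 q.2)
      (f := fun q : RN N × ℝ => (a + q.2 * α, q.1 + q.2 • η)) ?_).enorm
    fun_prop
  calc _ ≤ ∫⁻ y, ∫⁻ θ in Icc (0 : ℝ) 1, ‖heatD i j α η (a + θ * α) (y + θ • η)‖ₑ :=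
        lintegral_mono hpt
    _ = ∫⁻ θ in Icc (0 : ℝ) 1, ∫⁻ y, ‖heatD i j α η (a + θ * α) (y + θ • η)‖ₑ :=
        lintegral_lintegral_swap hmeas.aemeasurable
    _ ≤ ∫⁻ θ in Icc (0 : ℝ) 1, ENNReal.ofReal (C * (2 * (N + 4)) * (l * a ^ (-(3 : ℝ) / 2))) := by
        refine setLIntegral_mono measurable_const fun θ hθ => ?_
        rw [lintegral_add_right_eq_self (fun y => ‖heatD i j α η (a + θ * α) y‖ₑ)]
        have hb := hpath θ hθ
        set b := a + θ * α
        have hb0 : 0 < b := hpos θ hθ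
        refine (h b hb0 _ ((N + 4) * (l / (Real.sqrt b * b))) (by positivity) fun y =>
          abs_heatD_le i j hl (by nlinarith) hα hη y).trans (ENNReal.ofReal_le_ofReal ?_)
        have h1 : 3 / 4 * Real.sqrt a ≤ Real.sqrt b := by
          refine Real.le_sqrt_of_sq_le ?_
          rw [mul_pow, Real.sq_sqrt ha0.le]
          linarith
        have hsa : 0 < Real.sqrt a := Real.sqrt_pos.2 ha0
        have h2 : Real.sqrt a * a / 2 ≤ Real.sqrt b * b := by
          calc Real.sqrt a * a / 2 ≤ 3 / 4 * Real.sqrt a * (3 / 4 * a) := by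
                have : 0 < Real.sqrt a * a := by positivity
                linarith
            _ ≤ _ := by gcongr
        have h3 : a ^ (-(3 : ℝ) / 2) = 1 / (Real.sqrt a * a) := by
          rw [neg_div, Real.rpow_neg ha0.le, Real.sqrt_eq_rpow]
          nth_rewrite 3 [← Real.rpow_one a]
          rw [← Real.rpow_add ha0, one_div]
          norm_num
        rw [h3]
        calc C * ((N + 4) * (l / (Real.sqrt b * b)))
            ≤ C * ((N + 4) * (l / (Real.sqrt a * a / 2))) := by gcongr
          _ = _ := by field_simp
    _ = _ := by simp

/-- The (regularised, damped) kernel of the second derivatives of the backward heat equation. -/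
def heatCZ {N : ℕ} (ε : ℝ) (i j : Fin N) (z : RN N × ℝ) : ℝ :=
  if z.2 < 0 then Real.exp (-(ε - z.2)) * heatH i j (ε - z.2) z.1 else 0

theorem measurable_heatCZ {N : ℕ} (ε : ℝ) (i j : Fin N) : Measurable (heatCZ ε i j) := by
  unfold heatCZ
  refine Measurable.ite (measurableSet_lt measurable_snd measurable_const) ?_ measurable_const
  have := (measurable_heatH i j).comp (f := fun z : RN N × ℝ => (ε - z.2, z.1)) (by fun_prop)
  simp only [Function.comp_def] at this
  fun_prop

theorem heatK_le {N : ℕ} {ε a : ℝ} (hε : 0 < ε) (ha : ε ≤ a) (y : RN N) :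
    heatK a y ≤ (4 * Real.pi * ε) ^ (-(N : ℝ) / 2) := by
  have ha0 := hε.trans_le ha
  unfold heatK
  calc _ ≤ (4 * Real.pi * ε) ^ (-(N : ℝ) / 2) * 1 := by
        refine mul_le_mul ?_ ?_ (by positivity) (by positivity)
        · refine Real.rpow_le_rpow_of_nonpos (by positivity) (by gcongr) ?_
          have : (0 : ℝ) ≤ N := Nat.cast_nonneg N
          linarith
        · rw [Real.exp_le_one_iff, neg_div]
          have : 0 ≤ (∑ k, y k ^ 2) / (4 * a) := by positivity
          linarith
    _ = _ := mul_one _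

theorem bdd_heatCZ {N : ℕ} {ε : ℝ} (hε : 0 < ε) (i j : Fin N) : ∃ M, ∀ z, |heatCZ ε i j z| ≤ M := by
  obtain ⟨C, hC, h⟩ := exists_poly_mul_heatK_le N 1
  have hM : 0 ≤ 1 / ε * (C * (4 * Real.pi * ε) ^ (-(N : ℝ) / 2)) := by positivity
  refine ⟨1 / ε * (C * (4 * Real.pi * ε) ^ (-(N : ℝ) / 2)), fun z => ?_⟩
  unfold heatCZ
  split_ifs with hz
  · have ha : ε ≤ ε - z.2 := by linarith
    have ha0 : 0 < ε - z.2 := hε.trans_le ha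
    rw [abs_mul, abs_of_pos (Real.exp_pos _)]
    have h1 : Real.exp (-(ε - z.2)) ≤ 1 := by rw [Real.exp_le_one_iff]; linarith
    have h2 := heatK_nonneg (N := N) (by positivity : 0 < 2 * (ε - z.2)) z.1
    have h3 := h _ ha0 z.1
    rw [pow_one] at h3
    calc _ ≤ 1 * (1 / (ε - z.2) * (C * heatK (2 * (ε - z.2)) z.1)) :=
          mul_le_mul h1 ((abs_heatH_le i j ha0 z.1).trans
            (mul_le_mul_of_nonneg_left h3 (by positivity))) (abs_nonneg _) zero_le_one
      _ ≤ 1 * (1 / ε * (C * (4 * Real.pi * ε) ^ (-(N : ℝ) / 2))) := by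
          gcongr
          exact heatK_le hε (by linarith) z.1
      _ = _ := one_mul _
  · simpa using hM

theorem lintegral_heatCZ_eq {N : ℕ} (ε : ℝ) (i j : Fin N) (w : RN N → ℝ≥0∞) (hw : Measurable w)
    (S : Set ℝ) :
    ∫⁻ z in {z : RN N × ℝ | z.2 ∈ S}, w z.1 * ‖heatCZ ε i j z‖ₑ
      = ∫⁻ s in S ∩ Iio 0, ENNReal.ofReal (Real.exp (-(ε - s))) * ∫⁻ y, w y *
          ‖heatH i j (ε - s) y‖ₑ := by
  have e : {z : RN N × ℝ | z.2 ∈ S} = univ ×ˢ S := by ext z; simp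
  have hm : Measurable fun z : RN N × ℝ => w z.1 * ‖heatCZ ε i j z‖ₑ :=
    (hw.comp measurable_fst).mul (measurable_heatCZ ε i j).enorm
  rw [e, Measure.volume_eq_prod, ← Measure.prod_restrict, Measure.restrict_univ,
    lintegral_prod_symm' _ hm, inter_comm, ← Measure.restrict_restrict measurableSet_Iio,
    ← lintegral_indicator measurableSet_Iio]
  refine lintegral_congr fun s => ?_
  by_cases hs : s < 0
  · rw [indicator_of_mem (by exact hs), ← lintegral_const_mul' _ _ ENNReal.ofReal_ne_top]
    refine lintegral_congr fun y => ?_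
    simp only [heatCZ, hs, if_true, enorm_mul, Real.enorm_of_nonneg (Real.exp_pos _).le]
    ring
  · rw [indicator_of_notMem (by exact hs)]
    simp [heatCZ, hs]

theorem lintegral_Iio_exp : ∫⁻ s in Iio (0 : ℝ), ENNReal.ofReal (Real.exp s) = 1 := by
  rw [← ofReal_integral_eq_lintegral_ofReal, ← integral_Iic_eq_integral_Iio, integral_exp_Iic]
  · simp
  · exact (integrableOn_exp_Iic 0).mono_set Iio_subset_Iic_self
  · exact .of_forall fun s => (Real.exp_pos _).le

theorem integrable_heatCZ {N : ℕ} {ε : ℝ} (hε : 0 < ε) (i j : Fin N) :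
    Integrable (heatCZ ε i j) := by
  obtain ⟨C, hC, h⟩ := exists_heatH_bounds N
  refine ⟨(measurable_heatCZ ε i j).aestronglyMeasurable, ?_⟩
  have := lintegral_heatCZ_eq ε i j (fun _ => 1) measurable_const univ
  simp only [mem_univ, one_mul, univ_inter] at this
  rw [show {z : RN N × ℝ | True} = univ from rfl, Measure.restrict_univ] at this
  rw [HasFiniteIntegral, this]
  calc _ ≤ ∫⁻ s in Iio (0 : ℝ), ENNReal.ofReal (Real.exp s) * ENNReal.ofReal (C * (1 / ε)) := by
        refine setLIntegral_mono (by fun_prop) fun s hs => ?_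
        have hs' : s < 0 := hs
        gcongr
        · linarith
        · refine ((h i j (ε - s) (by linarith)).1).trans (ENNReal.ofReal_le_ofReal ?_)
          gcongr
          linarith
    _ < ∞ := by
        rw [lintegral_mul_const' _ _ ENNReal.ofReal_ne_top, lintegral_Iio_exp, one_mul]
        exact ENNReal.ofReal_lt_top

theorem sq_norm_le_sum {N : ℕ} (y : RN N) : ‖y‖ ^ 2 ≤ ∑ k, y k ^ 2 := by
  have h0 : 0 ≤ ∑ k, y k ^ 2 := Finset.sum_nonneg fun k _ => sq_nonneg _
  have : ‖y‖ ≤ Real.sqrt (∑ k, y k ^ 2) := by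
    rw [pi_norm_le_iff_of_nonneg (Real.sqrt_nonneg _)]
    intro k
    rw [Real.norm_eq_abs]
    exact Real.abs_le_sqrt
      (Finset.single_le_sum (f := fun k => y k ^ 2) (fun k _ => sq_nonneg _) (Finset.mem_univ k))
  calc _ ≤ Real.sqrt (∑ k, y k ^ 2) ^ 2 := by gcongr
    _ = _ := Real.sq_sqrt h0

theorem lintegral_Iio_rpow {l : ℝ} (hl : 0 < l) :
    ∫⁻ s in Iio (-(4 * l ^ 2)), ENNReal.ofReal ((-s) ^ (-(3 : ℝ) / 2))
        = ENNReal.ofReal (1 / l) := by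
  have e : ∫⁻ s in Iio (-(4 * l ^ 2)), ENNReal.ofReal ((-s) ^ (-(3 : ℝ) / 2))
      = ∫⁻ s in Ioi (4 * l ^ 2), ENNReal.ofReal (s ^ (-(3 : ℝ) / 2)) := by
    have := (Measure.measurePreserving_neg (volume : Measure ℝ)).setLIntegral_comp_preimage
      (s := Ioi (4 * l ^ 2)) measurableSet_Ioi
      (f := fun s => ENNReal.ofReal (s ^ (-(3 : ℝ) / 2))) (by fun_prop)
    rw [← this]
    simp
  have h4 : (0 : ℝ) < 4 * l ^ 2 := by positivity
  rw [e, ← ofReal_integral_eq_lintegral_ofReal, integral_Ioi_rpow_of_lt (by norm_num) h4]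
  · congr 1
    have : (4 * l ^ 2 : ℝ) = (2 * l) ^ (2 : ℝ) := by norm_cast; ring
    rw [this, ← Real.rpow_mul (by positivity)]
    norm_num
    rw [Real.rpow_neg_one]
    field_simp
  · exact integrableOn_Ioi_rpow_of_lt (by norm_num) h4
  · refine (ae_restrict_mem measurableSet_Ioi).mono fun s hs => ?_
    exact Real.rpow_nonneg (h4.le.trans (le_of_lt hs)) _

theorem exists_heatCZ_hormander (N : ℕ) : ∃ B : ℝ≥0, ∀ (ε : ℝ), 0 < ε → ∀ (i j : Fin N),
    ∀ l : ℝ, 0 < l → ∀ h : RN N × ℝ, ‖h.1‖ ≤ l → |h.2| ≤ l ^ 2 →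
    ∫⁻ z in {z : RN N × ℝ | 2 * l < ‖z.1‖ ∨ 4 * l ^ 2 < |z.2|},
      ‖heatCZ ε i j (z - h) - heatCZ ε i j z‖ₑ ≤ B := by
  obtain ⟨C, hC, hH⟩ := exists_heatH_bounds N
  obtain ⟨C', hC', hH'⟩ := exists_lintegral_heatH_sub_le N
  refine ⟨Real.toNNReal C' + (Real.toNNReal (5 * C) + Real.toNNReal (5 * C)),
    fun ε hε i j l hl h h1 h2 => ?_⟩
  set K : RN N × ℝ → ℝ := heatCZ ε i j with hK
  have hKm : Measurable K := measurable_heatCZ ε i j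
  have hl2 : 0 < l ^ 2 := by positivity
  -- large times
  have hA : ∫⁻ z in {z : RN N × ℝ | z.2 ∈ {s : ℝ | 4 * l ^ 2 < |s|}}, ‖K (z - h) - K z‖ₑ
      ≤ ENNReal.ofReal C' := by
    have hS : MeasurableSet {s : ℝ | 4 * l ^ 2 < |s|} :=
        measurableSet_lt (by fun_prop) (by fun_prop)
    have e : {z : RN N × ℝ | z.2 ∈ {s : ℝ | 4 * l ^ 2 < |s|}}
        = univ ×ˢ {s : ℝ | 4 * l ^ 2 < |s|} := by ext z; simp
    have hm : Measurable fun z : RN N × ℝ => ‖K (z - h) - K z‖ₑ := by fun_prop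
    rw [e, Measure.volume_eq_prod, ← Measure.prod_restrict, Measure.restrict_univ,
      lintegral_prod_symm' _ hm]
    calc _ ≤ ∫⁻ s in {s : ℝ | 4 * l ^ 2 < |s|}, (Iio (-(4 * l ^ 2))).indicator (fun s =>
          ENNReal.ofReal (C' * l) * ENNReal.ofReal ((-s) ^ (-(3 : ℝ) / 2))) s := by
          refine setLIntegral_mono (Measurable.indicator (by fun_prop) measurableSet_Iio)
            fun s hs => ?_
          have hs' : 4 * l ^ 2 < |s| := hs
          have h2' := abs_le.1 h2
          rcases lt_abs.1 hs' with h3 | h3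
          · have : ∀ y : RN N, ‖K ((y, s) - h) - K (y, s)‖ₑ = 0 := fun y => by
              rw [hK, heatCZ, heatCZ, if_neg, if_neg]
              · simp
              · simp only [not_lt]; linarith
              · simp only [Prod.snd_sub, not_lt]; linarith
            simp [this]
          · rw [indicator_of_mem (show s ∈ Iio (-(4 * l ^ 2)) by simp only [mem_Iio]; linarith)]
            have : ∀ y : RN N, ‖K ((y, s) - h) - K (y, s)‖ₑ =
                ‖Real.exp (-((ε - s) + h.2)) * heatH i j ((ε - s) + h.2) (y + -h.1)
                  - Real.exp (-(ε - s)) * heatH i j (ε - s) y‖ₑ := fun y => by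
              rw [hK, heatCZ, heatCZ, if_pos, if_pos]
              · simp only [Prod.snd_sub, Prod.fst_sub]
                rw [show ε - (s - h.2) = ε - s + h.2 by ring, sub_eq_add_neg y]
              · show s < 0
                linarith
              · simp only [Prod.snd_sub]; linarith
            simp only [this]
            refine (hH' i j (ε - s) h.2 l (-h.1) hl (by linarith) h2 fun k => ?_).trans ?_
            · rw [Pi.neg_apply, abs_neg]
              exact (norm_le_pi_norm h.1 k).trans h1
            · rw [← ENNReal.ofReal_mul (by positivity)]
              refine ENNReal.ofReal_le_ofReal ?_
              rw [mul_assoc]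
              gcongr C' * (l * ?_)
              refine Real.rpow_le_rpow_of_nonpos (by linarith) (by linarith) (by norm_num)
      _ ≤ ∫⁻ s, (Iio (-(4 * l ^ 2))).indicator (fun s =>
          ENNReal.ofReal (C' * l) * ENNReal.ofReal ((-s) ^ (-(3 : ℝ) / 2))) s :=
          setLIntegral_le_lintegral _ _
      _ = ENNReal.ofReal C' := by
          rw [lintegral_indicator measurableSet_Iio, lintegral_const_mul' _ _ ENNReal.ofReal_ne_top,
            lintegral_Iio_rpow hl, ← ENNReal.ofReal_mul (by positivity)]
          congr 1
          field_simp
  -- bounded times, large distance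
  set D : Set (RN N × ℝ) := {z | l < ‖z.1‖ ∧ |z.2| ≤ 5 * l ^ 2} with hDdef
  have hDm : MeasurableSet D := by
    have a1 : MeasurableSet {z : RN N × ℝ | l < ‖z.1‖} :=
      measurableSet_lt (by fun_prop) (by fun_prop)
    have a2 : MeasurableSet {z : RN N × ℝ | |z.2| ≤ 5 * l ^ 2} :=
      measurableSet_le (by fun_prop) (by fun_prop)
    exact a1.inter a2
  have hD : ∫⁻ z in D, ‖K z‖ₑ ≤ ENNReal.ofReal (5 * C) := by
    have hS : MeasurableSet {s : ℝ | |s| ≤ 5 * l ^ 2} :=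
      measurableSet_le (by fun_prop) (by fun_prop)
    calc _ ≤ ∫⁻ z in {z : RN N × ℝ | z.2 ∈ {s : ℝ | |s| ≤ 5 * l ^ 2}},
          ENNReal.ofReal ((l ^ 2)⁻¹ * ∑ k, z.1 k ^ 2) * ‖K z‖ₑ := by
          refine (setLIntegral_mono (by fun_prop) fun z hz => ?_).trans
            (lintegral_mono_set fun z hz => hz.2)
          have : 1 ≤ ENNReal.ofReal ((l ^ 2)⁻¹ * ∑ k, z.1 k ^ 2) := by
            rw [ENNReal.one_le_ofReal, ← div_eq_inv_mul, one_le_div hl2]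
            refine le_trans ?_ (sq_norm_le_sum z.1)
            have : l ≤ ‖z.1‖ := hz.1.le
            gcongr
          calc ‖K z‖ₑ = 1 * ‖K z‖ₑ := (one_mul _).symm
            _ ≤ _ := by gcongr
      _ = ∫⁻ s in {s : ℝ | |s| ≤ 5 * l ^ 2} ∩ Iio 0, ENNReal.ofReal (Real.exp (-(ε - s))) *
          ∫⁻ y : RN N, ENNReal.ofReal ((l ^ 2)⁻¹ * ∑ k, y k ^ 2) * ‖heatH i j (ε - s) y‖ₑ :=
          lintegral_heatCZ_eq ε i j (fun y => ENNReal.ofReal ((l ^ 2)⁻¹ * ∑ k, y k ^ 2))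
            (by fun_prop) _
      _ ≤ ∫⁻ s in {s : ℝ | |s| ≤ 5 * l ^ 2} ∩ Iio 0, ENNReal.ofReal ((l ^ 2)⁻¹ * C) := by
          refine setLIntegral_mono measurable_const fun s hs => ?_
          have hs' : s < 0 := hs.2
          have e1 : ENNReal.ofReal (Real.exp (-(ε - s))) ≤ 1 := by
            rw [ENNReal.ofReal_le_one, Real.exp_le_one_iff]; linarith
          have e2 : ∫⁻ y : RN N, ENNReal.ofReal ((l ^ 2)⁻¹ * ∑ k, y k ^ 2) * ‖heatH i j (ε - s) y‖ₑ
              ≤ ENNReal.ofReal ((l ^ 2)⁻¹ * C) := by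
            have e3 : ∀ y : RN N, ENNReal.ofReal ((l ^ 2)⁻¹ * ∑ k, y k ^ 2) * ‖heatH i j (ε - s) y‖ₑ
                = ENNReal.ofReal (l ^ 2)⁻¹ * ‖(∑ k, y k ^ 2) * heatH i j (ε - s) y‖ₑ := fun y => by
              rw [ENNReal.ofReal_mul (by positivity), enorm_mul, Real.enorm_of_nonneg
                (Finset.sum_nonneg fun k _ => sq_nonneg _), mul_assoc]
            simp only [e3]
            rw [lintegral_const_mul' _ _ ENNReal.ofReal_ne_top, ENNReal.ofReal_mul (by positivity)]
            gcongr
            exact (hH i j (ε - s) (by linarith)).2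
          calc _ ≤ 1 * ENNReal.ofReal ((l ^ 2)⁻¹ * C) := by gcongr
            _ = _ := one_mul _
      _ ≤ ENNReal.ofReal ((l ^ 2)⁻¹ * C) * ENNReal.ofReal (5 * l ^ 2) := by
          rw [setLIntegral_const]
          gcongr
          calc _ ≤ volume (Icc (-(5 * l ^ 2)) 0) :=
                measure_mono fun s hs => ⟨(abs_le.1 hs.1).1, le_of_lt hs.2⟩
            _ = _ := by rw [Real.volume_Icc]; congr 1; ring
      _ = _ := by
          rw [← ENNReal.ofReal_mul (by positivity)]
          congr 1
          field_simp
  have hB : ∫⁻ z in {z : RN N × ℝ | 2 * l < ‖z.1‖ ∧ |z.2| ≤ 4 * l ^ 2}, ‖K (z - h) - K z‖ₑ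
      ≤ ENNReal.ofReal (5 * C) + ENNReal.ofReal (5 * C) := by
    have a1 : MeasurableSet {z : RN N × ℝ | 2 * l < ‖z.1‖} :=
      measurableSet_lt (by fun_prop) (by fun_prop)
    have a2 : MeasurableSet {z : RN N × ℝ | |z.2| ≤ 4 * l ^ 2} :=
      measurableSet_le (by fun_prop) (by fun_prop)
    have hBm : MeasurableSet {z : RN N × ℝ | 2 * l < ‖z.1‖ ∧ |z.2| ≤ 4 * l ^ 2} := a1.inter a2
    calc _ ≤ ∫⁻ z, ((D.indicator fun z => ‖K z‖ₑ) (z - h) + (D.indicator fun z => ‖K z‖ₑ) z) := by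
          rw [← lintegral_indicator hBm]
          refine lintegral_mono fun z => ?_
          by_cases hz : z ∈ {z : RN N × ℝ | 2 * l < ‖z.1‖ ∧ |z.2| ≤ 4 * l ^ 2}
          swap
          · rw [indicator_of_notMem hz]
            exact zero_le
          rw [indicator_of_mem hz]
          have hz1 : 2 * l < ‖z.1‖ := hz.1
          have hz2 : |z.2| ≤ 4 * l ^ 2 := hz.2
          rw [indicator_of_mem, indicator_of_mem]
          · exact enorm_sub_le
          · refine ⟨by linarith, by nlinarith⟩
          · refine ⟨?_, ?_⟩
            · have := norm_sub_norm_le z.1 h.1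
              simp only [Prod.fst_sub]
              linarith
            · simp only [Prod.snd_sub]
              exact (abs_sub _ _).trans (by linarith)
      _ = (∫⁻ z in D, ‖K z‖ₑ) + ∫⁻ z in D, ‖K z‖ₑ := by
          have hm : Measurable (D.indicator fun z => ‖K z‖ₑ) := hKm.enorm.indicator hDm
          rw [lintegral_add_right _ hm, lintegral_sub_right_eq_self (D.indicator fun z => ‖K z‖ₑ),
            lintegral_indicator hDm]
      _ ≤ _ := by gcongr
  calc _ ≤ ∫⁻ z in {z : RN N × ℝ | z.2 ∈ {s : ℝ | 4 * l ^ 2 < |s|}} ∪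
        {z : RN N × ℝ | 2 * l < ‖z.1‖ ∧ |z.2| ≤ 4 * l ^ 2}, ‖K (z - h) - K z‖ₑ := by
        refine lintegral_mono_set fun z hz => ?_
        by_cases h4 : 4 * l ^ 2 < |z.2|
        · exact Or.inl h4
        · exact Or.inr ⟨hz.resolve_right h4, not_lt.1 h4⟩
    _ ≤ _ := lintegral_union_le _ _ _
    _ ≤ _ := by
        push_cast
        exact add_le_add hA hB

section Plancherel

open FourierTransform

variable {V : Type*} [NormedAddCommGroup V] [InnerProductSpace ℝ V] [FiniteDimensional ℝ V]
  [MeasurableSpace V] [BorelSpace V]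

theorem coeFn_fourier_toLp_ae_eq {f : V → ℂ} (hf : Integrable f) (h2 : MemLp f 2) :
    (𝓕 (h2.toLp f) : Lp (α := V) ℂ 2) =ᵐ[volume] (𝓕 f : V → ℂ) := by
  have hc : Continuous (𝓕 f : V → ℂ) :=
    VectorFourier.fourierIntegral_continuous Real.continuous_fourierChar continuous_inner hf
  refine ae_eq_of_integral_contDiff_smul_eq
    ((Lp.memLp _).locallyIntegrable one_le_two)
    hc.locallyIntegrable fun g hg hgc => ?_
  have hG1 : ContDiff ℝ (⊤ : ℕ∞) (fun x => (g x : ℂ)) := Complex.ofRealCLM.contDiff.comp hg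
  have hG2 : HasCompactSupport (fun x => (g x : ℂ)) :=
      hgc.comp_left (g := fun x : ℝ => (x : ℂ)) (by simp)
  set G := hG2.toSchwartzMap hG1
  have hG : ∀ x, G x = g x := fun x => rfl
  have h1 := congrArg (fun D => D G) (Lp.fourier_toTemperedDistribution_eq (h2.toLp f))
  simp only [TemperedDistribution.fourier_apply, Lp.toTemperedDistribution_apply] at h1
  have h3 : ∫ x, (𝓕 G) x • (h2.toLp f) x = ∫ x, (𝓕 G) x • f x :=
    integral_congr_ae (by filter_upwards [h2.coeFn_toLp] with x hx; rw [hx])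
  have h4 : ∫ ξ, (𝓕 f : V → ℂ) ξ • G ξ = ∫ x, f x • (𝓕 (G : V → ℂ)) x := by
    simpa using! (VectorFourier.integral_fourierIntegral_smul_eq_flip (L := innerₗ V)
      (μ := volume) (ν := volume) Real.continuous_fourierChar continuous_inner hf
          (G.integrable (μ := volume)))
  have h5 : ((𝓕 G : SchwartzMap V ℂ) : V → ℂ) = 𝓕 (G : V → ℂ) := SchwartzMap.fourier_coe G
  rw [h3, h5] at h1
  calc _ = ∫ x, G x • (𝓕 (h2.toLp f) : Lp ℂ 2 (volume : Measure V)) x :=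
        integral_congr_ae (ae_of_all _ fun x => by simp [hG])
    _ = ∫ x, f x • (𝓕 (G : V → ℂ)) x := by
        rw [← h1]; exact integral_congr_ae (ae_of_all _ fun x => by simp [mul_comm])
    _ = _ := by rw [← h4]; exact integral_congr_ae (ae_of_all _ fun x => by simp [hG, mul_comm])

theorem lintegral_enorm_fourier_sq {f : V → ℂ} (hf : Integrable f) (h2 : MemLp f 2) :
    ∫⁻ ξ, ‖(𝓕 f : V → ℂ) ξ‖ₑ ^ 2 = ∫⁻ x, ‖f x‖ₑ ^ 2 := by
  have h := coeFn_fourier_toLp_ae_eq hf h2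
  have h1 : eLpNorm (𝓕 f : V → ℂ) 2 = eLpNorm f 2 := by
    rw [← eLpNorm_congr_ae h, ← Lp.enorm_def, ← Lp.enorm_toLp h2, ← ofReal_norm,
      ← ofReal_norm, Lp.norm_fourier_eq]
  have e : ∀ u : V → ℂ, ∫⁻ x, ‖u x‖ₑ ^ 2 = eLpNorm u 2 ^ (2 : ℝ) := fun u => by
    rw [eLpNorm_eq_lintegral_rpow_enorm_toReal two_ne_zero ENNReal.ofNat_ne_top, ← ENNReal.rpow_mul]
    simp
  rw [e, e, h1]

theorem lintegral_enorm_convolution_sq_le {K g : V → ℂ} (hK : Integrable K) (hg : Integrable g)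
    (hg2 : MemLp g 2) (hu : Integrable (convolution g K (ContinuousLinearMap.mul ℂ ℂ) volume))
    (hu2 : MemLp (convolution g K (ContinuousLinearMap.mul ℂ ℂ) volume) 2) {B : ℝ≥0}
    (hB : ∀ ξ, ‖(𝓕 K : V → ℂ) ξ‖ₑ ≤ B) :
    ∫⁻ x, ‖convolution g K (ContinuousLinearMap.mul ℂ ℂ) volume x‖ₑ ^ 2
      ≤ (B : ℝ≥0∞) ^ 2 * ∫⁻ x, ‖g x‖ₑ ^ 2 := by
  rw [← lintegral_enorm_fourier_sq hu hu2, ← lintegral_enorm_fourier_sq hg hg2,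
    ← lintegral_const_mul' _ _ (by simp)]
  refine lintegral_mono fun ξ => ?_
  rw [Real.fourier_mul_convolution_eq hg hK, enorm_mul, mul_pow, mul_comm]
  gcongr
  exact hB ξ

end Plancherel

theorem memLp_two_of_bounded {α E : Type*} [MeasurableSpace α]
    [NormedAddCommGroup E] {μ : Measure α}
    {f : α → E} (hf : Integrable f μ) {M : ℝ} (hM : ∀ x, ‖f x‖ ≤ M) : MemLp f 2 μ := by
  rw [memLp_two_iff_integrable_sq_norm hf.1]
  refine (hf.norm.const_mul M).mono' (hf.1.norm.pow 2) (ae_of_all _ fun x => ?_)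
  rw [Real.norm_of_nonneg (by positivity), sq]
  exact mul_le_mul_of_nonneg_right (hM x) (norm_nonneg _)

/-- The identification of `ℝ^N × ℝ`, with the maximum norm, with a Euclidean space. -/
def toEucl (N : ℕ) : RN N × ℝ ≃ᵐ WithLp 2 (EuclideanSpace ℝ (Fin N) × ℝ) :=
  ((MeasurableEquiv.toLp 2 (Fin N → ℝ)).prodCongr (MeasurableEquiv.refl ℝ)).trans
    (MeasurableEquiv.toLp 2 (EuclideanSpace ℝ (Fin N) × ℝ))

theorem measurePreserving_toEucl (N : ℕ) : MeasurePreserving (toEucl N) :=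
  (WithLp.volume_preserving_toLp (EuclideanSpace ℝ (Fin N)) ℝ).comp
    ((PiLp.volume_preserving_toLp (Fin N)).prod (MeasurePreserving.id volume))

theorem toEucl_symm_sub {N : ℕ} (x y : WithLp 2 (EuclideanSpace ℝ (Fin N) × ℝ)) :
    (toEucl N).symm (x - y) = (toEucl N).symm x - (toEucl N).symm y := rfl

theorem inner_toEucl {N : ℕ} (z : RN N × ℝ) (ζ : WithLp 2 (EuclideanSpace ℝ (Fin N) × ℝ)) :
    inner ℝ (toEucl N z) ζ = ∑ i, z.1 i * ζ.fst i + z.2 * ζ.snd := by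
  rw [WithLp.prod_inner_apply, PiLp.inner_apply]
  simp [toEucl, mul_comm]
  rfl

theorem lintegral_conv_sq_le {N : ℕ} {K : RN N × ℝ → ℝ} (hKi : Integrable K)
    {M : ℝ} (hM : ∀ z, |K z| ≤ M) {B : ℝ≥0}
    (hB : ∀ (ξ : RN N) (τ : ℝ),
      ‖∫ z : RN N × ℝ, Complex.exp (Complex.I * (∑ i, z.1 i * ξ i + z.2 * τ : ℝ)) * K z‖ ≤ B)
    {g : RN N × ℝ → ℝ} (hgi : Integrable g) {M' : ℝ} (hM' : ∀ z, |g z| ≤ M') :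
    ∫⁻ z, ‖conv K g z‖ₑ ^ 2 ≤ (B : ℝ≥0∞) ^ 2 * ∫⁻ z, ‖g z‖ₑ ^ 2 := by
  have mp := measurePreserving_toEucl N
  have mps := mp.symm
  set e := toEucl N
  set K' : WithLp 2 (EuclideanSpace ℝ (Fin N) × ℝ) → ℂ := fun x => (K (e.symm x) : ℂ)
  set g' : WithLp 2 (EuclideanSpace ℝ (Fin N) × ℝ) → ℂ := fun x => (g (e.symm x) : ℂ)
  have hK' : Integrable K' := (mps.integrable_comp_of_integrable hKi).ofReal
  have hg' : Integrable g' := (mps.integrable_comp_of_integrable hgi).ofReal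
  have hg2 : MemLp g' 2 := memLp_two_of_bounded hg' (M := M') fun x => by
    simpa [g'] using hM' (e.symm x)
  have hcv : ∀ x, convolution g' K' (ContinuousLinearMap.mul ℂ ℂ) volume x
      = (conv K g (e.symm x) : ℂ) := fun x => by
    have h1 := mps.integral_comp' (g := fun w => ((K (e.symm x - w) * g w : ℝ) : ℂ))
    rw [convolution_def, conv, ← integral_complex_ofReal, ← h1]
    refine integral_congr_ae (ae_of_all _ fun t => ?_)
    simp [K', g', e, toEucl_symm_sub, mul_comm]
  have hcve : convolution g' K' (ContinuousLinearMap.mul ℂ ℂ) volume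
      = fun x => (conv K g (e.symm x) : ℂ) := funext hcv
  have hu : Integrable (convolution g' K' (ContinuousLinearMap.mul ℂ ℂ) volume) :=
    hg'.integrable_convolution _ hK'
  have hu2 : MemLp (convolution g' K' (ContinuousLinearMap.mul ℂ ℂ) volume) 2 := by
    refine memLp_two_of_bounded hu (M := ∫ z, M * ‖g z‖) fun x => ?_
    rw [hcv, Complex.norm_real]
    refine norm_integral_le_of_norm_le (hgi.norm.const_mul M) (ae_of_all _ fun w => ?_)
    rw [norm_mul]
    exact mul_le_mul_of_nonneg_right (hM _) (norm_nonneg _)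
  have hF : ∀ ζ, ‖(FourierTransform.fourier K' : _ → ℂ) ζ‖ₑ ≤ B := fun ζ => by
    have h1 := mps.integral_comp' (g := fun z : RN N × ℝ =>
      Complex.exp (Complex.I * (∑ i, z.1 i * (-(2 * Real.pi) * ζ.fst i)
        + z.2 * (-(2 * Real.pi) * ζ.snd) : ℝ)) * K z)
    have h2 : (FourierTransform.fourier K' : _ → ℂ) ζ = ∫ z : RN N × ℝ,
      Complex.exp (Complex.I * (∑ i, z.1 i * (-(2 * Real.pi) * ζ.fst i)
        + z.2 * (-(2 * Real.pi) * ζ.snd) : ℝ)) * K z := by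
      rw [Real.fourier_eq', ← h1]
      refine integral_congr_ae (ae_of_all _ fun x => ?_)
      have h3 := inner_toEucl (e.symm x) ζ
      rw [e.apply_symm_apply] at h3
      simp only [smul_eq_mul, K', h3]
      congr 2
      rw [mul_comm Complex.I]
      congr 2
      rw [mul_add, Finset.mul_sum]
      congr 1
      · exact Finset.sum_congr rfl fun i _ => by ring
      · ring
    rw [h2, ← ofReal_norm]
    exact (ENNReal.ofReal_le_ofReal (hB _ _)).trans (by simp)
  have := lintegral_enorm_convolution_sq_le hK' hg' hg2 hu hu2 hF
  have t1 := mps.lintegral_comp_emb e.symm.measurableEmbedding (fun z => ‖conv K g z‖ₑ ^ 2)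
  have t2 := mps.lintegral_comp_emb e.symm.measurableEmbedding (fun z => ‖g z‖ₑ ^ 2)
  rw [← t1, ← t2]
  simpa [hcve, g', ← ofReal_norm] using this

/-- The first order partial derivatives of the heat kernel. -/
def heatG {N : ℕ} (i : Fin N) (a : ℝ) (y : RN N) : ℝ := -(y i / (2 * a)) * heatK a y

theorem single_add_smul {N : ℕ} (i : Fin N) (y : RN N) (t : ℝ) :
    y + t • (Pi.single i 1 : RN N) = fun k => y k + t * (Pi.single i (1 : ℝ) : RN N) k := by
  ext k; simp

theorem hasLineDerivAt_heatK {N : ℕ} (i : Fin N) {a : ℝ} (ha : 0 < a) (y : RN N) :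
    HasLineDerivAt ℝ (heatK a) (heatG i a y) y (Pi.single i 1) := by
  have h := hasDerivAt_heatK_path (a := a) (α := 0) (θ := 0) y (Pi.single i 1) (by simpa using ha)
  simp only [HasLineDerivAt, single_add_smul]
  simp only [mul_zero, add_zero] at h
  refine h.congr_deriv ?_
  simp [heatG, Pi.single_apply]
  left
  ring

theorem hasLineDerivAt_coord {N : ℕ} (i j : Fin N) (y : RN N) :
    HasLineDerivAt ℝ (fun y : RN N => y j) (if i = j then 1 else 0) y (Pi.single i 1) := by
  simp only [HasLineDerivAt, single_add_smul]
  have := (((hasDerivAt_id (0 : ℝ)).mul_const ((Pi.single i (1 : ℝ) : RN N) j)).const_add (y j))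
  refine this.congr_deriv ?_
  simp [Pi.single_apply, eq_comm]

theorem hasLineDerivAt_heatG {N : ℕ} (i j : Fin N) {a : ℝ} (ha : 0 < a) (y : RN N) :
    HasLineDerivAt ℝ (heatG j a) (heatH i j a y) y (Pi.single i 1) := by
  have h1 := hasLineDerivAt_heatK i ha y
  have h2 := hasLineDerivAt_coord i j y
  unfold HasLineDerivAt at *
  unfold heatG
  refine ((h2.div_const (2 * a)).fun_neg.fun_mul h1).congr_deriv ?_
  simp only [zero_smul, add_zero, heatH, heatP, heatG]
  field_simp
  ring

theorem hasDerivAt_heatK {N : ℕ} {a : ℝ} (ha : 0 < a) (y : RN N) :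
    HasDerivAt (fun a => heatK a y) (∑ i, heatH i i a y) a := by
  have h := hasDerivAt_heatK_path (a := 0) (α := 1) (θ := a) y 0 (by simpa using ha)
  simp only [mul_one, zero_add, Pi.zero_apply, mul_zero, add_zero] at h
  refine h.congr_deriv ?_
  simp only [heatH, heatP, ← Finset.sum_mul, Finset.sum_sub_distrib, if_true, Finset.sum_const_zero,
    Finset.sum_const, Finset.card_univ, Fintype.card_fin, nsmul_eq_mul, ← sq, ← Finset.sum_div]
  field_simp
  ring

theorem measurable_heatG {N : ℕ} (i : Fin N) : Measurable fun q : ℝ × RN N => heatG i q.1 q.2 := by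
  have := measurable_heatK (N := N)
  unfold heatG
  fun_prop

theorem abs_heatG_le {N : ℕ} (i : Fin N) {a : ℝ} (ha : 0 < a) (y : RN N) :
    |heatG i a y| ≤ a ^ (-(1 : ℝ) / 2) * ((1 + (∑ k, y k ^ 2) / a) ^ 2 * heatK a y) := by
  have hK := heatK_nonneg ha y
  have hs0 := Real.sqrt_pos.2 ha
  have e : a ^ (-(1 : ℝ) / 2) = (Real.sqrt a)⁻¹ := by
    rw [Real.sqrt_eq_rpow, ← Real.rpow_neg ha.le]; norm_num
  have h1 : y i ^ 2 ≤ ∑ k, y k ^ 2 :=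
    Finset.single_le_sum (f := fun k => y k ^ 2) (fun k _ => sq_nonneg _) (Finset.mem_univ i)
  have h2 := one_le_one_add_div ha y
  set q := (∑ k, y k ^ 2) / a with hq
  have h3 : |y i| / (2 * a) ≤ (Real.sqrt a)⁻¹ * (1 + q) ^ 2 := by
    have h4 : (|y i| / Real.sqrt a) ^ 2 ≤ q := by
      rw [div_pow, sq_abs, Real.sq_sqrt ha.le, hq]; gcongr
    have h5 : |y i| / (2 * a) = (Real.sqrt a)⁻¹ * (|y i| / Real.sqrt a / 2) := by
      nth_rw 1 [← Real.sq_sqrt ha.le]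
      field_simp
    rw [h5]
    gcongr
    nlinarith [sq_nonneg (|y i| / Real.sqrt a - 1)]
  rw [heatG, abs_mul, abs_neg, abs_div, abs_of_pos (show 0 < 2 * a by positivity), abs_of_nonneg hK,
    e, ← mul_assoc]
  gcongr

theorem exists_lintegral_heatG_le (N : ℕ) : ∃ C : ℝ, 0 < C ∧ ∀ (i : Fin N) (a : ℝ), 0 < a →
    ∫⁻ y, ‖heatG i a y‖ₑ ≤ ENNReal.ofReal (C * a ^ (-(1 : ℝ) / 2)) := by
  obtain ⟨C, hC, h⟩ := exists_lintegral_le_of_le_poly_mul_heatK N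
  exact ⟨C, hC, fun i a ha => h a ha _ _ (by positivity) fun y => abs_heatG_le i ha y⟩

theorem integrable_heatG {N : ℕ} (i : Fin N) {a : ℝ} (ha : 0 < a) : Integrable (heatG i a) := by
  obtain ⟨C, hC, h⟩ := exists_lintegral_heatG_le N
  exact ⟨((measurable_heatG i).comp measurable_prodMk_left).aestronglyMeasurable,
    (h i a ha).trans_lt ENNReal.ofReal_lt_top⟩

theorem integrable_heatH {N : ℕ} (i j : Fin N) {a : ℝ} (ha : 0 < a) : Integrable (heatH i j a) := by
  obtain ⟨C, hC, h⟩ := exists_heatH_bounds N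
  exact ⟨((measurable_heatH i j).comp measurable_prodMk_left).aestronglyMeasurable,
    (h i j a ha).1.trans_lt ENNReal.ofReal_lt_top⟩

/-- The plane wave `e^{i y·ξ}`. -/
def wave {N : ℕ} (ξ y : RN N) : ℂ := Complex.exp (Complex.I * (∑ i, y i * ξ i : ℝ))

theorem norm_wave {N : ℕ} (ξ y : RN N) : ‖wave ξ y‖ = 1 := by
  rw [wave, mul_comm]; exact Complex.norm_exp_ofReal_mul_I _

theorem continuous_wave {N : ℕ} (ξ : RN N) : Continuous (wave ξ) := by
  unfold wave
  fun_prop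

theorem integrable_wave_mul {N : ℕ} (ξ : RN N) {f : RN N → ℝ} (hf : Integrable f) :
    Integrable fun y => wave ξ y * (f y : ℂ) :=
  hf.ofReal.bdd_mul (c := 1) (continuous_wave ξ).aestronglyMeasurable
    (ae_of_all _ fun y => (norm_wave ξ y).le)

theorem hasLineDerivAt_wave {N : ℕ} (ξ : RN N) (i : Fin N) (y : RN N) :
    HasLineDerivAt ℝ (wave ξ) (Complex.I * ξ i * wave ξ y) y (Pi.single i 1) := by
  have h1 : HasDerivAt (fun t : ℝ => ∑ k, (y + t • (Pi.single i 1 : RN N)) k * ξ k) (ξ i) 0 := by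
    have : ∀ k, HasDerivAt (fun t : ℝ => (y + t • (Pi.single i 1 : RN N)) k * ξ k)
        ((if i = k then 1 else 0) * ξ k) 0 := fun k => (hasLineDerivAt_coord i k y).mul_const _
    refine (HasDerivAt.fun_sum fun k _ => this k).congr_deriv ?_
    simp
  have h2 := ((h1.ofReal_comp).const_mul Complex.I).cexp
  refine h2.congr_deriv ?_
  simp [wave]
  ring

theorem integral_wave_mul_lineDeriv {N : ℕ} (ξ : RN N) (i : Fin N) {f f' : RN N → ℝ}
    (hf : Integrable f) (hf' : Integrable f')
    (h : ∀ y, HasLineDerivAt ℝ f (f' y) y (Pi.single i 1)) :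
    ∫ y, wave ξ y * (f' y : ℂ) = -(Complex.I * ξ i) * ∫ y, wave ξ y * (f y : ℂ) := by
  have := integral_bilinear_hasLineDerivAt_right_eq_neg_left_of_integrable (μ := volume)
    (B := ContinuousLinearMap.mul ℝ ℂ) (f := wave ξ) (g := fun y => (f y : ℂ))
    (f' := fun y => Complex.I * ξ i * wave ξ y) (g' := fun y => (f' y : ℂ))
    (v := (Pi.single i 1 : RN N))
    (by simpa [mul_assoc] using (integrable_wave_mul ξ hf).const_mul (Complex.I * ξ i))
    (integrable_wave_mul ξ hf') (integrable_wave_mul ξ hf)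
    (fun y _ => hasLineDerivAt_wave ξ i y) (fun y _ => (h y).ofReal_comp)
  simp only [ContinuousLinearMap.mul_apply'] at this
  rw [this, ← integral_const_mul, ← integral_neg]
  refine integral_congr_ae (ae_of_all _ fun y => ?_)
  ring

theorem integral_wave_mul_heatH {N : ℕ} (ξ : RN N) (i j : Fin N) {a : ℝ} (ha : 0 < a) :
    ∫ y, wave ξ y * (heatH i j a y : ℂ) = (-(ξ i * ξ j) * Real.exp (-a * ∑ k, ξ k ^ 2) : ℝ) := by
  rw [integral_wave_mul_lineDeriv ξ i (integrable_heatG j ha) (integrable_heatH i j ha)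
    (hasLineDerivAt_heatG i j ha), integral_wave_mul_lineDeriv ξ j (integrable_heatK ha)
    (integrable_heatG j ha) (hasLineDerivAt_heatK j ha)]
  simp only [wave]
  rw [integral_cexp_mul_heatK ha]
  push_cast
  linear_combination (ξ i * ξ j * Complex.exp (-a * ∑ k, (ξ k : ℂ) ^ 2)) * Complex.I_sq

theorem norm_integral_wave_mul_heatCZ_le {N : ℕ} {ε : ℝ} (hε : 0 < ε) (i j : Fin N) (ξ : RN N)
    (τ : ℝ) : ‖∫ z : RN N × ℝ, Complex.exp (Complex.I * (∑ k, z.1 k * ξ k + z.2 * τ : ℝ))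
      * heatCZ ε i j z‖ ≤ (1 : ℝ≥0) := by
  set S := ∑ k, ξ k ^ 2 with hS
  have hS0 : 0 ≤ S := Finset.sum_nonneg fun k _ => sq_nonneg _
  have h_int : Integrable (fun z : RN N × ℝ =>
      Complex.exp (Complex.I * (∑ k, z.1 k * ξ k + z.2 * τ : ℝ))
      * heatCZ ε i j z) := by
    refine (integrable_heatCZ hε i j).ofReal.bdd_mul (c := 1)
      (Continuous.aestronglyMeasurable (by fun_prop)) (ae_of_all _ fun y => ?_)
    rw [mul_comm]; exact (Complex.norm_exp_ofReal_mul_I _).le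
  rw [Measure.volume_eq_prod] at h_int ⊢
  rw [integral_prod_symm _ h_int]
  have hin : ∀ s : ℝ, ∫ y : RN N, Complex.exp (Complex.I * (∑ k, y k * ξ k + s * τ : ℝ))
      * heatCZ ε i j (y, s) = (Iio 0).indicator
          (fun s : ℝ => Complex.exp (Complex.I * (s * τ : ℝ)) *
        (Real.exp (-(ε - s)) * (-(ξ i * ξ j) * Real.exp (-(ε - s) * S)) : ℝ)) s := fun s => by
    by_cases hs : s < 0
    · have hw := integral_wave_mul_heatH ξ i j (a := ε - s) (by linarith)
      rw [← hS] at hw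
      rw [indicator_of_mem (show s ∈ Iio 0 from hs), Complex.ofReal_mul (Real.exp (-(ε - s))),
        ← hw, ← mul_assoc, ← integral_const_mul]
      refine integral_congr_ae (ae_of_all _ fun y => ?_)
      simp only [heatCZ, if_pos hs, wave]
      push_cast
      rw [mul_add, Complex.exp_add]
      ring
    · rw [indicator_of_notMem (by simpa using hs)]
      simp [heatCZ, if_neg hs]
  simp only [hin]
  rw [integral_indicator measurableSet_Iio]
  rcases hS0.eq_or_lt with h0 | h0
  · have hξ : ξ i = 0 := by
      have := (Finset.sum_eq_zero_iff_of_nonneg (fun k _ => sq_nonneg (ξ k))).1 h0.symm i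
        (Finset.mem_univ i)
      simpa using this
    simp [hξ]
  calc _ ≤ ∫ s in Iio 0, S * Real.exp (S * s) := by
        refine norm_integral_le_of_norm_le
          (((integrableOn_exp_mul_Iic h0 0).mono_set Iio_subset_Iic_self).const_mul S) ?_
        refine (ae_restrict_iff' measurableSet_Iio).2 (ae_of_all _ fun s hs => ?_)
        have hs' : s < 0 := hs
        rw [norm_mul, mul_comm Complex.I, Complex.norm_exp_ofReal_mul_I, one_mul, Complex.norm_real,
          norm_mul, norm_mul, norm_neg, Real.norm_of_nonneg (Real.exp_pos _).le,
          Real.norm_of_nonneg (Real.exp_pos _).le, Real.norm_eq_abs]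
        have e1 : Real.exp (-(ε - s)) ≤ 1 := by rw [Real.exp_le_one_iff]; linarith
        have e2 : Real.exp (-(ε - s) * S) ≤ Real.exp (S * s) := Real.exp_le_exp.2 (by nlinarith)
        calc _ ≤ 1 * (S * Real.exp (S * s)) :=
              mul_le_mul e1 (mul_le_mul (abs_mul_le_sum_sq i j ξ) e2 (Real.exp_pos _).le hS0)
                (by positivity) zero_le_one
          _ = _ := one_mul _
    _ = 1 := by
        rw [integral_const_mul, ← integral_Iic_eq_integral_Iio, integral_exp_mul_Iic h0]
        simp [h0.ne']
    _ = _ := by simp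

theorem exists_CZKernel_heatCZ (N : ℕ) : ∃ B : ℝ≥0, ∀ (ε : ℝ), 0 < ε → ∀ (i j : Fin N),
    CZKernel (heatCZ ε i j) B := by
  obtain ⟨B, hB⟩ := exists_heatCZ_hormander N
  refine ⟨max B 1, fun ε hε i j => ⟨measurable_heatCZ ε i j, bdd_heatCZ hε i j,
    integrable_heatCZ hε i j, fun g _ hgi ⟨M', hM'⟩ => ?_, fun l hl h h1 h2 => ?_⟩⟩
  · obtain ⟨M, hM⟩ := bdd_heatCZ hε i j
    refine lintegral_conv_sq_le (integrable_heatCZ hε i j) hM (fun ξ τ => ?_) hgi hM'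
    exact (norm_integral_wave_mul_heatCZ_le hε i j ξ τ).trans (by exact_mod_cast le_max_right _ _)
  · exact (hB ε hε i j l hl h h1 h2).trans (by exact_mod_cast le_max_left _ _)

/-- The lattice vector `(k, 0)` of space-time. -/
def latt {N : ℕ} (k : Fin N → ℤ) : RN N × ℝ := (fun i => (k i : ℝ), 0)

/-- Smooth functions on space-time, periodic in space and supported in `a ≤ t ≤ b`. -/
structure PerTest {N : ℕ} {F : Type} [NormedAddCommGroup F] [NormedSpace ℝ F]
    (a b : ℝ) (f : RN N × ℝ → F) : Prop where
  smooth : ContDiff ℝ (⊤ : ℕ∞) f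
  per : ∀ (k : Fin N → ℤ) z, f (z + latt k) = f z
  supp : ∀ z, z.2 ∉ Icc a b → f z = 0

namespace PerTest

variable {N : ℕ} {F : Type} [NormedAddCommGroup F] [NormedSpace ℝ F] {a b : ℝ}
  {f : RN N × ℝ → F}

theorem differentiable (hf : PerTest a b f) : Differentiable ℝ f :=
  hf.smooth.differentiable (by simp)

theorem continuous (hf : PerTest a b f) : Continuous f := hf.smooth.continuous

theorem total_deriv (hf : PerTest a b f) : PerTest a b (fderiv ℝ f) where
  smooth := hf.smooth.fderiv_right (by simp)
  per k z := by
    rw [← fderiv_comp_add_right]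
    congr 1
    ext1 y
    exact hf.per k y
  supp z hz := by
    have : f =ᶠ[𝓝 z] fun _ => 0 := by
      have ho : IsOpen {z : RN N × ℝ | z.2 ∉ Icc a b} :=
        (isClosed_Icc.preimage continuous_snd).isOpen_compl
      filter_upwards [ho.mem_nhds hz] with y hy using hf.supp y hy
    rw [this.fderiv_eq]
    simp

theorem clm_comp {G : Type} [NormedAddCommGroup G] [NormedSpace ℝ G] (hf : PerTest a b f)
    (L : F →L[ℝ] G) : PerTest a b (fun z => L (f z)) where
  smooth := L.contDiff.comp hf.smooth
  per k z := by rw [hf.per]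
  supp z hz := by rw [hf.supp z hz, map_zero]

theorem dir_deriv (hf : PerTest a b f) (v : RN N × ℝ) :
    PerTest a b (fun z => fderiv ℝ f z v) :=
  hf.total_deriv.clm_comp (ContinuousLinearMap.apply ℝ F v)

theorem norm_bdd (hf : PerTest a b f) : ∃ M, ∀ z, ‖f z‖ ≤ M := by
  have hc : IsCompact ((Icc 0 1 : Set (RN N)) ×ˢ Icc a b) := isCompact_Icc.prod isCompact_Icc
  obtain ⟨M, hM⟩ := hc.exists_bound_of_continuousOn hf.continuous.continuousOn
  refine ⟨max M 0, fun z => ?_⟩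
  by_cases hz : z.2 ∈ Icc a b
  · have := hf.per (fun i => ⌊z.1 i⌋) ((fun i => Int.fract (z.1 i)), z.2)
    have e : ((fun i => Int.fract (z.1 i)), z.2) + latt (fun i => ⌊z.1 i⌋) = z := by
      ext i
      · simp [latt]
      · simp [latt]
    rw [e] at this
    rw [this]
    refine (hM ((fun i => Int.fract (z.1 i)), z.2)
      ⟨⟨fun i => Int.fract_nonneg (z.1 i), fun i => ?_⟩, hz⟩).trans (le_max_left _ _)
    exact (Int.fract_lt_one (z.1 i)).le
  · rw [hf.supp z hz]
    simp

end PerTest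

/-- Convolution of a kernel with a vector-valued function, written with the variable in `f`. -/
def cv {N : ℕ} {F : Type} [NormedAddCommGroup F] [NormedSpace ℝ F] (K : RN N × ℝ → ℝ)
    (f : RN N × ℝ → F) (z : RN N × ℝ) : F := ∫ w, K w • f (z - w)

theorem cv_eq_conv {N : ℕ} (K f : RN N × ℝ → ℝ) : cv K f = conv K f := by
  ext z
  unfold cv conv
  rw [← integral_sub_left_eq_self _ volume z]
  simp

section

variable {N : ℕ} {F : Type} [NormedAddCommGroup F] [NormedSpace ℝ F] {a b : ℝ}
  {f : RN N × ℝ → F} {K : RN N × ℝ → ℝ}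

theorem PerTest.integrable_smul (hf : PerTest a b f) (hK : Integrable K) (z : RN N × ℝ) :
    Integrable fun w => K w • f (z - w) := by
  obtain ⟨M, hM⟩ := hf.norm_bdd
  refine hK.smul_bdd M ?_ (ae_of_all _ fun w => hM _)
  exact (hf.continuous.comp (continuous_const.sub continuous_id)).aestronglyMeasurable

theorem PerTest.hasFDerivAt_cv [CompleteSpace F] (hf : PerTest a b f) (hK : Integrable K)
    (z : RN N × ℝ) : HasFDerivAt (cv K f) (cv K (fderiv ℝ f) z) z := by
  obtain ⟨M, hM⟩ := hf.total_deriv.norm_bdd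
  unfold cv
  refine hasFDerivAt_integral_of_dominated_of_fderiv_le (𝕜 := ℝ) (s := univ)
    (bound := fun w => ‖K w‖ * M)
    (F' := fun z w => K w • fderiv ℝ f (z - w)) univ_mem ?_ ?_ ?_ ?_ ?_ ?_
  · exact Eventually.of_forall fun y => (hf.integrable_smul hK y).aestronglyMeasurable
  · exact hf.integrable_smul hK z
  · exact (hf.total_deriv.integrable_smul hK z).aestronglyMeasurable
  · refine ae_of_all _ fun w y _ => ?_
    rw [norm_smul]
    exact mul_le_mul_of_nonneg_left (hM _) (norm_nonneg _)
  · exact hK.norm.mul_const M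
  · refine ae_of_all _ fun w y _ => ?_
    have h1 := (hf.differentiable (y - w)).hasFDerivAt
    have h2 : HasFDerivAt (fun y => f (y - w)) (fderiv ℝ f (y - w)) y := by
      have := h1.comp y ((hasFDerivAt_id y).sub_const w)
      rwa [ContinuousLinearMap.comp_id] at this
    exact h2.const_smul (K w)

theorem PerTest.contDiff_cv_nat (n : ℕ) : ∀ (F : Type) [NormedAddCommGroup F] [NormedSpace ℝ F]
    [CompleteSpace F] (f : RN N × ℝ → F), PerTest a b f → Integrable K →
    ContDiff ℝ n (cv K f) := by
  induction n with
  | zero =>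
    intro F _ _ _ f hf hK
    rw [Nat.cast_zero, contDiff_zero]
    exact continuous_iff_continuousAt.2 fun z => (hf.hasFDerivAt_cv hK z).continuousAt
  | succ n ih =>
    intro F _ _ _ f hf hK
    have e : fderiv ℝ (cv K f) = cv K (fderiv ℝ f) :=
      funext fun z => (hf.hasFDerivAt_cv hK z).fderiv
    push_cast
    rw [contDiff_succ_iff_fderiv]
    refine ⟨fun z => (hf.hasFDerivAt_cv hK z).differentiableAt, by simp, ?_⟩
    rw [e]
    exact ih _ _ hf.total_deriv hK

theorem PerTest.contDiff_cv [CompleteSpace F] (hf : PerTest a b f) (hK : Integrable K) :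
    ContDiff ℝ (⊤ : ℕ∞) (cv K f) :=
  contDiff_infty.2 fun n => PerTest.contDiff_cv_nat n F f hf hK

theorem PerTest.cv_per (hf : PerTest a b f) (k : Fin N → ℤ) (z : RN N × ℝ) :
    cv K f (z + latt k) = cv K f z := by
  unfold cv
  congr 1 with w
  rw [show z + latt k - w = z - w + latt k by abel, hf.per]

theorem PerTest.cv_eq_zero (hf : PerTest a b f) (hK : ∀ z, 0 ≤ z.2 → K z = 0) {z : RN N × ℝ}
    (hz : b ≤ z.2) : cv K f z = 0 := by
  unfold cv
  rw [← integral_zero (RN N × ℝ) F]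
  congr 1 with w
  by_cases hw : 0 ≤ w.2
  · rw [hK w hw, zero_smul]
  · rw [hf.supp, smul_zero]
    intro h
    have := h.2
    simp only [Prod.snd_sub] at this
    linarith

theorem PerTest.fderiv_cv_apply [CompleteSpace F] (hf : PerTest a b f) (hK : Integrable K)
    (z v : RN N × ℝ) :
    fderiv ℝ (cv K f) z v = cv K (fun y => fderiv ℝ f y v) z := by
  rw [(hf.hasFDerivAt_cv hK z).fderiv]
  unfold cv
  rw [ContinuousLinearMap.integral_apply (hf.total_deriv.integrable_smul hK z)]
  rfl

/-- Integration by parts in a space-time direction `v`. -/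
theorem PerTest.cv_fderiv {f : RN N × ℝ → ℝ} {K' : RN N × ℝ → ℝ} (hf : PerTest a b f)
    (hK : Integrable K) (hK' : Integrable K') {v : RN N × ℝ}
    (hd : ∀ z, HasLineDerivAt ℝ K (K' z) z v) (z : RN N × ℝ) :
    cv K (fun y => fderiv ℝ f y v) z = cv K' f z := by
  have h := integral_bilinear_hasLineDerivAt_right_eq_neg_left_of_integrable (μ := volume)
    (B := ContinuousLinearMap.mul ℝ ℝ) (f := K) (f' := K') (g := fun w => f (z - w))
    (g' := fun w => - fderiv ℝ f (z - w) v) (v := v)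
    (by simpa using hf.integrable_smul hK' z)
    (by simpa using ((hf.dir_deriv v).integrable_smul hK z).neg)
    (by simpa using hf.integrable_smul hK z)
    (fun y _ => hd y) (fun y _ => by
      have h1 := (hf.differentiable (z - y)).hasFDerivAt
      have h2 : HasFDerivAt (fun y => f (z - y)) (-fderiv ℝ f (z - y)) y := by
        have := h1.comp y ((hasFDerivAt_id y).const_sub z)
        refine this.congr_fderiv ?_
        ext <;> simp
      simpa using h2.hasLineDerivAt v)
  simp only [ContinuousLinearMap.mul_apply', mul_neg, integral_neg, neg_inj] at h
  simpa [cv] using h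

end

/-- The space-time kernel `1_{s < 0} e^{-(ε - s)} k(ε - s, y)`. -/
def damp {N : ℕ} (k : ℝ → RN N → ℝ) (ε : ℝ) (z : RN N × ℝ) : ℝ :=
  if z.2 < 0 then Real.exp (-(ε - z.2)) * k (ε - z.2) z.1 else 0

theorem damp_eq_zero {N : ℕ} (k : ℝ → RN N → ℝ) (ε : ℝ) (z : RN N × ℝ) (hz : 0 ≤ z.2) :
    damp k ε z = 0 := by
  simp [damp, hz.not_gt]

theorem measurable_damp {N : ℕ} {k : ℝ → RN N → ℝ}
    (hk : Measurable fun q : ℝ × RN N => k q.1 q.2) (ε : ℝ) : Measurable (damp k ε) := by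
  unfold damp
  refine Measurable.ite (measurableSet_lt measurable_snd measurable_const) ?_ measurable_const
  have := hk.comp (f := fun z : RN N × ℝ => (ε - z.2, z.1)) (by fun_prop)
  simp only [Function.comp_def] at this
  fun_prop

theorem lintegral_mul_damp {N : ℕ} {k : ℝ → RN N → ℝ}
    (hk : Measurable fun q : ℝ × RN N => k q.1 q.2) (ε : ℝ) (w : RN N × ℝ → ℝ≥0∞)
    (hw : Measurable w) :
    ∫⁻ z, w z * ‖damp k ε z‖ₑ = ∫⁻ s in Iio (0 : ℝ),
      ENNReal.ofReal (Real.exp (-(ε - s))) * ∫⁻ y, w (y, s) * ‖k (ε - s) y‖ₑ := by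
  have hm : Measurable fun z : RN N × ℝ => w z * ‖damp k ε z‖ₑ :=
    hw.mul (measurable_damp hk ε).enorm
  rw [Measure.volume_eq_prod, lintegral_prod_symm' _ hm, ← lintegral_indicator measurableSet_Iio]
  refine lintegral_congr fun s => ?_
  by_cases hs : s < 0
  · rw [indicator_of_mem (by exact hs), ← lintegral_const_mul' _ _ ENNReal.ofReal_ne_top]
    refine lintegral_congr fun y => ?_
    simp only [damp, hs, if_true, enorm_mul, Real.enorm_of_nonneg (Real.exp_pos _).le]
    ring
  · rw [indicator_of_notMem (by exact hs)]
    simp [damp, hs]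

theorem lintegral_damp {N : ℕ} {k : ℝ → RN N → ℝ}
    (hk : Measurable fun q : ℝ × RN N => k q.1 q.2) (ε : ℝ) :
    ∫⁻ z, ‖damp k ε z‖ₑ = ∫⁻ s in Iio (0 : ℝ),
      ENNReal.ofReal (Real.exp (-(ε - s))) * ∫⁻ y, ‖k (ε - s) y‖ₑ := by
  simpa using lintegral_mul_damp hk ε (fun _ => 1) measurable_const

theorem lintegral_damp_heatK_le {N : ℕ} {ε : ℝ} (hε : 0 < ε) :
    ∫⁻ z : RN N × ℝ, ‖damp heatK ε z‖ₑ ≤ 1 := by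
  rw [lintegral_damp measurable_heatK, ← lintegral_Iio_exp]
  refine setLIntegral_mono (by fun_prop) fun s hs => ?_
  have hs' : s < 0 := hs
  have : ∫⁻ y : RN N, ‖heatK (ε - s) y‖ₑ = 1 := by
    rw [← lintegral_heatK (N := N) (show 0 < ε - s by linarith)]
    exact lintegral_congr fun y => Real.enorm_of_nonneg (heatK_nonneg (by linarith) y)
  rw [this, mul_one]
  exact ENNReal.ofReal_le_ofReal (Real.exp_le_exp.2 (by linarith))

theorem integrable_damp_heatK {N : ℕ} {ε : ℝ} (hε : 0 < ε) :
    Integrable (damp heatK ε : RN N × ℝ → ℝ) :=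
  ⟨(measurable_damp measurable_heatK ε).aestronglyMeasurable,
    (lintegral_damp_heatK_le hε).trans_lt ENNReal.one_lt_top⟩

theorem exists_lintegral_damp_heatG_le (N : ℕ) : ∃ B : ℝ≥0, ∀ (ε : ℝ), 0 < ε → ∀ i : Fin N,
    ∫⁻ z, ‖damp (heatG i) ε z‖ₑ ≤ B := by
  obtain ⟨C, hC, h⟩ := exists_lintegral_heatG_le N
  have h1 : IntegrableOn (fun s : ℝ => Real.exp s * (-s) ^ (-(1 : ℝ) / 2)) (Iio 0) := by
    have := Real.GammaIntegral_convergent (s := 1 / 2) (by norm_num)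
    rw [← (Measure.measurePreserving_neg (volume : Measure ℝ)).integrableOn_comp_preimage
      (MeasurableEquiv.neg ℝ).measurableEmbedding] at this
    rw [show (Neg.neg ⁻¹' Ioi (0 : ℝ)) = Iio 0 by ext; simp] at this
    refine this.congr_fun (fun s _ => ?_) measurableSet_Iio
    simp only [Function.comp_apply, neg_neg]
    norm_num
  have h2 : ∫⁻ s in Iio (0 : ℝ), ENNReal.ofReal (C * (Real.exp s * (-s) ^ (-(1 : ℝ) / 2))) ≠ ∞ := by
    have := (h1.const_mul C).2
    refine ne_top_of_le_ne_top this.ne ?_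
    exact lintegral_mono fun s => by rw [← ofReal_norm]; gcongr; exact Real.le_norm_self _
  refine ⟨(∫⁻ s in Iio (0 : ℝ),
    ENNReal.ofReal (C * (Real.exp s * (-s) ^ (-(1 : ℝ) / 2)))).toNNReal, fun ε hε i => ?_⟩
  rw [ENNReal.coe_toNNReal h2, lintegral_damp (measurable_heatG i)]
  refine setLIntegral_mono (by fun_prop) fun s hs => ?_
  have hs' : s < 0 := hs
  calc _ ≤ ENNReal.ofReal (Real.exp s) * ENNReal.ofReal (C * (-s) ^ (-(1 : ℝ) / 2)) := by
        refine mul_le_mul ?_ ?_ zero_le zero_le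
        · exact ENNReal.ofReal_le_ofReal (Real.exp_le_exp.2 (by linarith))
        · refine (h i (ε - s) (by linarith)).trans (ENNReal.ofReal_le_ofReal ?_)
          refine mul_le_mul_of_nonneg_left ?_ hC.le
          exact Real.rpow_le_rpow_of_nonpos (by linarith) (by linarith) (by norm_num)
    _ = _ := by
        rw [← ENNReal.ofReal_mul (Real.exp_pos _).le]
        congr 1
        ring

theorem integrable_damp_heatG {N : ℕ} {ε : ℝ} (hε : 0 < ε) (i : Fin N) :
    Integrable (damp (heatG i) ε) := by
  obtain ⟨B, hB⟩ := exists_lintegral_damp_heatG_le N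
  exact ⟨(measurable_damp (measurable_heatG i) ε).aestronglyMeasurable,
    (hB ε hε i).trans_lt ENNReal.coe_lt_top⟩

/-- The unit vector of space-time in the `i`-th space direction. -/
def dirX {N : ℕ} (i : Fin N) : RN N × ℝ := (Pi.single i 1, 0)

theorem hasLineDerivAt_damp {N : ℕ} {k k' : ℝ → RN N → ℝ} {i : Fin N}
    (h : ∀ a, 0 < a → ∀ y, HasLineDerivAt ℝ (k a) (k' a y) y (Pi.single i 1)) {ε : ℝ}
    (hε : 0 < ε) (z : RN N × ℝ) : HasLineDerivAt ℝ (damp k ε) (damp k' ε z) z (dirX i) := by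
  by_cases hz : z.2 < 0
  · have := (h (ε - z.2) (by linarith) z.1).const_mul (Real.exp (-(ε - z.2)))
    simpa [HasLineDerivAt, damp, dirX, hz] using this
  · simpa [HasLineDerivAt, damp, dirX, hz] using hasDerivAt_const (0 : ℝ) (0 : ℝ)

section

variable {N : ℕ} {a b : ℝ} {f : RN N × ℝ → ℝ} {ε : ℝ}

theorem PerTest.cv_heatK_dirX (hf : PerTest a b f) (hε : 0 < ε) (i : Fin N) (z : RN N × ℝ) :
    cv (damp heatK ε) (fun y => fderiv ℝ f y (dirX i)) z = cv (damp (heatG i) ε) f z :=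
  hf.cv_fderiv (integrable_damp_heatK hε) (integrable_damp_heatG hε i)
    (hasLineDerivAt_damp (fun _ ha y => hasLineDerivAt_heatK i ha y) hε) z

theorem PerTest.cv_heatG_dirX (hf : PerTest a b f) (hε : 0 < ε) (i j : Fin N) (z : RN N × ℝ) :
    cv (damp (heatG j) ε) (fun y => fderiv ℝ f y (dirX i)) z = cv (heatCZ ε i j) f z :=
  hf.cv_fderiv (integrable_damp_heatG hε j) (integrable_heatCZ hε i j)
    (hasLineDerivAt_damp (fun _ ha y => hasLineDerivAt_heatG i j ha y) hε) z

theorem PerTest.cv_heatK_dirX_dirX (hf : PerTest a b f) (hε : 0 < ε) (i j : Fin N)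
    (z : RN N × ℝ) :
    cv (damp heatK ε) (fun y => fderiv ℝ (fun y => fderiv ℝ f y (dirX i)) y (dirX j)) z
      = cv (heatCZ ε i j) f z := by
  rw [(hf.dir_deriv (dirX i)).cv_heatK_dirX hε j, hf.cv_heatG_dirX hε i j]

end

section

variable {N : ℕ} {a b : ℝ} {f : RN N × ℝ → ℝ} {ε : ℝ}

theorem hasDerivAt_damped_heatK {N : ℕ} {ε s : ℝ} (hs : s < ε) (y : RN N) {u : ℝ → ℝ} {u' : ℝ}
    (hu : HasDerivAt u u' s) :
    HasDerivAt (fun s => -(Real.exp (-(ε - s)) * heatK (ε - s) y * u s))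
      (Real.exp (-(ε - s)) * (heatK (ε - s) y * -u' + (∑ i, heatH i i (ε - s) y) * u s
        - heatK (ε - s) y * u s)) s := by
  have h0 : HasDerivAt (fun s => ε - s) (-1) s := by
    simpa using (hasDerivAt_id s).const_sub ε
  have h1 : HasDerivAt (fun s => Real.exp (-(ε - s))) (Real.exp (-(ε - s))) s := by
    simpa using h0.fun_neg.exp
  have h2 : HasDerivAt (fun s => heatK (ε - s) y) ((∑ i, heatH i i (ε - s) y) * -1) s :=
    (hasDerivAt_heatK (by linarith) y).comp s h0
  refine ((h1.fun_mul h2).fun_mul hu).fun_neg.congr_deriv ?_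
  ring

theorem PerTest.integral_heat_section (hf : PerTest a b f) (hε : 0 < ε) (z : RN N × ℝ) (y : RN N)
    (h_int : Integrable fun s : ℝ => damp heatK ε (y, s) * fderiv ℝ f (z - (y, s)) (0, 1)
        + (∑ i, heatCZ ε i i (y, s)) * f (z - (y, s)) - damp heatK ε (y, s) * f (z - (y, s))) :
    ∫ s : ℝ, (damp heatK ε (y, s) * fderiv ℝ f (z - (y, s)) (0, 1)
        + (∑ i, heatCZ ε i i (y, s)) * f (z - (y, s)) - damp heatK ε (y, s) * f (z - (y, s)))
      = -(Real.exp (-ε) * (heatK ε y * f (z.1 - y, z.2))) := by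
  set g' : ℝ → ℝ := fun s => Real.exp (-(ε - s)) *
    (heatK (ε - s) y * - -fderiv ℝ f (z - (y, s)) (0, 1)
      + (∑ i, heatH i i (ε - s) y) * f (z - (y, s)) - heatK (ε - s) y * f (z - (y, s))) with hg'
  have e : (fun s : ℝ => damp heatK ε (y, s) * fderiv ℝ f (z - (y, s)) (0, 1)
        + (∑ i, heatCZ ε i i (y, s)) * f (z - (y, s)) - damp heatK ε (y, s) * f (z - (y, s)))
      = (Iio 0).indicator g' := by
    ext s
    by_cases hs : s < 0
    · rw [indicator_of_mem (by exact hs)]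
      simp only [damp, heatCZ, hs, if_true, hg', ← Finset.mul_sum]
      ring
    · rw [indicator_of_notMem (by exact hs)]
      simp [damp, heatCZ, hs]
  rw [e] at h_int ⊢
  rw [integrable_indicator_iff measurableSet_Iio, ← integrableOn_Iic_iff_integrableOn_Iio] at h_int
  rw [integral_indicator measurableSet_Iio, ← integral_Iic_eq_integral_Iio]
  have hd : ∀ s, s < ε → HasDerivAt
      (fun s => -(Real.exp (-(ε - s)) * heatK (ε - s) y * f (z - (y, s)))) (g' s) s := by
    intro s hs
    refine hasDerivAt_damped_heatK hs y ?_
    have h1 := (hf.differentiable (z - (y, s))).hasFDerivAt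
    have h2 : HasDerivAt (fun s : ℝ => z - (y, s)) (0, -1) s := by
      have := ((hasDerivAt_const s y).prodMk (hasDerivAt_id s)).const_sub z
      simpa using this
    have := h1.comp_hasDerivAt s h2
    refine this.congr_deriv ?_
    rw [← map_neg]
    simp
  have hlim : Tendsto (fun s => -(Real.exp (-(ε - s)) * heatK (ε - s) y * f (z - (y, s)))) atBot
      (𝓝 0) := by
    refine tendsto_const_nhds.congr' ?_
    filter_upwards [eventually_lt_atBot (z.2 - b)] with s hs
    rw [hf.supp, mul_zero, neg_zero]
    intro h
    have := h.2
    simp only [Prod.snd_sub] at this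
    linarith
  rw [integral_Iic_of_hasDerivAt_of_tendsto (hd 0 hε).continuousAt.continuousWithinAt
    (fun s hs => hd s (lt_trans hs hε)) h_int hlim]
  simp only [sub_zero, mul_assoc]
  rw [show z - (y, (0 : ℝ)) = (z.1 - y, z.2) by ext <;> simp]

/-- The damped heat potential solves the backward heat equation with a regularised source. -/
theorem PerTest.heat_equation (hf : PerTest a b f) (hε : 0 < ε) (z : RN N × ℝ) :
    cv (damp heatK ε) (fun y => fderiv ℝ f y (0, 1)) z + ∑ i, cv (heatCZ ε i i) f z
        - cv (damp heatK ε) f z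
      = -(Real.exp (-ε) * ∫ y, heatK ε y * f (z.1 - y, z.2)) := by
  have i1 := (hf.dir_deriv (0, 1)).integrable_smul (integrable_damp_heatK hε) z
  have i2 : ∀ i, Integrable fun w => heatCZ ε i i w * f (z - w) := fun i =>
    hf.integrable_smul (integrable_heatCZ hε i i) z
  have i3 := hf.integrable_smul (integrable_damp_heatK hε) z
  simp only [smul_eq_mul] at i1 i2 i3
  have i2' := integrable_finsetSum Finset.univ fun i _ => i2 i
  simp only [← Finset.sum_mul] at i2'
  have i4 := (i1.add i2').sub i3
  have e1 : cv (damp heatK ε) (fun y => fderiv ℝ f y (0, 1)) z + ∑ i, cv (heatCZ ε i i) f z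
        - cv (damp heatK ε) f z = ∫ w, (damp heatK ε w * fderiv ℝ f (z - w) (0, 1)
        + (∑ i, heatCZ ε i i w) * f (z - w) - damp heatK ε w * f (z - w)) := by
    rw [integral_sub (by exact i1.add i2') i3, integral_add i1 i2']
    simp only [Finset.sum_mul]
    rw [integral_finsetSum _ fun i _ => i2 i]
    rfl
  rw [e1, Measure.volume_eq_prod, integral_prod _ (by exact i4), ← integral_const_mul,
    ← integral_neg]
  refine integral_congr_ae ?_
  rw [Measure.volume_eq_prod] at i4
  filter_upwards [i4.prod_right_ae] with y hy
  exact hf.integral_heat_section hε z y hy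

end

section

variable {N : ℕ} {V : RN N × ℝ → ℝ}

theorem deriv_section_time (hV : Differentiable ℝ V) (x : RN N) (t : ℝ) :
    HasDerivAt (fun t => V (x, t)) (fderiv ℝ V (x, t) (0, 1)) t := by
  have h2 : HasDerivAt (fun s : ℝ => (x, s)) (0, 1) t :=
    (hasDerivAt_const t x).prodMk (hasDerivAt_id t)
  exact (hV (x, t)).hasFDerivAt.comp_hasDerivAt t h2

theorem hasFDerivAt_section_space (hV : Differentiable ℝ V) (x : RN N) (t : ℝ) :
    HasFDerivAt (fun x => V (x, t))
      ((fderiv ℝ V (x, t)).comp (ContinuousLinearMap.inl ℝ (RN N) ℝ)) x :=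
  (hV (x, t)).hasFDerivAt.comp x (hasFDerivAt_prodMk_left x t)

theorem pd_section_space (hV : Differentiable ℝ V) (i : Fin N) (x : RN N) (t : ℝ) :
    pd i (fun x => V (x, t)) x = fderiv ℝ V (x, t) (dirX i) := by
  rw [pd, (hasFDerivAt_section_space hV x t).fderiv]
  simp [dirX]

theorem pd_const_mul_section (hV : Differentiable ℝ V) (c : ℝ) (i : Fin N) (x : RN N) (t : ℝ) :
    pd i (fun x => c * V (x, t)) x = c * fderiv ℝ V (x, t) (dirX i) := by
  rw [pd, ((hasFDerivAt_section_space hV x t).const_mul c).fderiv]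
  simp [dirX]

end

/-- The test function `e^{-t} U` built from the damped heat potential `U` of `f`. -/
def potTest {N : ℕ} (ε : ℝ) (f : RN N × ℝ → ℝ) (x : RN N) (t : ℝ) : ℝ :=
  Real.exp (-t) * cv (damp heatK ε) f (x, t)

section

variable {N : ℕ} {a b : ℝ} {f : RN N × ℝ → ℝ} {ε : ℝ}

theorem PerTest.isTest_potTest (hf : PerTest a b f) (hε : 0 < ε) : IsTest N (potTest ε f) := by
  have h := hf.contDiff_cv (integrable_damp_heatK hε)
  refine ⟨?_, fun t x k => ?_⟩
  · unfold potTest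
    exact (Real.contDiff_exp.comp contDiff_snd.neg).mul h
  · have := hf.cv_per (K := damp heatK ε) k (x, t)
    unfold potTest
    have e : ((x, t) + latt k : RN N × ℝ) = (fun i => x i + (k i : ℝ), t) := by
      ext <;> simp [latt]
    rw [e] at this
    simp only [this]

theorem PerTest.potTest_eq_zero (hf : PerTest a b f) {t : ℝ} (ht : b ≤ t) (x : RN N) :
    potTest ε f x t = 0 := by
  rw [potTest, hf.cv_eq_zero (damp_eq_zero _ _) (by exact ht), mul_zero]

theorem PerTest.pd_potTest (hf : PerTest a b f) (hε : 0 < ε) (i : Fin N) (x : RN N) (t : ℝ) :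
    pd i (fun y => potTest ε f y t) x = Real.exp (-t) * cv (damp (heatG i) ε) f (x, t) := by
  have h := (hf.contDiff_cv (integrable_damp_heatK hε)).differentiable (by simp)
  unfold potTest
  rw [pd_const_mul_section h, hf.fderiv_cv_apply (integrable_damp_heatK hε), hf.cv_heatK_dirX hε]

theorem PerTest.potTest_equation (hf : PerTest a b f) (hε : 0 < ε) (x : RN N) (t : ℝ) :
    deriv (potTest ε f x) t + lap (fun y => potTest ε f y t) x
      = -(Real.exp (-t) * (Real.exp (-ε) * ∫ y, heatK ε y * f (x - y, t))) := by
  have hc := hf.contDiff_cv (integrable_damp_heatK hε)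
  have h := hc.differentiable (by simp)
  have h1 : deriv (potTest ε f x) t = Real.exp (-t) *
      (cv (damp heatK ε) (fun y => fderiv ℝ f y (0, 1)) (x, t) - cv (damp heatK ε) f (x, t)) := by
    have h0 : HasDerivAt (fun t : ℝ => Real.exp (-t)) (-Real.exp (-t)) t := by
      simpa using (hasDerivAt_id t).fun_neg.exp
    rw [show potTest ε f x = fun t => Real.exp (-t) * cv (damp heatK ε) f (x, t) from rfl,
      (h0.fun_mul (deriv_section_time h x t)).deriv,
      hf.fderiv_cv_apply (integrable_damp_heatK hε)]
    ring
  have h2 : ∀ i, pd i (pd i fun y => potTest ε f y t) x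
      = Real.exp (-t) * cv (heatCZ ε i i) f (x, t) := by
    intro i
    have hd : Differentiable ℝ (cv (damp heatK ε) fun y => fderiv ℝ f y (dirX i)) :=
      ((hf.dir_deriv (dirX i)).contDiff_cv (integrable_damp_heatK hε)).differentiable (by simp)
    have e : pd i (fun y => potTest ε f y t)
        = fun x => Real.exp (-t) * cv (damp heatK ε) (fun y => fderiv ℝ f y (dirX i)) (x, t) := by
      ext x
      rw [hf.pd_potTest hε, hf.cv_heatK_dirX hε]
    rw [e, pd_const_mul_section hd,
      (hf.dir_deriv (dirX i)).fderiv_cv_apply (integrable_damp_heatK hε),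
      hf.cv_heatK_dirX_dirX hε]
  rw [h1, lap, Finset.sum_congr rfl fun i _ => h2 i, ← Finset.mul_sum, ← mul_add, ← mul_neg]
  congr 1
  rw [← hf.heat_equation hε (x, t)]
  ring

end

section

open scoped Pointwise

/-- The space-time strip `cube × ℝ`. -/
def strip (N : ℕ) : Set (RN N × ℝ) := cube N ×ˢ univ

theorem measurableSet_cube (N : ℕ) : MeasurableSet (cube N) := measurableSet_Icc

theorem measurableSet_strip (N : ℕ) : MeasurableSet (strip N) :=
  (measurableSet_cube N).prod MeasurableSet.univ

theorem setLIntegral_cube_sub {N : ℕ} (F : RN N → ℝ≥0∞)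
    (hF : ∀ (k : Fin N → ℤ) x, F (x + fun i => (k i : ℝ)) = F x) (y : RN N) :
    ∫⁻ x in cube N, F (x - y) = ∫⁻ x in cube N, F x := by
  have hc : (cube N : Set (RN N)) =ᵐ[volume] ZSpan.fundamentalDomain (Pi.basisFun ℝ (Fin N)) := by
    rw [ZSpan.fundamentalDomain_pi_basisFun]
    exact (Measure.univ_pi_Ico_ae_eq_Icc (f := (0 : RN N)) (g := 1)).symm
  have hd := ZSpan.isAddFundamentalDomain' (Pi.basisFun ℝ (Fin N)) (volume : Measure (RN N))
  rw [Measure.restrict_congr_set hc]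
  set D := ZSpan.fundamentalDomain (Pi.basisFun ℝ (Fin N)) with hD
  have hinv : ∀ (g : (Submodule.span ℤ (range (Pi.basisFun ℝ (Fin N)))).toAddSubgroup) (x : RN N),
      F (g +ᵥ x) = F x := by
    intro g x
    have hg := (Module.Basis.mem_span_iff_repr_mem ℤ (Pi.basisFun ℝ (Fin N)) (g : RN N)).1 g.2
    choose k hk using hg
    have : (g : RN N) = fun i => (k i : ℝ) := by
      ext i
      simpa using (hk i).symm
    rw [AddSubgroup.vadd_def, vadd_eq_add, add_comm, this, hF]
  have e : ∫⁻ x in D, F (x - y) = ∫⁻ x in (-y) +ᵥ D, F x := by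
    have := (measurePreserving_add_left (volume : Measure (RN N)) (-y)).setLIntegral_comp_emb
      (measurableEmbedding_addLeft (-y)) F D
    rw [← Set.image_vadd]
    simp only [vadd_eq_add] at this ⊢
    rw [← this]
    simp only [sub_eq_neg_add]
  have : Countable (Submodule.span ℤ (range (Pi.basisFun ℝ (Fin N)))).toAddSubgroup :=
    inferInstanceAs (Countable (Submodule.span ℤ (range (Pi.basisFun ℝ (Fin N)))))
  rw [e]
  exact (hd.vadd_of_comm (-y)).setLIntegral_eq hd F hinv

theorem setLIntegral_strip_eq {N : ℕ} (F : RN N × ℝ → ℝ≥0∞) (hm : Measurable F) :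
    ∫⁻ z in strip N, F z = ∫⁻ t, ∫⁻ x in cube N, F (x, t) := by
  rw [strip, Measure.volume_eq_prod, ← Measure.prod_restrict, Measure.restrict_univ,
    lintegral_prod_symm' _ hm]

theorem setLIntegral_strip_sub {N : ℕ} (F : RN N × ℝ → ℝ≥0∞) (hm : Measurable F)
    (hF : ∀ (k : Fin N → ℤ) z, F (z + latt k) = F z) (w : RN N × ℝ) :
    ∫⁻ z in strip N, F (z - w) = ∫⁻ z in strip N, F z := by
  rw [setLIntegral_strip_eq (fun z => F (z - w)) (hm.comp (measurable_id.sub_const w)),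
    setLIntegral_strip_eq _ hm,

    ← lintegral_sub_right_eq_self (fun t => ∫⁻ x in cube N, F (x, t)) w.2]
  refine lintegral_congr fun t => ?_
  rw [← setLIntegral_cube_sub (fun x => F (x, t - w.2)) _ w.1]
  · rfl
  · intro k x
    have := hF k (x, t - w.2)
    simpa [latt] using this

theorem setLIntegral_norm_le_three {N : ℕ} (F : RN N × ℝ → ℝ≥0∞)
    (hF : ∀ (k : Fin N → ℤ) z, F (z + latt k) = F z) :
    ∫⁻ z in {z : RN N × ℝ | ‖z.1‖ ≤ 3}, F z ≤ (6 ^ N : ℝ≥0∞) * ∫⁻ z in strip N, F z := by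
  set κ : (Fin N → Fin 6) → (Fin N → ℤ) := fun k i => (k i : ℤ) - 3 with hκ
  have hsub : {z : RN N × ℝ | ‖z.1‖ ≤ 3} ⊆ ⋃ k, {z | z - latt (κ k) ∈ strip N} := by
    intro z hz
    have hz' : ‖z.1‖ ≤ 3 := hz
    rw [pi_norm_le_iff_of_nonneg (by norm_num)] at hz'
    have : ∀ i, ∃ k : Fin 6, 0 ≤ z.1 i - ((k : ℤ) - 3 : ℤ) ∧ z.1 i - ((k : ℤ) - 3 : ℤ) ≤ 1 := by
      intro i
      have h := abs_le.1 (hz' i)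
      rcases le_total (z.1 i) (-2) with h1 | h1
      · exact ⟨0, by norm_num; constructor <;> linarith⟩
      rcases le_total (z.1 i) (-1) with h2 | h2
      · exact ⟨1, by norm_num; constructor <;> linarith⟩
      rcases le_total (z.1 i) 0 with h3 | h3
      · exact ⟨2, by norm_num; constructor <;> linarith⟩
      rcases le_total (z.1 i) 1 with h4 | h4
      · exact ⟨3, by norm_num; constructor <;> linarith⟩
      rcases le_total (z.1 i) 2 with h5 | h5
      · exact ⟨4, by norm_num; constructor <;> linarith⟩
      · exact ⟨5, by norm_num; constructor <;> linarith⟩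
    choose k hk using this
    refine mem_iUnion.2 ⟨k, ?_⟩
    refine ⟨⟨fun i => ?_, fun i => ?_⟩, mem_univ _⟩
    · exact (hk i).1
    · exact (hk i).2
  calc _ ≤ ∫⁻ z in ⋃ k, {z | z - latt (κ k) ∈ strip N}, F z := lintegral_mono_set hsub
    _ ≤ ∑ k, ∫⁻ z in {z | z - latt (κ k) ∈ strip N}, F z := by
        exact (lintegral_iUnion_le _ _).trans_eq (tsum_fintype _)
    _ = ∑ k : Fin N → Fin 6, ∫⁻ z in strip N, F z := by
        refine Finset.sum_congr rfl fun k _ => ?_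
        have hs : MeasurableSet {z : RN N × ℝ | z - latt (κ k) ∈ strip N} :=
          (measurable_id.sub_const _) (measurableSet_strip N)
        rw [← lintegral_indicator hs, ← lintegral_indicator (measurableSet_strip N),
          ← lintegral_sub_right_eq_self ((strip N).indicator F) (latt (κ k))]
        refine lintegral_congr fun z => ?_
        by_cases hz : z - latt (κ k) ∈ strip N
        · rw [indicator_of_mem hz, indicator_of_mem (by exact hz), ← hF (κ k) (z - latt (κ k)),
            sub_add_cancel]
        · rw [indicator_of_notMem hz, indicator_of_notMem (by exact hz)]
    _ = _ := by simp

theorem rpow_lintegral_mul_le {α : Type*} [MeasurableSpace α] {μ : Measure α} {κ F : α → ℝ≥0∞}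
    (hκ : AEMeasurable κ μ) (hF : AEMeasurable F μ) {q : ℝ} (hq : 1 ≤ q) :
    (∫⁻ x, κ x * F x ∂μ) ^ q ≤ (∫⁻ x, κ x ∂μ) ^ (q - 1) * ∫⁻ x, κ x * F x ^ q ∂μ := by
  have hq0 : 0 < q := by linarith
  have h := ENNReal.lintegral_mul_norm_pow_le (μ := μ) hκ (hκ.mul (hF.pow_const q))
    (p := 1 - 1 / q) (q := 1 / q) (by rw [sub_nonneg, div_le_one hq0]; exact hq) (by positivity)
    (by ring)
  have e : ∀ x, κ x ^ (1 - 1 / q) * (κ * fun x => F x ^ q) x ^ (1 / q) = κ x * F x := by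
    intro x
    rw [Pi.mul_apply, ENNReal.mul_rpow_of_nonneg _ _ (by positivity), ← mul_assoc,
      ← ENNReal.rpow_add_of_nonneg _ _ (by rw [sub_nonneg, div_le_one hq0]; exact hq)
        (by positivity), ← ENNReal.rpow_mul]
    rw [show 1 - 1 / q + 1 / q = 1 by ring, show q * (1 / q) = 1 by field_simp]
    simp
  simp only [e] at h
  calc _ ≤ _ := ENNReal.rpow_le_rpow h hq0.le
    _ = _ := by
      rw [ENNReal.mul_rpow_of_nonneg _ _ hq0.le, ← ENNReal.rpow_mul, ← ENNReal.rpow_mul,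
        show (1 - 1 / q) * q = q - 1 by field_simp, show 1 / q * q = 1 by field_simp,
        ENNReal.rpow_one]
      rfl

/-- Young's inequality for convolutions of an integrable kernel with a periodic function. -/
theorem lintegral_strip_young {N : ℕ} {κ F : RN N × ℝ → ℝ≥0∞} (hκ : Measurable κ)
    (hm : Measurable F) (hF : ∀ (k : Fin N → ℤ) z, F (z + latt k) = F z) {q : ℝ} (hq : 1 ≤ q) :
    ∫⁻ z in strip N, (∫⁻ w, κ w * F (z - w)) ^ q
      ≤ (∫⁻ w, κ w) ^ q * ∫⁻ z in strip N, F z ^ q := by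
  calc _ ≤ ∫⁻ z in strip N, (∫⁻ w, κ w) ^ (q - 1) * ∫⁻ w, κ w * F (z - w) ^ q :=
        lintegral_mono fun z => rpow_lintegral_mul_le hκ.aemeasurable
          (hm.comp (measurable_const.sub measurable_id)).aemeasurable hq
    _ = (∫⁻ w, κ w) ^ (q - 1) * ∫⁻ w, κ w * ∫⁻ z in strip N, F (z - w) ^ q := by
        rw [lintegral_const_mul, lintegral_lintegral_swap]
        · congr 1
          refine lintegral_congr fun w => ?_
          rw [lintegral_const_mul]
          exact (hm.comp (measurable_id.sub_const w)).pow_const q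
        · refine Measurable.aemeasurable ?_
          unfold Function.uncurry
          fun_prop
        · have : Measurable fun p : (RN N × ℝ) × (RN N × ℝ) => κ p.2 * F (p.1 - p.2) ^ q := by
            fun_prop
          exact this.lintegral_prod_right
    _ = (∫⁻ w, κ w) ^ (q - 1) * ((∫⁻ w, κ w) * ∫⁻ z in strip N, F z ^ q) := by
        rw [← lintegral_mul_const _ hκ]
        congr 1
        refine lintegral_congr fun w => ?_
        rw [setLIntegral_strip_sub (fun z => F z ^ q) (hm.pow_const q) (fun k z => by rw [hF])]
    _ = _ := by
        rw [← mul_assoc]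
        congr 1
        nth_rewrite 2 [← ENNReal.rpow_one (∫⁻ w, κ w)]
        rw [← ENNReal.rpow_add_of_nonneg _ _ (by linarith) zero_le_one]
        congr 1
        ring

end

theorem exists_lintegral_heatCZ_far_le (N : ℕ) : ∃ B : ℝ≥0, ∀ (ε : ℝ), 0 < ε → ∀ i j : Fin N,
    ∫⁻ z, {z : RN N × ℝ | 1 ≤ ‖z.1‖}.indicator (fun z => ‖heatCZ ε i j z‖ₑ) z ≤ B := by
  obtain ⟨C, hC, h⟩ := exists_heatH_bounds N
  refine ⟨C.toNNReal, fun ε hε i j => ?_⟩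
  calc _ ≤ ∫⁻ z : RN N × ℝ, ENNReal.ofReal (∑ k, z.1 k ^ 2) * ‖damp (heatH i j) ε z‖ₑ := by
        refine lintegral_mono fun z => ?_
        by_cases hz : 1 ≤ ‖z.1‖
        · rw [indicator_of_mem (by exact hz)]
          have h1 : 1 ≤ ∑ k, z.1 k ^ 2 := (one_le_pow₀ hz).trans (sq_norm_le_sum z.1)
          calc _ = 1 * ‖heatCZ ε i j z‖ₑ := (one_mul _).symm
            _ ≤ _ := by
              refine mul_le_mul ?_ le_rfl zero_le zero_le
              rw [← ENNReal.ofReal_one]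
              exact ENNReal.ofReal_le_ofReal h1
        · rw [indicator_of_notMem (by exact hz)]
          exact zero_le
    _ = _ := lintegral_mul_damp (measurable_heatH i j) ε
        (fun z : RN N × ℝ => ENNReal.ofReal (∑ k, z.1 k ^ 2)) (by fun_prop)
    _ ≤ ∫⁻ s in Iio (0 : ℝ), ENNReal.ofReal (Real.exp s) * C.toNNReal := by
        refine setLIntegral_mono (by fun_prop) fun s hs => ?_
        have hs' : s < 0 := hs
        refine mul_le_mul ?_ ?_ zero_le zero_le
        · exact ENNReal.ofReal_le_ofReal (Real.exp_le_exp.2 (by linarith))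
        · refine le_trans (le_of_eq (lintegral_congr fun y => ?_)) (h i j (ε - s) (by linarith)).2
          rw [enorm_mul, Real.enorm_of_nonneg (Finset.sum_nonneg fun k _ => sq_nonneg (y k))]
    _ = _ := by
        rw [lintegral_mul_const' _ _ ENNReal.coe_ne_top, lintegral_Iio_exp, one_mul]

theorem enorm_cv_le {N : ℕ} {f : RN N × ℝ → ℝ} (K : RN N × ℝ → ℝ)
    (z : RN N × ℝ) : ‖cv K f z‖ₑ ≤ ∫⁻ w, ‖K w‖ₑ * ‖f (z - w)‖ₑ := by
  refine (enorm_integral_le_lintegral_enorm _).trans (le_of_eq ?_)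
  simp only [smul_eq_mul, enorm_mul]

theorem PerTest.lintegral_strip_cv_le {N : ℕ} {a b : ℝ} {f : RN N × ℝ → ℝ} (hf : PerTest a b f)
    {K : RN N × ℝ → ℝ} (hK : Measurable K) {q : ℝ} (hq : 1 ≤ q) :
    ∫⁻ z in strip N, ‖cv K f z‖ₑ ^ q
      ≤ (∫⁻ w, ‖K w‖ₑ) ^ q * ∫⁻ z in strip N, ‖f z‖ₑ ^ q := by
  refine le_trans (lintegral_mono fun z => ?_) (lintegral_strip_young (κ := fun w => ‖K w‖ₑ)
    (F := fun z => ‖f z‖ₑ) hK.enorm hf.continuous.measurable.enorm (fun k z => by rw [hf.per]) hq)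
  exact ENNReal.rpow_le_rpow (enorm_cv_le K z) (by linarith)

/-- Calderón–Zygmund estimate for space-periodic functions. -/
theorem exists_strip_heatCZ_le (N : ℕ) {q : ℝ} (hq : 1 < q) : ∃ D : ℝ≥0, ∀ (ε : ℝ), 0 < ε →
    ∀ i j : Fin N, ∀ (a b : ℝ) (f : RN N × ℝ → ℝ), PerTest a b f →
    ∫⁻ z in strip N, ‖cv (heatCZ ε i j) f z‖ₑ ^ q ≤ D * ∫⁻ z in strip N, ‖f z‖ₑ ^ q := by
  obtain ⟨B, hB⟩ := exists_CZKernel_heatCZ N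
  obtain ⟨C, hC⟩ := CZKernel.exists_strong N B hq
  obtain ⟨B', hB'⟩ := exists_lintegral_heatCZ_far_le N
  have hq0 : 0 ≤ q := by linarith
  refine ⟨2 ^ (q - 1) * (C ^ q * 6 ^ N + B' ^ q), fun ε hε i j a b f hf => ?_⟩
  set K := heatCZ ε i j with hKdef
  have hK := hB ε hε i j
  obtain ⟨M, hM⟩ := hf.norm_bdd
  set χ : RN N × ℝ → ℝ := fun z => max 0 (min 1 (3 - ‖z.1‖)) with hχ
  have hχc : Continuous χ := by fun_prop
  have hχ0 : ∀ z, 0 ≤ χ z := fun z => le_max_left _ _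
  have hχ1 : ∀ z, χ z ≤ 1 := fun z => max_le zero_le_one (min_le_left _ _)
  set f₁ : RN N × ℝ → ℝ := fun z => χ z * f z with hf₁
  set f₂ : RN N × ℝ → ℝ := fun z => (1 - χ z) * f z with hf₂
  have hf₁c : Continuous f₁ := hχc.mul hf.continuous
  have hf₂c : Continuous f₂ := (continuous_const.sub hχc).mul hf.continuous
  have hb₁ : ∀ z, ‖f₁ z‖ ≤ M := fun z => by
    rw [hf₁, norm_mul, Real.norm_of_nonneg (hχ0 z)]
    exact (mul_le_of_le_one_left (norm_nonneg _) (hχ1 z)).trans (hM z)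
  have hb₂ : ∀ z, ‖f₂ z‖ ≤ ‖f z‖ := fun z => by
    rw [hf₂, norm_mul, Real.norm_of_nonneg (sub_nonneg.2 (hχ1 z))]
    exact mul_le_of_le_one_left (norm_nonneg _) (by linarith [hχ0 z])
  have h_int : ∀ g : RN N × ℝ → ℝ, Continuous g → (∀ z, ‖g z‖ ≤ M) → ∀ z,
      Integrable fun w => K w * g (z - w) := fun g hg hgM z =>
    hK.int.mul_bdd (c := M) (hg.comp (continuous_const.sub continuous_id)).aestronglyMeasurable
      (ae_of_all _ fun w => hgM _)
  have hsplit : ∀ z, cv K f z = conv K f₁ z + cv K f₂ z := by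
    intro z
    rw [← cv_eq_conv]
    unfold cv
    simp only [smul_eq_mul]
    rw [← integral_add (h_int f₁ hf₁c hb₁ z) (h_int f₂ hf₂c (fun z => (hb₂ z).trans (hM z)) z)]
    congr 1 with w
    simp only [hf₁, hf₂]
    ring
  have hcs : HasCompactSupport f₁ := by
    refine HasCompactSupport.of_support_subset_isCompact
      (K := Metric.closedBall (0 : RN N) 3 ×ˢ Icc a b)
      ((isCompact_closedBall _ _).prod isCompact_Icc) ?_
    intro z hz
    by_contra hn
    apply hz
    simp only [hf₁]
    by_cases h3 : ‖z.1‖ ≤ 3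
    · rw [hf.supp z fun ht => hn ⟨by simpa using h3, ht⟩, mul_zero]
    · have : χ z = 0 := max_eq_left ((min_le_right _ _).trans (by linarith))
      rw [this, zero_mul]
  have hnear : ∫⁻ z, ‖conv K f₁ z‖ₑ ^ q ≤ C ^ q * (6 ^ N * ∫⁻ z in strip N, ‖f z‖ₑ ^ q) := by
    refine (hC K hK f₁ hf₁c hcs).trans (mul_le_mul le_rfl ?_ zero_le zero_le)
    refine le_trans ?_ (setLIntegral_norm_le_three (fun z => ‖f z‖ₑ ^ q)
      (fun k z => by rw [hf.per]))
    have h3 : MeasurableSet {z : RN N × ℝ | ‖z.1‖ ≤ 3} :=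
      (isClosed_le (by fun_prop) continuous_const).measurableSet
    rw [← lintegral_indicator h3]
    refine lintegral_mono fun z => ?_
    by_cases hz : ‖z.1‖ ≤ 3
    · rw [indicator_of_mem (by exact hz)]
      refine ENNReal.rpow_le_rpow ?_ hq0
      rw [hf₁, enorm_mul, Real.enorm_of_nonneg (hχ0 z)]
      exact mul_le_of_le_one_left zero_le (ENNReal.ofReal_le_one.2 (hχ1 z))
    · have : f₁ z = 0 := by
        simp only [hf₁]
        rw [show χ z = 0 from max_eq_left ((min_le_right _ _).trans (by linarith)), zero_mul]
      rw [this, enorm_zero, ENNReal.zero_rpow_of_pos (by linarith)]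
      exact zero_le
  set κ : RN N × ℝ → ℝ≥0∞ := {z : RN N × ℝ | 1 ≤ ‖z.1‖}.indicator (fun z => ‖K z‖ₑ) with hκ
  have hκm : Measurable κ := hK.meas.enorm.indicator
    (isClosed_le continuous_const (by fun_prop)).measurableSet
  have hfar : ∫⁻ z in strip N, ‖cv K f₂ z‖ₑ ^ q ≤ B' ^ q * ∫⁻ z in strip N, ‖f z‖ₑ ^ q := by
    calc _ ≤ ∫⁻ z in strip N, (∫⁻ w, κ w * ‖f (z - w)‖ₑ) ^ q := by
          refine setLIntegral_mono' (measurableSet_strip N) fun z hz => ?_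
          refine ENNReal.rpow_le_rpow ?_ hq0
          refine (enorm_cv_le K z).trans (lintegral_mono fun w => ?_)
          by_cases hw : 1 ≤ ‖w.1‖
          · rw [hκ, indicator_of_mem (by exact hw)]
            refine mul_le_mul le_rfl ?_ zero_le zero_le
            exact enorm_le_iff_norm_le.2 (hb₂ _)
          · have hz1 : ‖z.1‖ ≤ 1 := by
              rw [pi_norm_le_iff_of_nonneg zero_le_one]
              intro i
              rw [Real.norm_of_nonneg (hz.1.1 i)]
              exact hz.1.2 i
            have h2 : ‖(z - w).1‖ ≤ 2 := (norm_sub_le _ _).trans (by linarith)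
            have : χ (z - w) = 1 := by
              simp only [hχ]
              rw [min_eq_left (by linarith), max_eq_right zero_le_one]
            simp [hf₂, this]
      _ ≤ (∫⁻ w, κ w) ^ q * ∫⁻ z in strip N, ‖f z‖ₑ ^ q :=
          lintegral_strip_young hκm hf.continuous.measurable.enorm
            (fun k z => by rw [hf.per]) hq.le
      _ ≤ _ := mul_le_mul (ENNReal.rpow_le_rpow (hB' ε hε i j) hq0) le_rfl zero_le zero_le
  have hmeas : Measurable (conv K f₁) := measurable_conv hK.meas hf₁c.measurable
  calc _ ≤ ∫⁻ z in strip N, 2 ^ (q - 1) * (‖conv K f₁ z‖ₑ ^ q + ‖cv K f₂ z‖ₑ ^ q) := by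
        refine lintegral_mono fun z => ?_
        rw [hsplit]
        exact (ENNReal.rpow_le_rpow (enorm_add_le _ _) hq0).trans
          (ENNReal.rpow_add_le_mul_rpow_add_rpow _ _ hq.le)
    _ = 2 ^ (q - 1) * ((∫⁻ z in strip N, ‖conv K f₁ z‖ₑ ^ q)
          + ∫⁻ z in strip N, ‖cv K f₂ z‖ₑ ^ q) := by
        rw [lintegral_const_mul' _ _ (by finiteness), lintegral_add_left (hmeas.enorm.pow_const q)]
    _ ≤ 2 ^ (q - 1) * (C ^ q * (6 ^ N * ∫⁻ z in strip N, ‖f z‖ₑ ^ q)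
          + B' ^ q * ∫⁻ z in strip N, ‖f z‖ₑ ^ q) := by
        refine mul_le_mul le_rfl (add_le_add ?_ hfar) zero_le zero_le
        exact (setLIntegral_le_lintegral _ _).trans hnear
    _ = _ := by
        have h2 : ((2 : ℝ≥0) : ℝ≥0∞) = 2 := rfl
        have h6 : ((6 : ℝ≥0) : ℝ≥0∞) = 6 := rfl
        rw [ENNReal.coe_mul, ENNReal.coe_add, ENNReal.coe_mul, ENNReal.coe_pow,
          ENNReal.coe_rpow_of_ne_zero two_ne_zero, ENNReal.coe_rpow_of_nonneg _ hq0,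
          ENNReal.coe_rpow_of_nonneg _ hq0, h2, h6]
        ring

theorem euclNorm_le_sum {N : ℕ} (v : RN N) : euclNorm v ≤ ∑ i, |v i| := by
  refine Real.sqrt_le_iff.2 ⟨Finset.sum_nonneg fun i _ => abs_nonneg _, ?_⟩
  have := Finset.sum_sq_le_sq_sum_of_nonneg (s := Finset.univ) (f := fun i => |v i|)
    fun i _ => abs_nonneg _
  simpa using this

theorem abs_le_euclNorm {N : ℕ} (v : RN N) (i : Fin N) : |v i| ≤ euclNorm v := by
  rw [← Real.sqrt_sq_eq_abs]
  exact Real.sqrt_le_sqrt (Finset.single_le_sum (f := fun i => v i ^ 2)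
    (fun i _ => sq_nonneg _) (Finset.mem_univ i))

theorem euclNorm_nonneg {N : ℕ} (v : RN N) : 0 ≤ euclNorm v := Real.sqrt_nonneg _

theorem lintegral_euclNorm_rpow_le {N : ℕ} {α : Type*} [MeasurableSpace α] {μ : Measure α} {q : ℝ}
    (hq : 1 ≤ q) (v : α → RN N) (hv : ∀ i, AEMeasurable (fun z => v z i) μ) :
    ∫⁻ z, ‖euclNorm (v z)‖ₑ ^ q ∂μ
      ≤ (N : ℝ≥0∞) ^ (q - 1) * ∑ i, ∫⁻ z, ‖v z i‖ₑ ^ q ∂μ := by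
  rw [← lintegral_finsetSum' _ fun i _ => (hv i).enorm.pow_const q,
    ← lintegral_const_mul' _ _ (ENNReal.rpow_ne_top_of_nonneg (by linarith)
      (ENNReal.natCast_ne_top N))]
  refine lintegral_mono fun z => ?_
  have h : ‖euclNorm (v z)‖ₑ ≤ ∑ i, ‖v z i‖ₑ := by
    rw [Real.enorm_of_nonneg (euclNorm_nonneg _)]
    refine (ENNReal.ofReal_le_ofReal (euclNorm_le_sum _)).trans ?_
    rw [ENNReal.ofReal_sum_of_nonneg fun i _ => abs_nonneg _]
    simp only [Real.enorm_eq_ofReal_abs, le_refl]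
  refine (ENNReal.rpow_le_rpow h (by linarith)).trans ?_
  have := ENNReal.rpow_sum_le_const_mul_sum_rpow (s := Finset.univ) (fun i => ‖v z i‖ₑ) hq
  simpa using this

theorem setLIntegral_QQ_le_strip {N : ℕ} (T : ℝ) (F : RN N × ℝ → ℝ≥0∞) :
    ∫⁻ z in QQ N T, F z ≤ ∫⁻ z in strip N, F z :=
  lintegral_mono_set (prod_mono le_rfl (subset_univ _))

theorem measurableSet_QQ (N : ℕ) (T : ℝ) : MeasurableSet (QQ N T) :=
  (measurableSet_cube N).prod measurableSet_Ioo

theorem lintegral_exp_neg_mul_le {N : ℕ} (T : ℝ) {q : ℝ} (hq : 0 ≤ q) (F : RN N × ℝ → ℝ) :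
    ∫⁻ z in QQ N T, ‖Real.exp (-z.2) * F z‖ₑ ^ q ≤ ∫⁻ z in strip N, ‖F z‖ₑ ^ q := by
  refine le_trans (setLIntegral_mono' (measurableSet_QQ N T) fun z hz => ?_)
    (setLIntegral_QQ_le_strip T _)
  refine ENNReal.rpow_le_rpow ?_ hq
  rw [enorm_mul, Real.enorm_of_nonneg (Real.exp_nonneg _)]
  exact mul_le_of_le_one_left zero_le
    (ENNReal.ofReal_le_one.2 (Real.exp_le_one_iff.2 (by linarith [hz.2.1])))

theorem exists_lintegral_grad_potTest_le (N : ℕ) {q : ℝ} (hq : 1 < q) : ∃ D : ℝ≥0,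
    ∀ (ε : ℝ), 0 < ε → ∀ (a b : ℝ) (f : RN N × ℝ → ℝ), PerTest a b f → ∀ T : ℝ,
    ∫⁻ z in QQ N T, ‖euclNorm (grad (fun y => potTest ε f y z.2) z.1)‖ₑ ^ q
      ≤ D * ∫⁻ z in strip N, ‖f z‖ₑ ^ q ∧
    ∀ j : Fin N, ∫⁻ z in QQ N T, ‖euclNorm (grad (fun y =>
        potTest ε (fun z => fderiv ℝ f z (dirX j)) y z.2) z.1)‖ₑ ^ q
      ≤ D * ∫⁻ z in strip N, ‖f z‖ₑ ^ q := by
  obtain ⟨D, hD⟩ := exists_strip_heatCZ_le N hq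
  obtain ⟨B, hB⟩ := exists_lintegral_damp_heatG_le N
  have hq0 : 0 ≤ q := by linarith
  have key : ∀ (D' : ℝ≥0∞), D' ≤ (D + B ^ q : ℝ≥0) →
      ∀ (T : ℝ) (φ : RN N → ℝ → ℝ) (F : Fin N → RN N × ℝ → ℝ) (S : ℝ≥0∞),
      (∀ i z, grad (fun y => φ y z.2) z.1 i = Real.exp (-z.2) * F i z) →
      (∀ i, Continuous (F i)) → (∀ i, ∫⁻ z in strip N, ‖F i z‖ₑ ^ q ≤ D' * S) →
      ∫⁻ z in QQ N T, ‖euclNorm (grad (fun y => φ y z.2) z.1)‖ₑ ^ q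
        ≤ ((N : ℝ≥0) ^ (q - 1) * N * (D + B ^ q) : ℝ≥0) * S := by
    intro D' hD' T φ F S hg hF hS
    have hm : ∀ i, Measurable fun z : RN N × ℝ => grad (fun y => φ y z.2) z.1 i := fun i => by
      simp only [hg]
      have := (hF i).measurable
      fun_prop
    refine (lintegral_euclNorm_rpow_le hq.le _ fun i => (hm i).aemeasurable).trans ?_
    rw [ENNReal.coe_mul, ENNReal.coe_mul, ENNReal.coe_rpow_of_nonneg _ (by linarith),
      ENNReal.coe_natCast, mul_assoc, mul_assoc]
    refine mul_le_mul le_rfl ?_ zero_le zero_le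
    calc _ ≤ ∑ i : Fin N, ((D + B ^ q : ℝ≥0) : ℝ≥0∞) * S := by
          refine Finset.sum_le_sum fun i _ => ?_
          simp only [hg]
          exact (lintegral_exp_neg_mul_le T hq0 (F i)).trans
            ((hS i).trans (mul_le_mul hD' le_rfl zero_le zero_le))
      _ = _ := by simp
  refine ⟨(N : ℝ≥0) ^ (q - 1) * N * (D + B ^ q), fun ε hε a b f hf T => ⟨?_, fun j => ?_⟩⟩
  · refine key (B ^ q) ?_ T (potTest ε f) (fun i => cv (damp (heatG i) ε) f) _
      (fun i z => hf.pd_potTest hε i z.1 z.2)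
      (fun i => (hf.contDiff_cv (integrable_damp_heatG hε i)).continuous) fun i => ?_
    · rw [ENNReal.coe_add, ENNReal.coe_rpow_of_nonneg _ hq0]
      exact le_add_self
    · refine (hf.lintegral_strip_cv_le (measurable_damp (measurable_heatG i) ε) hq.le).trans ?_
      exact mul_le_mul (ENNReal.rpow_le_rpow (hB ε hε i) hq0) le_rfl zero_le zero_le
  · refine key D ?_ T (potTest ε fun z => fderiv ℝ f z (dirX j)) (fun i => cv (heatCZ ε j i) f) _
      (fun i z => ?_) (fun i => (hf.contDiff_cv (integrable_heatCZ hε j i)).continuous)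
      fun i => hD ε hε j i a b f hf
    · rw [ENNReal.coe_add]
      exact le_self_add
    · rw [grad, (hf.dir_deriv (dirX j)).pd_potTest hε i z.1 z.2, hf.cv_heatG_dirX hε j i]

theorem PerTest.lintegral_cube_cv_heatK_le {N : ℕ} {a b : ℝ} {f : RN N × ℝ → ℝ}
    (hf : PerTest a b f) {ε : ℝ} (hε : 0 < ε) :
    ∫⁻ x in cube N, ‖cv (damp heatK ε) f (x, 0)‖ₑ ≤ ∫⁻ z in strip N, ‖f z‖ₑ := by
  have hfm := hf.continuous.measurable
  have hKm := measurable_damp (N := N) measurable_heatK ε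
  set P : ℝ → ℝ≥0∞ := fun t => ∫⁻ x in cube N, ‖f (x, t)‖ₑ with hP
  have hPm : Measurable P := by
    have : Measurable fun z : ℝ × RN N => ‖f (z.2, z.1)‖ₑ := by fun_prop
    exact this.lintegral_prod_right'
  calc _ ≤ ∫⁻ x in cube N, ∫⁻ w, ‖damp heatK ε w‖ₑ * ‖f ((x, 0) - w)‖ₑ :=
        lintegral_mono fun x => enorm_cv_le _ _
    _ = ∫⁻ w, ∫⁻ x in cube N, ‖damp heatK ε w‖ₑ * ‖f ((x, 0) - w)‖ₑ := by
        refine lintegral_lintegral_swap ?_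
        refine Measurable.aemeasurable ?_
        fun_prop
    _ = ∫⁻ w : RN N × ℝ, P (-w.2) * ‖damp heatK ε w‖ₑ := by
        refine lintegral_congr fun w => ?_
        rw [lintegral_const_mul' _ _ (by finiteness), mul_comm]
        congr 1
        have := setLIntegral_cube_sub (fun x => ‖f (x, -w.2)‖ₑ) (fun k x => by
          rw [← hf.per k (x, -w.2)]
          simp [latt]) w.1
        have e : ∀ x : RN N, (x, (0 : ℝ)) - w = (x - w.1, -w.2) := fun x => by
          ext <;> simp
        simpa only [hP, e] using this
    _ = ∫⁻ s in Iio (0 : ℝ), ENNReal.ofReal (Real.exp (-(ε - s)))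
          * ∫⁻ y : RN N, P (-s) * ‖heatK (ε - s) y‖ₑ :=
        lintegral_mul_damp measurable_heatK ε (fun w => P (-w.2)) (by fun_prop)
    _ ≤ ∫⁻ s in Iio (0 : ℝ), P (-s) := by
        refine setLIntegral_mono (by fun_prop) fun s hs => ?_
        have hs' : s < 0 := hs
        have h1 : ∫⁻ y : RN N, ‖heatK (ε - s) y‖ₑ = 1 := by
          rw [← lintegral_heatK (N := N) (show 0 < ε - s by linarith)]
          exact lintegral_congr fun y => Real.enorm_of_nonneg (heatK_nonneg (by linarith) y)
        have hkm : Measurable fun y : RN N => ‖heatK (ε - s) y‖ₑ :=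
          (measurable_heatK.comp (measurable_const.prodMk measurable_id)).enorm
        rw [lintegral_const_mul _ hkm, h1, mul_one]
        exact mul_le_of_le_one_left zero_le
          (ENNReal.ofReal_le_one.2 (Real.exp_le_one_iff.2 (by linarith)))
    _ ≤ ∫⁻ s, P (-s) := setLIntegral_le_lintegral _ _
    _ = ∫⁻ s, P s := lintegral_neg_eq_self P
    _ = _ := (setLIntegral_strip_eq (fun z => ‖f z‖ₑ) hfm.enorm).symm

theorem ZPeriodic.exists_bound {N : ℕ} {u : RN N → ℝ} (hu : ZPeriodic u) (hc : Continuous u) :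
    ∃ M, ∀ x, |u x| ≤ M := by
  obtain ⟨M, hM⟩ := (isCompact_Icc (a := (0 : RN N)) (b := 1)).exists_bound_of_continuousOn
    hc.continuousOn
  refine ⟨M, fun x => ?_⟩
  have h := hu (fun i => Int.fract (x i)) fun i => ⌊x i⌋
  simp only [Int.fract_add_floor] at h
  rw [h]
  exact hM _ ⟨fun i => Int.fract_nonneg _, fun i => (Int.fract_lt_one _).le⟩

theorem volume_cube (N : ℕ) : volume (cube N) = 1 := by
  rw [cube, Real.volume_Icc_pi]
  simp

instance isProbabilityMeasure_cube (N : ℕ) :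
    IsProbabilityMeasure (volume.restrict (cube N)) :=
  ⟨by rw [Measure.restrict_apply_univ, volume_cube]⟩

theorem Continuous.integrableOn_cube {N : ℕ} {u : RN N → ℝ} (hc : Continuous u) :
    IntegrableOn u (cube N) :=
  hc.continuousOn.integrableOn_compact isCompact_Icc

theorem setIntegral_cube_add {N : ℕ} {u : RN N → ℝ} (hu : ZPeriodic u) (hc : Continuous u)
    (y : RN N) : ∫ x in cube N, u (x + y) = ∫ x in cube N, u x := by
  have h : ∀ v : RN N → ℝ, ZPeriodic v → ∫⁻ x in cube N, ENNReal.ofReal (v (x + y))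
      = ∫⁻ x in cube N, ENNReal.ofReal (v x) := fun v hv => by
    simpa using setLIntegral_cube_sub (fun x => ENNReal.ofReal (v x))
      (fun k x => by rw [← hv x k]; rfl) (-y)
  rw [integral_eq_lintegral_pos_part_sub_lintegral_neg_part
    (Continuous.integrableOn_cube (by fun_prop)),
    integral_eq_lintegral_pos_part_sub_lintegral_neg_part hc.integrableOn_cube, h u hu,
    h (fun x => -u x) fun x k => congrArg _ (hu x k)]

theorem setIntegral_cube_pd_eq_zero {N : ℕ} {u : RN N → ℝ} (hu : ZPeriodic u)
    (hd : Differentiable ℝ u) (j : Fin N) {C : ℝ} (hC : ∀ x, |pd j u x| ≤ C) :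
    ∫ x in cube N, pd j u x = 0 := by
  set e : RN N := Pi.single j 1 with he
  have hl : ∀ x s, HasDerivAt (fun s : ℝ => u (x + s • e)) (pd j u (x + s • e)) s := fun x s => by
    have h1 : HasDerivAt (fun s : ℝ => x + s • e) e s := by
      simpa using ((hasDerivAt_id s).smul_const e).const_add x
    exact (hd (x + s • e)).hasFDerivAt.comp_hasDerivAt s h1
  set h : ℕ → ℝ := fun n => 1 / ((n : ℝ) + 1) with hh
  have hpos : ∀ n, 0 < h n := fun n => by positivity
  have hlim : Tendsto (fun n => ∫ x in cube N, (h n)⁻¹ * (u (x + h n • e) - u x)) atTop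
      (𝓝 (∫ x in cube N, pd j u x)) := by
    refine tendsto_integral_of_dominated_convergence (fun _ => C) (fun n => ?_)
      (integrable_const C) (fun n => ae_of_all _ fun x => ?_) (ae_of_all _ fun x => ?_)
    · have := hd.continuous
      exact Continuous.aestronglyMeasurable (by fun_prop)
    · have := (convex_univ (𝕜 := ℝ) (E := ℝ)).norm_image_sub_le_of_norm_hasDerivWithin_le
        (fun s _ => (hl x s).hasDerivWithinAt) (fun s _ => hC (x + s • e)) (mem_univ 0)
        (mem_univ (h n))
      simp only [zero_smul, add_zero, sub_zero] at this
      rw [norm_mul, norm_inv, inv_mul_le_iff₀ (norm_pos_iff.2 (hpos n).ne'), mul_comm]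
      exact this
    · have h0 := hl x 0
      rw [zero_smul, add_zero] at h0
      have := h0.tendsto_slope_zero
      simp only [zero_add, zero_smul, add_zero, smul_eq_mul] at this
      refine this.comp (tendsto_nhdsWithin_iff.2 ⟨tendsto_one_div_add_atTop_nhds_zero_nat,
        Eventually.of_forall fun n => (hpos n).ne'⟩)
  refine tendsto_nhds_unique hlim ?_
  have : ∀ n, ∫ x in cube N, (h n)⁻¹ * (u (x + h n • e) - u x) = 0 := fun n => by
    have := hd.continuous
    rw [integral_const_mul, integral_sub (Continuous.integrableOn_cube (by fun_prop))
      this.integrableOn_cube, setIntegral_cube_add hu this, sub_self, mul_zero]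
  simp only [this, tendsto_const_nhds]

theorem ZPeriodic.pd {N : ℕ} {u : RN N → ℝ} (hu : ZPeriodic u) (j : Fin N) :
    ZPeriodic (pd j u) := fun x k => by
  unfold _root_.pd
  have := fderiv_comp_add_right (𝕜 := ℝ) (f := u) (x := x) (fun i => (k i : ℝ))
  rw [show (fun x : RN N => u (x + fun i => (k i : ℝ))) = u from funext fun x => hu x k] at this
  rw [this]
  rfl

theorem FPData.abs_setIntegral_mul_pd_le {N : ℕ} {K₀ : ℝ} {m₀ : RN N → ℝ} (h : FPData N K₀ m₀)
    {W : RN N → ℝ} (hW : ContDiff ℝ 1 W) (hper : ZPeriodic W) (j : Fin N) :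
    |∫ x in cube N, m₀ x * pd j W x| ≤ K₀ * ∫ x in cube N, |W x| := by
  obtain ⟨h1, -, -, hd, hb⟩ := h
  have hWd : Differentiable ℝ W := hW.differentiable one_ne_zero
  have hWc' : Continuous (pd j W) := by
    have := hW.continuous_fderiv one_ne_zero
    unfold pd
    fun_prop
  obtain ⟨M₁, hM₁⟩ := h1.exists_bound hd.continuous
  obtain ⟨M₂, hM₂⟩ := hper.exists_bound hW.continuous
  obtain ⟨M₃, hM₃⟩ := (hper.pd j).exists_bound hWc'
  have hpm : ∀ x, |pd j m₀ x| ≤ K₀ := fun x => (abs_le_euclNorm (grad m₀ x) j).trans (hb x)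
  have hprod : ∀ x, pd j (fun x => m₀ x * W x) x = m₀ x * pd j W x + W x * pd j m₀ x := fun x => by
    unfold pd
    rw [fderiv_fun_mul (hd x) (hWd x)]
    simp
  have hz := setIntegral_cube_pd_eq_zero (u := fun x => m₀ x * W x)
    (fun x k => congrArg₂ (· * ·) (h1 x k) (hper x k)) (hd.mul hWd) j
        (C := M₁ * M₃ + M₂ * K₀) fun x => by
      rw [hprod]
      refine (abs_add_le _ _).trans ?_
      rw [abs_mul, abs_mul]
      exact add_le_add
        (mul_le_mul (hM₁ x) (hM₃ x) (abs_nonneg _) ((abs_nonneg _).trans (hM₁ x)))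
        (mul_le_mul (hM₂ x) (hpm x) (abs_nonneg _) ((abs_nonneg _).trans (hM₂ x)))
  have hm : Measurable (pd j m₀) := measurable_fderiv_apply_const ℝ m₀ _
  have hi : Integrable (fun x => W x * pd j m₀ x) (volume.restrict (cube N)) :=
    hW.continuous.integrableOn_cube.mul_bdd (c := K₀) hm.aestronglyMeasurable (ae_of_all _ hpm)
  simp only [hprod] at hz
  rw [integral_add (Continuous.integrableOn_cube (by have := hd.continuous; fun_prop)) hi] at hz
  rw [eq_neg_of_add_eq_zero_left hz, abs_neg, ← integral_const_mul]
  refine (abs_integral_le_integral_abs).trans (integral_mono hi.abs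
    (hW.continuous.integrableOn_cube.abs.const_mul _) fun x => ?_)
  simp only [abs_mul]
  rw [mul_comm]
  exact mul_le_mul_of_nonneg_right (hpm x) (abs_nonneg _)

theorem FPData.le_one_add {N : ℕ} {K₀ : ℝ} {m₀ : RN N → ℝ} (h : FPData N K₀ m₀)
    {x : RN N} (hx : x ∈ cube N) : m₀ x ≤ 1 + N * K₀ := by
  obtain ⟨h1, -, h3, hd, hb⟩ := h
  obtain ⟨y, hy, hy1⟩ : ∃ y ∈ cube N, m₀ y ≤ 1 := by
    obtain ⟨y, hy, h⟩ := exists_le_setAverage (μ := volume) (s := cube N) (f := m₀)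
      (by simp [volume_cube]) (by simp [volume_cube]) hd.continuous.integrableOn_cube
    refine ⟨y, hy, h.trans ?_⟩
    rw [setAverage_eq, h3]
    simp [Measure.real, volume_cube]
  have hK : 0 ≤ K₀ := (euclNorm_nonneg _).trans (hb 0)
  have hn : ∀ z, ‖fderiv ℝ m₀ z‖ ≤ N * K₀ := fun z => by
    refine ContinuousLinearMap.opNorm_le_bound _ (by positivity) fun v => ?_
    have hv : fderiv ℝ m₀ z v = ∑ i, v i * pd i m₀ z := by
      conv_lhs => rw [pi_eq_sum_univ' v]
      simp only [map_sum, map_smul, smul_eq_mul, pd]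
    rw [hv]
    refine (norm_sum_le _ _).trans ?_
    calc _ ≤ ∑ i : Fin N, ‖v‖ * K₀ := by
          refine Finset.sum_le_sum fun i _ => ?_
          rw [norm_mul]
          exact mul_le_mul (norm_le_pi_norm v i) ((abs_le_euclNorm (grad m₀ z) i).trans (hb z))
            (norm_nonneg _) (norm_nonneg _)
      _ = _ := by simp; ring
  have := (convex_univ (𝕜 := ℝ) (E := RN N)).norm_image_sub_le_of_norm_fderiv_le
    (fun z _ => hd z) (fun z _ => hn z) (mem_univ y) (mem_univ x)
  have hxy : ‖x - y‖ ≤ 1 := by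
    rw [pi_norm_le_iff_of_nonneg zero_le_one]
    intro i
    have a1 := hx.1 i; have a2 := hx.2 i; have a3 := hy.1 i; have a4 := hy.2 i
    simp only [Pi.zero_apply, Pi.one_apply] at a1 a2 a3 a4
    rw [Pi.sub_apply, Real.norm_eq_abs, abs_le]
    constructor <;> linarith
  have h5 : m₀ x - m₀ y ≤ N * K₀ := (le_abs_self _).trans
    (this.trans (mul_le_of_le_one_right (by positivity) hxy))
  linarith

/-- The contribution of the initial datum. -/
theorem FPData.abs_initial_le {N : ℕ} {K₀ : ℝ} {m₀ : RN N → ℝ} (h : FPData N K₀ m₀)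
    {a b ε : ℝ} {f : RN N × ℝ → ℝ} (hf : PerTest a b f) (hε : 0 < ε) :
    ENNReal.ofReal |∫ x in cube N, m₀ x * potTest ε f x 0|
      ≤ ENNReal.ofReal (1 + N * K₀) * ∫⁻ z in strip N, ‖f z‖ₑ ∧
    ∀ j : Fin N,
      ENNReal.ofReal |∫ x in cube N, m₀ x * potTest ε (fun z => fderiv ℝ f z (dirX j)) x 0|
        ≤ ENNReal.ofReal (1 + N * K₀ + K₀) * ∫⁻ z in strip N, ‖f z‖ₑ := by
  have hK : 0 ≤ K₀ := (euclNorm_nonneg _).trans (h.2.2.2.2 0)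
  have hc := hf.contDiff_cv (integrable_damp_heatK (N := N) hε)
  set W : RN N → ℝ := fun x => cv (damp heatK ε) f (x, 0) with hW
  have hWc : ContDiff ℝ (⊤ : ℕ∞) W := by
    have := hc.comp (f := fun x : RN N => (x, (0 : ℝ))) (by fun_prop)
    exact this
  have hle := hf.lintegral_cube_cv_heatK_le hε
  have hWi : ENNReal.ofReal (∫ x in cube N, |W x|) ≤ ∫⁻ z in strip N, ‖f z‖ₑ := by
    rw [ofReal_integral_eq_lintegral_ofReal hWc.continuous.integrableOn_cube.abs
      (ae_of_all _ fun x => abs_nonneg _)]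
    simpa only [← Real.enorm_eq_ofReal_abs] using hle
  refine ⟨?_, fun j => ?_⟩
  · refine le_trans (ENNReal.ofReal_le_ofReal ?_)
      ((ENNReal.ofReal_mul (p := 1 + N * K₀) (q := ∫ x in cube N, |W x|) (by positivity)).trans_le
        (mul_le_mul le_rfl hWi zero_le zero_le))
    have e : ∀ x, potTest ε f x 0 = W x := fun x => by simp [potTest, hW]
    simp only [e]
    rw [← integral_const_mul]
    have hmc := h.2.2.2.1.continuous
    have hWc' := hWc.continuous
    refine abs_integral_le_integral_abs.trans (setIntegral_mono_on
      (Continuous.integrableOn_cube (by fun_prop)) (Continuous.integrableOn_cube (by fun_prop))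
      (measurableSet_cube N) fun x hx => ?_)
    rw [abs_mul, abs_of_nonneg (h.2.1 x)]
    exact mul_le_mul_of_nonneg_right (h.le_one_add hx) (abs_nonneg _)
  · refine le_trans (ENNReal.ofReal_le_ofReal ?_)
      ((ENNReal.ofReal_mul (p := 1 + N * K₀ + K₀) (q := ∫ x in cube N, |W x|)
        (by positivity)).trans_le (mul_le_mul le_rfl hWi zero_le zero_le))
    have e : ∀ x, potTest ε (fun z => fderiv ℝ f z (dirX j)) x 0 = pd j W x := fun x => by
      rw [hW, pd_section_space (hc.differentiable (by simp)),
        hf.fderiv_cv_apply (integrable_damp_heatK hε)]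
      simp [potTest]
    simp only [e]
    refine (h.abs_setIntegral_mul_pd_le (hWc.of_le (by exact_mod_cast le_top)) (fun x k => ?_)
      j).trans ?_
    · have := hf.cv_per (K := damp heatK ε) k (x, 0)
      rw [show ((x, (0 : ℝ)) + latt k) = ((fun i => x i + (k i : ℝ)), 0) by
        ext <;> simp [latt]] at this
      exact this
    · refine mul_le_mul_of_nonneg_right ?_ (integral_nonneg fun x => abs_nonneg _)
      nlinarith [mul_nonneg (Nat.cast_nonneg (α := ℝ) N) hK]

namespace IsTest

variable {N : ℕ} {φ ψ : RN N → ℝ → ℝ}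

theorem differentiable (h : IsTest N φ) : Differentiable ℝ fun z : RN N × ℝ => φ z.1 z.2 :=
  h.1.differentiable (by simp)

theorem continuous (h : IsTest N φ) : Continuous fun z : RN N × ℝ => φ z.1 z.2 := h.1.continuous

theorem pd_eq (h : IsTest N φ) (i : Fin N) (x : RN N) (t : ℝ) :
    _root_.pd i (fun y => φ y t) x = fderiv ℝ (fun z : RN N × ℝ => φ z.1 z.2) (x, t) (dirX i) :=
  pd_section_space h.differentiable i x t

theorem deriv_eq (h : IsTest N φ) (x : RN N) (t : ℝ) :
    _root_.deriv (φ x) t = fderiv ℝ (fun z : RN N × ℝ => φ z.1 z.2) (x, t) (0, 1) :=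
  (deriv_section_time h.differentiable x t).deriv

theorem dir_periodic (h : IsTest N φ) (v : RN N × ℝ) (t : ℝ) :
    ZPeriodic fun x => fderiv ℝ (fun z : RN N × ℝ => φ z.1 z.2) (x, t) v := fun x k => by
  have hper : (fun z : RN N × ℝ => φ (z + latt k).1 (z + latt k).2)
      = fun z : RN N × ℝ => φ z.1 z.2 := by
    ext z
    have := h.2 z.2 z.1 k
    simp only [latt, Prod.fst_add, Prod.snd_add, add_zero]
    exact this
  have := fderiv_comp_add_right (𝕜 := ℝ) (f := fun z : RN N × ℝ => φ z.1 z.2)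
    (x := (x, t)) (latt k)
  rw [hper] at this
  beta_reduce
  rw [this]
  congr 2
  ext <;> simp [latt]

theorem dir (h : IsTest N φ) (v : RN N × ℝ) :
    IsTest N fun x t => fderiv ℝ (fun z : RN N × ℝ => φ z.1 z.2) (x, t) v :=
  ⟨(h.1.fderiv_right (by simp)).clm_apply contDiff_const, h.dir_periodic v⟩

protected theorem pd (h : IsTest N φ) (i : Fin N) :
    IsTest N fun x t => _root_.pd i (fun y => φ y t) x := by
  simp only [h.pd_eq]
  exact h.dir _

protected theorem deriv (h : IsTest N φ) : IsTest N fun x t => _root_.deriv (φ x) t := by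
  simp only [h.deriv_eq]
  exact h.dir _

theorem add (h : IsTest N φ) (h' : IsTest N ψ) : IsTest N fun x t => φ x t + ψ x t :=
  ⟨h.1.add h'.1, fun t x k => congrArg₂ (· + ·) (h.2 t x k) (h'.2 t x k)⟩

theorem mul (h : IsTest N φ) (h' : IsTest N ψ) : IsTest N fun x t => φ x t * ψ x t :=
  ⟨h.1.mul h'.1, fun t x k => congrArg₂ (· * ·) (h.2 t x k) (h'.2 t x k)⟩

theorem of_time {u : ℝ → ℝ} (hu : ContDiff ℝ (⊤ : ℕ∞) u) : IsTest N fun _ t => u t :=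
  ⟨hu.comp contDiff_snd, fun _ _ _ => rfl⟩

theorem sum {ι : Type*} (s : Finset ι) {φ : ι → RN N → ℝ → ℝ} (h : ∀ i ∈ s, IsTest N (φ i)) :
    IsTest N fun x t => ∑ i ∈ s, φ i x t :=
  ⟨ContDiff.sum fun i hi => (h i hi).1,
    fun t x k => Finset.sum_congr rfl fun i hi => (h i hi).2 t x k⟩

protected theorem lap (h : IsTest N φ) : IsTest N fun x t => lap (fun y => φ y t) x :=
  sum _ fun i _ => (h.pd i).pd i

theorem exists_bound (h : IsTest N φ) (T : ℝ) : ∃ M, ∀ z ∈ QQ N T, |φ z.1 z.2| ≤ M := by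
  obtain ⟨M, hM⟩ := ((isCompact_Icc (a := (0 : RN N)) (b := 1)).prod
    (isCompact_Icc (a := (0 : ℝ)) (b := T))).exists_bound_of_continuousOn
    h.continuous.continuousOn
  exact ⟨M, fun z hz => hM z ⟨hz.1, Ioo_subset_Icc_self hz.2⟩⟩

theorem integrableOn_mul (h : IsTest N φ) {T : ℝ} {f : RN N × ℝ → ℝ}
    (hf : IntegrableOn f (QQ N T)) : IntegrableOn (fun z => f z * φ z.1 z.2) (QQ N T) := by
  obtain ⟨M, hM⟩ := h.exists_bound T
  exact hf.mul_bdd (c := M) h.continuous.aestronglyMeasurable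
    ((ae_restrict_iff' (measurableSet_QQ N T)).2 (ae_of_all _ hM))

end IsTest

theorem abs_dotp_le {N : ℕ} (v w : RN N) : |dotp v w| ≤ euclNorm v * euclNorm w := by
  unfold dotp euclNorm
  rw [← Real.sqrt_mul (Finset.sum_nonneg fun i _ => sq_nonneg _), ← Real.sqrt_sq_eq_abs]
  exact Real.sqrt_le_sqrt (Finset.sum_mul_sq_le_sq_mul_sq _ _ _)

section

variable {N : ℕ} {T γ' p q K₀ : ℝ} {m₀ : RN N → ℝ} {m : RN N → ℝ → ℝ} {A : RN N → ℝ → RN N}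
  {φ : RN N → ℝ → ℝ}

/-- The quantity `E^{1/γ'} ‖m‖_p^{1/γ}`. -/
def fluxNorm (N : ℕ) (T γ' p : ℝ) (m : RN N → ℝ → ℝ) (A : RN N → ℝ → RN N) : ℝ :=
  (intQ N T (fun x t => euclNorm (A x t) ^ γ' * m x t)) ^ (1 / γ')
    * (intQ N T (fun x t => m x t ^ p)) ^ (1 / (p * (γ' / (γ' - 1))))

theorem fluxNorm_nonneg (hm : ∀ x t, 0 ≤ m x t) : 0 ≤ fluxNorm N T γ' p m A :=
  mul_nonneg (Real.rpow_nonneg (integral_nonneg fun _ => mul_nonneg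
      (Real.rpow_nonneg (euclNorm_nonneg _) _) (hm _ _)) _)
    (Real.rpow_nonneg (integral_nonneg fun _ => Real.rpow_nonneg (hm _ _) _) _)

theorem FPSol.integrableOn_flux (hs : FPSol N T γ' m₀ m A) (hd : FPData N K₀ m₀) (hT : 0 < T)
    (hφ : IsTest N φ) (hφT : ∀ x, φ x T = 0) :
    IntegrableOn (fun z : RN N × ℝ => m z.1 z.2
      * dotp (A z.1 z.2) (grad (fun y => φ y z.2) z.1)) (QQ N T) := by
  by_contra hni
  have key : ∀ ψ : RN N → ℝ → ℝ, IsTest N ψ → (∀ x, ψ x T = 0) →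
      (∀ x t, grad (fun y => ψ y t) x = grad (fun y => φ y t) x) →
      ∫ x in cube N, m₀ x * ψ x 0 = 0 := by
    intro ψ hψ hψT hg
    have h := hs.weak ψ hψ hψT
    rwa [intQ, integral_undef, zero_add] at h
    intro hi
    apply hni
    have h1 := (hψ.deriv.add hψ.lap).integrableOn_mul hs.int_m
    refine (hi.sub h1).congr (ae_of_all _ fun z => ?_)
    simp only [Pi.sub_apply, hg]
    ring
  have h1 := key φ hφ hφT fun _ _ => rfl
  have hu : IsTest N fun _ t => 1 - t / T :=
    IsTest.of_time (contDiff_const.sub (contDiff_id.div_const T))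
  have h2 := key _ (hφ.add hu) (fun x => by rw [hφT, div_self hT.ne']; simp) fun x t => by
    ext i
    simp only [grad, pd, fderiv_add_const]
  have hc : Continuous fun x => m₀ x * φ x 0 := by
    have := hd.2.2.2.1.continuous
    have h3 := hφ.continuous.comp (f := fun x : RN N => (x, (0 : ℝ))) (by fun_prop)
    exact this.mul h3
  simp only [mul_add, zero_div, sub_zero, mul_one] at h2
  rw [integral_add hc.integrableOn_cube hd.2.2.2.1.continuous.integrableOn_cube, h1, hd.2.2.1] at h2
  norm_num at h2

theorem FPSol.test_identity (hs : FPSol N T γ' m₀ m A) (hd : FPData N K₀ m₀) (hT : 0 < T)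
    (hφ : IsTest N φ) (hφT : ∀ x, φ x T = 0) :
    intQ N T (fun x t => m x t * (deriv (φ x) t + lap (fun y => φ y t) x))
      + intQ N T (fun x t => m x t * dotp (A x t) (grad (fun y => φ y t) x))
      + (∫ x in cube N, m₀ x * φ x 0) = 0 := by
  refine Eq.trans ?_ (hs.weak φ hφ hφT)
  congr 1
  unfold intQ
  rw [← integral_add ((hφ.deriv.add hφ.lap).integrableOn_mul hs.int_m)
    (hs.integrableOn_flux hd hT hφ hφT)]
  congr 1 with z
  ring

theorem FPSol.flux_le (hs : FPSol N T γ' m₀ m A) (hp : 1 < p) (hγ' : 1 < γ') (hq : 1 < q)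
    (hsum : 1 / γ' + 1 / (p * (γ' / (γ' - 1))) + 1 / q = 1)
    (hmp : IntegrableOn (fun z : RN N × ℝ => m z.1 z.2 ^ p) (QQ N T)) (hφ : IsTest N φ) :
    ENNReal.ofReal |intQ N T (fun x t => m x t * dotp (A x t) (grad (fun y => φ y t) x))|
      ≤ ENNReal.ofReal (fluxNorm N T γ' p m A)
        * (∫⁻ z in QQ N T, ‖euclNorm (grad (fun y => φ y z.2) z.1)‖ₑ ^ q) ^ (1 / q) := by
  have hγ0 : 0 < γ' / (γ' - 1) := div_pos (by linarith) (by linarith)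
  have hpg : 0 < p * (γ' / (γ' - 1)) := mul_pos (by linarith) hγ0
  have hq0 : 0 < q := by linarith
  have hγp : 0 < γ' := by linarith
  set f : Fin 3 → RN N × ℝ → ℝ≥0∞ :=
      ![fun z => ENNReal.ofReal (euclNorm (A z.1 z.2) ^ γ' * m z.1 z.2),
    fun z => ENNReal.ofReal (m z.1 z.2 ^ p), fun z => ‖euclNorm (grad (fun y => φ y z.2) z.1)‖ₑ ^ q]
    with hf
  have hgm : Measurable fun z : RN N × ℝ => euclNorm (grad (fun y => φ y z.2) z.1) := by
    have h : ∀ i, Continuous fun z : RN N × ℝ => grad (fun y => φ y z.2) z.1 i := fun i =>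
      (hφ.pd i).continuous
    unfold euclNorm
    exact (Real.continuous_sqrt.comp (continuous_finsetSum _ fun i _ => (h i).pow 2)).measurable
  have hfm : ∀ i ∈ Finset.univ, AEMeasurable (f i) (volume.restrict (QQ N T)) := by
    intro i _
    fin_cases i
    · exact hs.int_E.1.aemeasurable.ennreal_ofReal
    · exact hmp.1.aemeasurable.ennreal_ofReal
    · exact (hgm.enorm.pow_const q).aemeasurable
  have hH := ENNReal.lintegral_prod_norm_pow_le Finset.univ hfm
    (p := ![1 / γ', 1 / (p * (γ' / (γ' - 1))), 1 / q]) (by simpa [Fin.sum_univ_three] using hsum)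
    (by
      intro i _
      fin_cases i
      · exact (one_div_pos.2 hγp).le
      · exact (one_div_pos.2 hpg).le
      · exact (one_div_pos.2 hq0).le)
  simp only [Fin.prod_univ_three, hf, Matrix.cons_val_zero, Matrix.cons_val_one,
    Matrix.cons_val] at hH
  have e1 : (∫⁻ z in QQ N T, ENNReal.ofReal (euclNorm (A z.1 z.2) ^ γ' * m z.1 z.2)) ^ (1 / γ')
      * (∫⁻ z in QQ N T, ENNReal.ofReal (m z.1 z.2 ^ p)) ^ (1 / (p * (γ' / (γ' - 1))))
      = ENNReal.ofReal (fluxNorm N T γ' p m A) := by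
    have n1 : ∀ z : RN N × ℝ, 0 ≤ euclNorm (A z.1 z.2) ^ γ' * m z.1 z.2 := fun z =>
      mul_nonneg (Real.rpow_nonneg (euclNorm_nonneg _) _) (hs.nonneg _ _)
    have n2 : ∀ z : RN N × ℝ, 0 ≤ m z.1 z.2 ^ p := fun z => Real.rpow_nonneg (hs.nonneg _ _) _
    rw [← ofReal_integral_eq_lintegral_ofReal hs.int_E (ae_of_all _ n1),
      ← ofReal_integral_eq_lintegral_ofReal hmp (ae_of_all _ n2),
      ENNReal.ofReal_rpow_of_nonneg (integral_nonneg n1) (one_div_pos.2 hγp).le,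
      ENNReal.ofReal_rpow_of_nonneg (integral_nonneg n2) (one_div_pos.2 hpg).le,
      ← ENNReal.ofReal_mul (Real.rpow_nonneg (integral_nonneg n1) _)]
    rfl
  rw [e1] at hH
  refine le_trans ?_ hH
  rw [← Real.enorm_eq_ofReal_abs]
  refine (enorm_integral_le_lintegral_enorm _).trans (lintegral_mono fun z => ?_)
  have hm0 := hs.nonneg z.1 z.2
  have ha0 := euclNorm_nonneg (A z.1 z.2)
  have hv0 := euclNorm_nonneg (grad (fun y => φ y z.2) z.1)
  rw [← ENNReal.rpow_mul, mul_one_div_cancel hq0.ne', ENNReal.rpow_one,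
    ENNReal.ofReal_rpow_of_nonneg (mul_nonneg (Real.rpow_nonneg ha0 _) hm0) (one_div_pos.2 hγp).le,
    ENNReal.ofReal_rpow_of_nonneg (Real.rpow_nonneg hm0 _) (one_div_pos.2 hpg).le,
    Real.enorm_of_nonneg hv0, ← ENNReal.ofReal_mul (by positivity),
    ← ENNReal.ofReal_mul (by positivity), Real.enorm_eq_ofReal_abs]
  refine ENNReal.ofReal_le_ofReal ?_
  rw [abs_mul, abs_of_nonneg hm0]
  have e2 : (euclNorm (A z.1 z.2) ^ γ' * m z.1 z.2) ^ (1 / γ')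
      * (m z.1 z.2 ^ p) ^ (1 / (p * (γ' / (γ' - 1)))) = euclNorm (A z.1 z.2) * m z.1 z.2 := by
    rw [Real.mul_rpow (by positivity) hm0, ← Real.rpow_mul ha0, mul_one_div_cancel hγp.ne',
      Real.rpow_one, ← Real.rpow_mul hm0, mul_assoc,
      show p * (1 / (p * (γ' / (γ' - 1)))) = 1 - 1 / γ' by
        have : γ' - 1 ≠ 0 := by linarith
        field_simp]
    congr 1
    rcases hm0.eq_or_lt with h0 | h0
    · rw [← h0, Real.zero_rpow (one_div_pos.2 hγp).ne', zero_mul]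
    · rw [← Real.rpow_add h0, add_sub_cancel, Real.rpow_one]
  rw [e2]
  calc _ ≤ m z.1 z.2 * (euclNorm (A z.1 z.2) * euclNorm (grad (fun y => φ y z.2) z.1)) :=
        mul_le_mul_of_nonneg_left (abs_dotp_le _ _) hm0
    _ = _ := by ring

end

theorem PerTest.lintegral_strip_rpow_le {N : ℕ} {a b T q : ℝ} {f : RN N × ℝ → ℝ}
    (hf : PerTest a b f) (ha : 0 ≤ a) (hb : b ≤ T) (hT : 0 < T) (hq : 1 ≤ q) :
    ∫⁻ z in strip N, ‖f z‖ₑ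
      ≤ ENNReal.ofReal (T ^ (1 - 1 / q)) * (∫⁻ z in strip N, ‖f z‖ₑ ^ q) ^ (1 / q) := by
  have hq0 : 0 < q := by linarith
  set s : Set (RN N × ℝ) := univ ×ˢ Icc 0 T with hs
  have hsm : MeasurableSet s := MeasurableSet.univ.prod measurableSet_Icc
  set κ : RN N × ℝ → ℝ≥0∞ := s.indicator fun _ => 1 with hκ
  have hκm : Measurable κ := measurable_const.indicator hsm
  have hz : ∀ z, z ∉ s → f z = 0 := fun z hz => hf.supp z fun h =>
    hz ⟨mem_univ _, ha.trans h.1, h.2.trans hb⟩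
  have h1 : ∀ z, κ z * ‖f z‖ₑ = ‖f z‖ₑ := fun z => by
    by_cases h : z ∈ s
    · rw [hκ, indicator_of_mem h, one_mul]
    · rw [hz z h, enorm_zero, mul_zero]
  have h2 : ∀ z, κ z * ‖f z‖ₑ ^ q ≤ ‖f z‖ₑ ^ q := fun z =>
    mul_le_of_le_one_left zero_le (indicator_le_self' (f := fun _ => 1) (by simp) z |>.trans le_rfl)
  have hvol : ∫⁻ z in strip N, κ z = ENNReal.ofReal T := by
    rw [hκ, lintegral_indicator hsm, setLIntegral_one, Measure.restrict_apply hsm,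
      show s ∩ strip N = cube N ×ˢ Icc 0 T by ext; simp [hs, strip, and_comm],
      Measure.volume_eq_prod, Measure.prod_prod, volume_cube, Real.volume_Icc]
    simp
  have h := rpow_lintegral_mul_le (μ := volume.restrict (strip N)) hκm.aemeasurable
    hf.continuous.measurable.enorm.aemeasurable hq
  simp only [h1, hvol] at h
  have h3 := ENNReal.rpow_le_rpow (h.trans (mul_le_mul le_rfl (lintegral_mono h2) zero_le zero_le))
    (one_div_pos.2 hq0).le
  rw [← ENNReal.rpow_mul, mul_one_div_cancel hq0.ne', ENNReal.rpow_one,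
    ENNReal.mul_rpow_of_nonneg _ _ (one_div_pos.2 hq0).le, ← ENNReal.rpow_mul,
    ENNReal.ofReal_rpow_of_pos hT] at h3
  rwa [show (q - 1) * (1 / q) = 1 - 1 / q by field_simp] at h3

theorem PerTest.exists_heatK_sub_le {N : ℕ} {a b : ℝ} {f : RN N × ℝ → ℝ} (hf : PerTest a b f) :
    ∃ L : ℝ, ∀ (ε : ℝ), 0 < ε → ∀ x t, |(∫ y, heatK ε y * f (x - y, t)) - f (x, t)| ≤ L * √ε := by
  obtain ⟨C, hC, h⟩ := exists_lintegral_le_of_le_poly_mul_heatK N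
  obtain ⟨M, hM⟩ := hf.total_deriv.norm_bdd
  obtain ⟨M', hM'⟩ := hf.norm_bdd
  have hM0 : 0 ≤ M := (norm_nonneg _).trans (hM 0)
  refine ⟨C * M, fun ε hε x t => ?_⟩
  have hlip : ∀ y, |f (x - y, t) - f (x, t)| ≤ M * ‖y‖ := fun y => by
    have := (convex_univ (𝕜 := ℝ) (E := RN N × ℝ)).norm_image_sub_le_of_norm_fderiv_le
      (fun z _ => hf.differentiable z) (fun z _ => hM z) (mem_univ (x, t)) (mem_univ (x - y, t))
    rw [show ((x - y, t) : RN N × ℝ) - (x, t) = (-y, 0) by ext <;> simp] at this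
    simpa using this
  have hi : Integrable fun y : RN N => heatK ε y * f (x - y, t) :=
    (integrable_heatK hε).mul_bdd (c := M') (by
      have := hf.continuous
      exact Continuous.aestronglyMeasurable (by fun_prop)) (ae_of_all _ fun y => hM' _)
  have e : (∫ y, heatK ε y * f (x - y, t)) - f (x, t)
      = ∫ y, heatK ε y * (f (x - y, t) - f (x, t)) := by
    simp only [mul_sub]
    rw [integral_sub hi ((integrable_heatK hε).mul_const _), integral_mul_const, integral_heatK hε,
      one_mul]
  rw [e]
  have h1 := h ε hε (fun y => heatK ε y * (f (x - y, t) - f (x, t))) (M * √ε) (by positivity)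
    fun y => by
      have hk := heatK_nonneg hε y
      have hS : 0 ≤ ∑ i, y i ^ 2 := Finset.sum_nonneg fun i _ => sq_nonneg _
      set S := ∑ i, y i ^ 2 with hSdef
      have hy : ‖y‖ ≤ √ε * (1 + S / ε) ^ 2 := by
        have h2 : ‖y‖ ≤ √ε * √(S / ε) := by
          rw [← Real.sqrt_mul hε.le, mul_div_cancel₀ _ hε.ne']
          exact Real.le_sqrt_of_sq_le (sq_norm_le_sum y)
        refine h2.trans (mul_le_mul_of_nonneg_left ?_ (Real.sqrt_nonneg _))
        have h3 : 0 ≤ S / ε := by positivity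
        rw [Real.sqrt_le_left (by positivity)]
        nlinarith [sq_nonneg (S / ε), mul_nonneg h3 h3, mul_nonneg h3 (mul_nonneg h3 h3),
          mul_nonneg (mul_nonneg h3 h3) (mul_nonneg h3 h3)]
      rw [abs_mul, abs_of_nonneg hk]
      calc _ ≤ heatK ε y * (M * (√ε * (1 + S / ε) ^ 2)) :=
            mul_le_mul_of_nonneg_left ((hlip y).trans (mul_le_mul_of_nonneg_left hy hM0)) hk
        _ = _ := by ring
  have h2 := (enorm_integral_le_lintegral_enorm
    (fun y => heatK ε y * (f (x - y, t) - f (x, t)))).trans h1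
  rw [Real.enorm_eq_ofReal_abs, ENNReal.ofReal_le_ofReal_iff (by positivity)] at h2
  rw [mul_assoc]
  exact h2

section

variable {N : ℕ} {T γ' p q K₀ : ℝ}

theorem exists_potential_bound (hT : 0 < T) (hp : 1 < p) (hγ' : 1 < γ') (hq : 1 < q) (hK₀ : 0 ≤ K₀)
    (hsum : 1 / γ' + 1 / (p * (γ' / (γ' - 1))) + 1 / q = 1) :
    ∃ C : ℝ, 0 ≤ C ∧ ∀ (m₀ : RN N → ℝ) (m : RN N → ℝ → ℝ) (A : RN N → ℝ → RN N),
      FPData N K₀ m₀ → FPSol N T γ' m₀ m A →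
      IntegrableOn (fun z : RN N × ℝ => m z.1 z.2 ^ p) (QQ N T) →
      ∀ (a b : ℝ) (f : RN N × ℝ → ℝ), 0 ≤ a → b ≤ T → PerTest a b f → ∀ ε : ℝ, 0 < ε →
      ∀ h : RN N × ℝ → ℝ, (h = f ∨ ∃ j, h = fun z => fderiv ℝ f z (dirX j)) →
      ENNReal.ofReal |intQ N T (fun x t => m x t *
          (deriv (potTest ε h x) t + lap (fun y => potTest ε h y t) x))|
        ≤ ENNReal.ofReal (C * (fluxNorm N T γ' p m A + 1))
          * (∫⁻ z in strip N, ‖f z‖ₑ ^ q) ^ (1 / q) := by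
  obtain ⟨D, hD⟩ := exists_lintegral_grad_potTest_le N hq
  have hq0 : 0 < q := by linarith
  refine ⟨(D : ℝ) ^ (1 / q) + (1 + N * K₀ + K₀) * T ^ (1 - 1 / q), by positivity,
    fun m₀ m A hd hs hmp a b f ha hb hf ε hε h hh => ?_⟩
  set S := ∫⁻ z in strip N, ‖f z‖ₑ ^ q with hS
  have hF : 0 ≤ fluxNorm N T γ' p m A := fluxNorm_nonneg hs.nonneg
  have hh' : PerTest a b h := by
    rcases hh with rfl | ⟨j, rfl⟩
    · exact hf
    · exact hf.dir_deriv _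
  have hg : ∫⁻ z in QQ N T, ‖euclNorm (grad (fun y => potTest ε h y z.2) z.1)‖ₑ ^ q ≤ D * S := by
    rcases hh with rfl | ⟨j, rfl⟩
    · exact (hD ε hε a b _ hf T).1
    · exact (hD ε hε a b _ hf T).2 j
  have hi : ENNReal.ofReal |∫ x in cube N, m₀ x * potTest ε h x 0|
      ≤ ENNReal.ofReal (1 + N * K₀ + K₀) * ∫⁻ z in strip N, ‖f z‖ₑ := by
    rcases hh with rfl | ⟨j, rfl⟩
    · refine (hd.abs_initial_le hf hε).1.trans (mul_le_mul ?_ le_rfl zero_le zero_le)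
      exact ENNReal.ofReal_le_ofReal (by linarith)
    · exact (hd.abs_initial_le hf hε).2 j
  have htest := hh'.isTest_potTest hε
  have hid := hs.test_identity hd hT htest fun x => hh'.potTest_eq_zero hb x
  have hfl := hs.flux_le hp hγ' hq hsum hmp htest
  set I₁ := intQ N T fun x t => m x t *
          (deriv (potTest ε h x) t + lap (fun y => potTest ε h y t) x)
  set I₂ := intQ N T fun x t => m x t * dotp (A x t) (grad (fun y => potTest ε h y t) x)
  set I₃ := ∫ x in cube N, m₀ x * potTest ε h x 0
  have hI : |I₁| ≤ |I₂| + |I₃| := by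
    rw [show I₁ = -(I₂ + I₃) by linarith, abs_neg]
    exact abs_add_le _ _
  calc ENNReal.ofReal |I₁| ≤ ENNReal.ofReal |I₂| + ENNReal.ofReal |I₃| := by
        rw [← ENNReal.ofReal_add (abs_nonneg _) (abs_nonneg _)]
        exact ENNReal.ofReal_le_ofReal hI
    _ ≤ ENNReal.ofReal (fluxNorm N T γ' p m A) * (D * S) ^ (1 / q)
        + ENNReal.ofReal (1 + N * K₀ + K₀) * (ENNReal.ofReal (T ^ (1 - 1 / q)) * S ^ (1 / q)) := by
        refine add_le_add (hfl.trans ?_) (hi.trans ?_)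
        · exact mul_le_mul le_rfl (ENNReal.rpow_le_rpow hg (one_div_pos.2 hq0).le) zero_le zero_le
        · exact mul_le_mul le_rfl (hf.lintegral_strip_rpow_le ha hb hT hq.le) zero_le zero_le
    _ = ENNReal.ofReal (fluxNorm N T γ' p m A * (D : ℝ) ^ (1 / q)
          + (1 + N * K₀ + K₀) * T ^ (1 - 1 / q)) * S ^ (1 / q) := by
        rw [ENNReal.ofReal_add (p := fluxNorm N T γ' p m A * (D : ℝ) ^ (1 / q))
            (q := (1 + N * K₀ + K₀) * T ^ (1 - 1 / q)) (by positivity) (by positivity),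
          ENNReal.ofReal_mul hF,
          ENNReal.ofReal_mul (p := 1 + N * K₀ + K₀) (by positivity),
          ENNReal.mul_rpow_of_nonneg _ _ (one_div_pos.2 hq0).le,
          ← ENNReal.ofReal_rpow_of_nonneg D.coe_nonneg (one_div_pos.2 hq0).le,
          ENNReal.ofReal_coe_nnreal]
        ring
    _ ≤ _ := by
        refine mul_le_mul (ENNReal.ofReal_le_ofReal ?_) le_rfl zero_le zero_le
        have h1 : 0 ≤ (D : ℝ) ^ (1 / q) := by positivity
        have h2 : 0 ≤ (1 + N * K₀ + K₀) * T ^ (1 - 1 / q) := by positivity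
        nlinarith [mul_nonneg hF h2]

theorem tendsto_potential {m₀ : RN N → ℝ} {m : RN N → ℝ → ℝ} {A : RN N → ℝ → RN N}
    (hs : FPSol N T γ' m₀ m A) {a b : ℝ} {h : RN N × ℝ → ℝ} (hh : PerTest a b h) :
    Tendsto (fun n : ℕ => intQ N T (fun x t => m x t * (deriv (potTest (1 / ((n : ℝ) + 1)) h x) t
        + lap (fun y => potTest (1 / ((n : ℝ) + 1)) h y t) x))) atTop
      (𝓝 (-intQ N T (fun x t => m x t * (Real.exp (-t) * h (x, t))))) := by
  obtain ⟨L, hL⟩ := hh.exists_heatK_sub_le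
  obtain ⟨M, hM⟩ := hh.norm_bdd
  have hM0 : 0 ≤ M := (norm_nonneg _).trans (hM 0)
  have hε : ∀ n : ℕ, 0 < 1 / ((n : ℝ) + 1) := fun n => by positivity
  have hL0 : 0 ≤ L := by
    have := (abs_nonneg _).trans (hL 1 one_pos 0 0)
    simpa using this
  have hlim : Tendsto (fun n : ℕ => 1 / ((n : ℝ) + 1)) atTop (𝓝 0) :=
    tendsto_one_div_add_atTop_nhds_zero_nat
  unfold intQ
  rw [← integral_neg]
  refine tendsto_integral_of_dominated_convergence (fun z => m z.1 z.2 * (M + L)) (fun n => ?_)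
    (hs.int_m.mul_const _) (fun n => ?_) (ae_of_all _ fun z => ?_)
  · have htest := hh.isTest_potTest (hε n)
    exact ((htest.deriv.add htest.lap).integrableOn_mul hs.int_m).1
  · refine (ae_restrict_iff' (measurableSet_QQ N T)).2 (ae_of_all _ fun z hz => ?_)
    beta_reduce
    rw [hh.potTest_equation (hε n), norm_mul, Real.norm_of_nonneg (hs.nonneg _ _)]
    refine mul_le_mul_of_nonneg_left ?_ (hs.nonneg _ _)
    rw [norm_neg, norm_mul, norm_mul, Real.norm_of_nonneg (Real.exp_nonneg _),
      Real.norm_of_nonneg (Real.exp_nonneg _)]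
    have h1 : Real.exp (-z.2) ≤ 1 := Real.exp_le_one_iff.2 (by linarith [hz.2.1])
    have h2 : Real.exp (-(1 / ((n : ℝ) + 1))) ≤ 1 := Real.exp_le_one_iff.2 (by linarith [hε n])
    have h3 := hL _ (hε n) z.1 z.2
    have h4 : √(1 / ((n : ℝ) + 1)) ≤ 1 := by
      rw [Real.sqrt_le_one]
      rw [div_le_one (by positivity)]
      linarith [Nat.cast_nonneg (α := ℝ) n]
    have h5 : ‖∫ y, heatK (1 / ((n : ℝ) + 1)) y * h (z.1 - y, z.2)‖ ≤ M + L := by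
      have h6 := hM (z.1, z.2)
      rw [Real.norm_eq_abs] at h6 ⊢
      have h7 := abs_sub_abs_le_abs_sub (∫ y, heatK (1 / ((n : ℝ) + 1)) y * h (z.1 - y, z.2))
        (h (z.1, z.2))
      have h8 : L * √(1 / ((n : ℝ) + 1)) ≤ L := mul_le_of_le_one_right hL0 h4
      linarith
    refine (mul_le_of_le_one_left (by positivity) h1).trans
      ((mul_le_of_le_one_left (by positivity) h2).trans h5)
  · simp only [hh.potTest_equation (hε _)]
    rw [← mul_neg]
    refine Tendsto.const_mul _ (Tendsto.neg (Tendsto.const_mul _ ?_))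
    have h1 : Tendsto (fun n : ℕ => Real.exp (-(1 / ((n : ℝ) + 1)))) atTop (𝓝 1) := by
      have := (Real.continuous_exp.tendsto _).comp hlim.neg
      simpa [Function.comp_def] using this
    have h2 : Tendsto (fun n : ℕ => ∫ y, heatK (1 / ((n : ℝ) + 1)) y * h (z.1 - y, z.2)) atTop
        (𝓝 (h (z.1, z.2))) := by
      rw [tendsto_iff_norm_sub_tendsto_zero]
      refine squeeze_zero (fun _ => norm_nonneg _) (fun n => hL _ (hε n) z.1 z.2) ?_
      have := ((Real.continuous_sqrt.tendsto _).comp hlim).const_mul L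
      simpa [Function.comp_def] using this
    simpa using h1.mul h2

theorem exists_damped_bound (hT : 0 < T) (hp : 1 < p) (hγ' : 1 < γ') (hq : 1 < q) (hK₀ : 0 ≤ K₀)
    (hsum : 1 / γ' + 1 / (p * (γ' / (γ' - 1))) + 1 / q = 1) :
    ∃ C : ℝ, 0 ≤ C ∧ ∀ (m₀ : RN N → ℝ) (m : RN N → ℝ → ℝ) (A : RN N → ℝ → RN N),
      FPData N K₀ m₀ → FPSol N T γ' m₀ m A →
      IntegrableOn (fun z : RN N × ℝ => m z.1 z.2 ^ p) (QQ N T) →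
      ∀ (a b : ℝ) (f : RN N × ℝ → ℝ), 0 ≤ a → b ≤ T → PerTest a b f →
      ∀ h : RN N × ℝ → ℝ, (h = f ∨ ∃ j, h = fun z => fderiv ℝ f z (dirX j)) →
      ENNReal.ofReal |intQ N T (fun x t => m x t * (Real.exp (-t) * h (x, t)))|
        ≤ ENNReal.ofReal (C * (fluxNorm N T γ' p m A + 1))
          * (∫⁻ z in strip N, ‖f z‖ₑ ^ q) ^ (1 / q) := by
  obtain ⟨C, hC, H⟩ := exists_potential_bound (N := N) hT hp hγ' hq hK₀ hsum
  refine ⟨C, hC, fun m₀ m A hd hs hmp a b f ha hb hf h hh => ?_⟩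
  have hh' : PerTest a b h := by
    rcases hh with rfl | ⟨j, rfl⟩
    · exact hf
    · exact hf.dir_deriv _
  have hlim := (ENNReal.continuous_ofReal.tendsto _).comp (tendsto_potential hs hh').abs
  rw [abs_neg] at hlim
  exact le_of_tendsto hlim (Eventually.of_forall fun n =>
    H m₀ m A hd hs hmp a b f ha hb hf _ (by positivity) h hh)

end

/-- Smooth cutoffs in time, supported in `(0, T)` and increasing to its indicator. -/
def timeCut (T : ℝ) (n : ℕ) (t : ℝ) : ℝ :=
  Real.smoothTransition (n * t - 1) * Real.smoothTransition (n * (T - t) - 1)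

theorem contDiff_timeCut (T : ℝ) (n : ℕ) : ContDiff ℝ (⊤ : ℕ∞) (timeCut T n) := by
  unfold timeCut
  exact (Real.smoothTransition.contDiff.comp (by fun_prop)).mul
    (Real.smoothTransition.contDiff.comp (by fun_prop))

theorem timeCut_nonneg (T : ℝ) (n : ℕ) (t : ℝ) : 0 ≤ timeCut T n t :=
  mul_nonneg (Real.smoothTransition.nonneg _) (Real.smoothTransition.nonneg _)

theorem timeCut_le_one (T : ℝ) (n : ℕ) (t : ℝ) : timeCut T n t ≤ 1 :=
  mul_le_one₀ (Real.smoothTransition.le_one _) (Real.smoothTransition.nonneg _)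
    (Real.smoothTransition.le_one _)

theorem timeCut_eq_zero {T : ℝ} (n : ℕ) {t : ℝ} (ht : t ∉ Ioo 0 T) : timeCut T n t = 0 := by
  have hn : (0 : ℝ) ≤ n := n.cast_nonneg
  by_cases h : t ≤ 0
  · rw [timeCut, Real.smoothTransition.zero_of_nonpos (by nlinarith), zero_mul]
  · have h' : T ≤ t := by
      by_contra h'
      exact ht ⟨not_le.1 h, not_le.1 h'⟩
    rw [timeCut, Real.smoothTransition.zero_of_nonpos (x := n * (T - t) - 1) (by nlinarith),
      mul_zero]

theorem tendsto_timeCut {T t : ℝ} (ht : t ∈ Ioo 0 T) :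
    Tendsto (fun n => timeCut T n t) atTop (𝓝 1) := by
  have key : ∀ s : ℝ, 0 < s → ∀ᶠ n : ℕ in atTop, Real.smoothTransition (n * s - 1) = 1 := by
    intro s hs
    have h := (tendsto_natCast_atTop_atTop (R := ℝ)).atTop_mul_const hs
    filter_upwards [h.eventually_ge_atTop 2] with n hn
    exact Real.smoothTransition.one_of_one_le (by linarith)
  refine tendsto_const_nhds.congr' ?_
  filter_upwards [key t ht.1, key (T - t) (sub_pos.2 ht.2)] with n h1 h2
  rw [timeCut, h1, h2, mul_one]

section

variable {N : ℕ} {T γ' p q K₀ : ℝ}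

theorem IsTest.perTest_expCut {ψ : RN N → ℝ → ℝ} (hψ : IsTest N ψ) (T : ℝ) (n : ℕ) :
    PerTest 0 T (fun z : RN N × ℝ => (Real.exp z.2 * timeCut T n z.2) * ψ z.1 z.2) := by
  have h := (IsTest.of_time (N := N) (Real.contDiff_exp.mul (contDiff_timeCut T n))).mul hψ
  refine ⟨h.1, fun k z => ?_, fun z hz => ?_⟩
  · have := h.2 z.2 z.1 k
    simp only [latt, Prod.fst_add, Prod.snd_add, add_zero]
    exact this
  · rw [timeCut_eq_zero n fun h => hz (Ioo_subset_Icc_self h), mul_zero, zero_mul]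

theorem IsTest.fderiv_expCut {ψ : RN N → ℝ → ℝ} (hψ : IsTest N ψ) (T : ℝ) (n : ℕ) (j : Fin N) :
    (fun z => fderiv ℝ (fun z : RN N × ℝ => (Real.exp z.2 * timeCut T n z.2) * ψ z.1 z.2) z
      (dirX j)) = fun z => (Real.exp z.2 * timeCut T n z.2) * pd j (fun y => ψ y z.2) z.1 := by
  ext z
  have h := pd_section_space (hψ.perTest_expCut T n).differentiable j z.1 z.2
  refine h.symm.trans ?_
  have hd : DifferentiableAt ℝ (fun y => ψ y z.2) z.1 := by
    have := hψ.differentiable.comp (f := fun y : RN N => (y, z.2)) (by fun_prop)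
    exact this z.1
  simp only [pd]
  rw [fderiv_const_mul hd]
  simp

theorem IsTest.lintegral_expCut_le {ψ : RN N → ℝ → ℝ} (n : ℕ) (hq : 0 < q) :
    ∫⁻ z in strip N, ‖(Real.exp z.2 * timeCut T n z.2) * ψ z.1 z.2‖ₑ ^ q
      ≤ ENNReal.ofReal (Real.exp T) ^ q * ∫⁻ z in QQ N T, ‖ψ z.1 z.2‖ₑ ^ q := by
  have hsub : QQ N T ⊆ strip N := prod_mono le_rfl (subset_univ _)
  rw [← lintegral_const_mul' _ _ (ENNReal.rpow_ne_top_of_nonneg hq.le ENNReal.ofReal_ne_top),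
    ← lintegral_indicator (measurableSet_QQ N T),
    ← lintegral_indicator (measurableSet_strip N)]
  refine lintegral_mono fun z => ?_
  by_cases hz : z ∈ QQ N T
  · rw [indicator_of_mem hz, indicator_of_mem (hsub hz), enorm_mul,
      ENNReal.mul_rpow_of_nonneg _ _ hq.le]
    refine mul_le_mul (ENNReal.rpow_le_rpow ?_ hq.le) le_rfl zero_le zero_le
    rw [Real.enorm_of_nonneg (mul_nonneg (Real.exp_nonneg _) (timeCut_nonneg _ _ _))]
    refine ENNReal.ofReal_le_ofReal ((mul_le_of_le_one_right (Real.exp_nonneg _)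
      (timeCut_le_one _ _ _)).trans (Real.exp_le_exp.2 hz.2.2.le))
  · rw [indicator_of_notMem hz]
    by_cases hz' : z ∈ strip N
    · rw [indicator_of_mem hz', timeCut_eq_zero n fun h => hz ⟨hz'.1, h⟩]
      simp [hq]
    · rw [indicator_of_notMem hz']

theorem exists_test_bound (hT : 0 < T) (hp : 1 < p) (hγ' : 1 < γ') (hq : 1 < q) (hK₀ : 0 ≤ K₀)
    (hsum : 1 / γ' + 1 / (p * (γ' / (γ' - 1))) + 1 / q = 1) :
    ∃ C : ℝ, 0 ≤ C ∧ ∀ (m₀ : RN N → ℝ) (m : RN N → ℝ → ℝ) (A : RN N → ℝ → RN N),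
      FPData N K₀ m₀ → FPSol N T γ' m₀ m A →
      IntegrableOn (fun z : RN N × ℝ => m z.1 z.2 ^ p) (QQ N T) →
      ∀ ψ : RN N → ℝ → ℝ, IsTest N ψ →
      ∀ h : RN N → ℝ → ℝ, (h = ψ ∨ ∃ j, h = fun x t => pd j (fun y => ψ y t) x) →
      ENNReal.ofReal |intQ N T (fun x t => m x t * h x t)|
        ≤ ENNReal.ofReal (C * (fluxNorm N T γ' p m A + 1))
          * (∫⁻ z in QQ N T, ‖ψ z.1 z.2‖ₑ ^ q) ^ (1 / q) := by
  obtain ⟨C, hC, H⟩ := exists_damped_bound (N := N) hT hp hγ' hq hK₀ hsum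
  have hq0 : 0 < q := by linarith
  refine ⟨C * Real.exp T, by positivity, fun m₀ m A hd hs hmp ψ hψ h hh => ?_⟩
  have hF : 0 ≤ fluxNorm N T γ' p m A := fluxNorm_nonneg hs.nonneg
  have hht : IsTest N h := by
    rcases hh with rfl | ⟨j, rfl⟩
    · exact hψ
    · exact hψ.pd j
  have hb : ∀ n, ENNReal.ofReal |intQ N T (fun x t => m x t * (timeCut T n t * h x t))|
      ≤ ENNReal.ofReal (C * Real.exp T * (fluxNorm N T γ' p m A + 1))
          * (∫⁻ z in QQ N T, ‖ψ z.1 z.2‖ₑ ^ q) ^ (1 / q) := by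
    intro n
    have h1 := H m₀ m A hd hs hmp 0 T _ le_rfl le_rfl (hψ.perTest_expCut T n)
      (fun z => (Real.exp z.2 * timeCut T n z.2) * h z.1 z.2) (by
        rcases hh with rfl | ⟨j, rfl⟩
        · exact Or.inl rfl
        · exact Or.inr ⟨j, (hψ.fderiv_expCut T n j).symm⟩)
    have e : ∀ x t, m x t * (Real.exp (-t) * ((Real.exp t * timeCut T n t) * h x t))
        = m x t * (timeCut T n t * h x t) := fun x t => by
      rw [← mul_assoc (Real.exp (-t)), ← mul_assoc (Real.exp (-t)), ← Real.exp_add]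
      simp
    simp only [e] at h1
    refine h1.trans ?_
    calc _ ≤ ENNReal.ofReal (C * (fluxNorm N T γ' p m A + 1))
          * (ENNReal.ofReal (Real.exp T) ^ q * ∫⁻ z in QQ N T, ‖ψ z.1 z.2‖ₑ ^ q) ^ (1 / q) :=
          mul_le_mul le_rfl (ENNReal.rpow_le_rpow (IsTest.lintegral_expCut_le n hq0)
            (one_div_pos.2 hq0).le) zero_le zero_le
      _ = _ := by
          rw [ENNReal.mul_rpow_of_nonneg _ _ (one_div_pos.2 hq0).le, ← ENNReal.rpow_mul,
            mul_one_div_cancel hq0.ne', ENNReal.rpow_one, ← mul_assoc,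
            ← ENNReal.ofReal_mul (by positivity)]
          congr 2
          ring
  have hlim : Tendsto (fun n => intQ N T (fun x t => m x t * (timeCut T n t * h x t))) atTop
      (𝓝 (intQ N T (fun x t => m x t * h x t))) := by
    unfold intQ
    have hi := hht.integrableOn_mul hs.int_m
    refine tendsto_integral_of_dominated_convergence (fun z => ‖m z.1 z.2 * h z.1 z.2‖)
      (fun n => ?_) hi.norm (fun n => ae_of_all _ fun z => ?_)
      ((ae_restrict_iff' (measurableSet_QQ N T)).2 (ae_of_all _ fun z hz => ?_))
    · exact (((IsTest.of_time (contDiff_timeCut T n)).mul hht).integrableOn_mul hs.int_m).1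
    · simp only [norm_mul, Real.norm_of_nonneg (timeCut_nonneg T n z.2)]
      refine mul_le_mul_of_nonneg_left ?_ (norm_nonneg _)
      exact mul_le_of_le_one_left (norm_nonneg _) (timeCut_le_one T n z.2)
    · have := ((tendsto_timeCut hz.2).mul_const (h z.1 z.2)).const_mul (m z.1 z.2)
      simpa using this
  exact le_of_tendsto ((ENNReal.continuous_ofReal.tendsto _).comp hlim.abs)
    (Eventually.of_forall hb)

end

theorem exists_clm_extension {V E : Type*} [AddCommGroup V] [Module ℝ V] [NormedAddCommGroup E]
    [NormedSpace ℝ E] (ι : V →ₗ[ℝ] E) (Λ : V →ₗ[ℝ] ℝ) {R : ℝ} (hR : 0 ≤ R)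
    (h : ∀ v, |Λ v| ≤ R * ‖ι v‖) :
    ∃ L : E →L[ℝ] ℝ, (∀ v, L (ι v) = Λ v) ∧ ‖L‖ ≤ R := by
  have hk : LinearMap.ker ι ≤ LinearMap.ker Λ := fun v hv => by
    rw [LinearMap.mem_ker] at hv ⊢
    have := h v
    rw [hv, norm_zero, mul_zero] at this
    exact abs_nonpos_iff.1 this
  set f₀ : LinearMap.range ι →ₗ[ℝ] ℝ :=
    (LinearMap.ker ι).liftQ Λ hk ∘ₗ ι.quotKerEquivRange.symm.toLinearMap with hf₀
  have hf₀v : ∀ v, f₀ ⟨ι v, LinearMap.mem_range_self ι v⟩ = Λ v := fun v => by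
    have : ι.quotKerEquivRange.symm ⟨ι v, LinearMap.mem_range_self ι v⟩
        = Submodule.Quotient.mk v := by
      rw [LinearEquiv.symm_apply_eq]
      rfl
    simp only [hf₀, LinearMap.comp_apply, LinearEquiv.coe_coe, this]
    exact Submodule.liftQ_apply _ _ _
  have hb : ∀ w, ‖f₀ w‖ ≤ R * ‖w‖ := by
    rintro ⟨w, v, rfl⟩
    rw [hf₀v]
    exact h v
  obtain ⟨L, hL, hn⟩ := exists_extension_norm_eq (𝕜 := ℝ) (LinearMap.range ι)
    (f₀.mkContinuous R hb)
  exact ⟨L, fun v => (hL ⟨ι v, LinearMap.mem_range_self ι v⟩).trans (hf₀v v),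
    hn.trans_le (f₀.mkContinuous_norm_le hR hb)⟩

section

variable {α : Type*} [MeasurableSpace α] {μ : Measure α} [IsFiniteMeasure μ]
  {P : ℝ≥0∞}

theorem indicatorConstLp_biUnion_finset {s : ℕ → Set α} (hs : ∀ i, MeasurableSet (s i))
    (hd : Pairwise (Function.onFun Disjoint s)) (S : Finset ℕ) :
    ∑ i ∈ S, indicatorConstLp P (hs i) (measure_ne_top μ _) (1 : ℝ)
      = indicatorConstLp P (S.measurableSet_biUnion fun i _ => hs i) (measure_ne_top μ _) 1 := by
  induction S using Finset.induction_on with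
  | empty => simp
  | insert a S ha ih =>
    rw [Finset.sum_insert ha, ih, ← indicatorConstLp_disjoint_union]
    · congr 1
      simp
    · rw [disjoint_iUnion₂_right]
      exact fun i hi => hd fun h => ha (h ▸ hi)

variable [Fact (1 ≤ P)]

theorem hasSum_indicatorConstLp (hP : P ≠ ∞) {s : ℕ → Set α} (hs : ∀ i, MeasurableSet (s i))
    (hd : Pairwise (Function.onFun Disjoint s)) :
    HasSum (fun i => indicatorConstLp P (hs i) (measure_ne_top μ _) (1 : ℝ))
      (indicatorConstLp P (MeasurableSet.iUnion hs) (measure_ne_top μ _) 1) := by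
  unfold HasSum
  simp only [indicatorConstLp_biUnion_finset hs hd]
  refine tendsto_indicatorConstLp_set hP ?_
  have h1 : ∀ S : Finset ℕ, μ (symmDiff (⋃ i ∈ S, s i) (⋃ i, s i))
      = μ (⋃ i, s i) - ∑ i ∈ S, μ (s i) := fun S => by
    rw [symmDiff_of_le (iUnion₂_subset fun i _ => subset_iUnion s i),
      measure_sdiff (iUnion₂_subset fun i _ => subset_iUnion s i)
        (S.measurableSet_biUnion fun i _ => hs i).nullMeasurableSet (measure_ne_top _ _),
      measure_biUnion_finset (fun i _ j _ h => hd h) fun i _ => hs i]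
  simp only [h1]
  have h2 : HasSum (fun i => μ (s i)) (μ (⋃ i, s i)) := by
    rw [measure_iUnion hd hs]
    exact ENNReal.summable.hasSum
  have := ENNReal.Tendsto.sub tendsto_const_nhds h2 (Or.inl (measure_ne_top μ (⋃ i, s i)))
  rwa [tsub_self] at this

/-- The signed measure `s ↦ L(1_s)` attached to a continuous functional on `L^P`. -/
def clmSignedMeasure (hP : P ≠ ∞) (L : Lp ℝ P μ →L[ℝ] ℝ) : SignedMeasure α := by
  classical
  exact
  { measureOf' := fun s => if hs : MeasurableSet s then
      L (indicatorConstLp P hs (measure_ne_top μ _) 1) else 0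
    empty' := by simp
    not_measurable' := fun s hs => dif_neg hs
    m_iUnion' := fun s hs hd => by
      simp only [hs, MeasurableSet.iUnion hs, dif_pos]
      exact L.hasSum (hasSum_indicatorConstLp hP hs hd) }

theorem exists_density_indicator (hP : P ≠ ∞) (L : Lp ℝ P μ →L[ℝ] ℝ) :
    ∃ g : α → ℝ, Measurable g ∧ Integrable g μ ∧ ∀ (s : Set α) (hs : MeasurableSet s),
      L (indicatorConstLp P hs (measure_ne_top μ _) 1) = ∫ x in s, g x ∂μ := by
  set ν := clmSignedMeasure hP L with hν
  have hνs : ∀ (s : Set α) (hs : MeasurableSet s),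
      ν s = L (indicatorConstLp P hs (measure_ne_top μ _) 1) := fun s hs => dif_pos hs
  have hac : ν ≪ᵥ μ.toENNRealVectorMeasure := by
    refine VectorMeasure.AbsolutelyContinuous.mk fun s hs h0 => ?_
    rw [Measure.toENNRealVectorMeasure_apply_measurable hs] at h0
    rw [hνs s hs, show indicatorConstLp P hs (measure_ne_top μ _) (1 : ℝ) = 0 from ?_, map_zero]
    ext1
    refine indicatorConstLp_coeFn.trans ?_
    refine (indicator_ae_eq_zero_of_restrict_ae_eq_zero hs ?_).trans (Lp.coeFn_zero _ _ _).symm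
    rw [Measure.restrict_eq_zero.2 h0]
    rfl
  have h := SignedMeasure.withDensityᵥ_rnDeriv_eq ν μ hac
  refine ⟨ν.rnDeriv μ, SignedMeasure.measurable_rnDeriv _ _, SignedMeasure.integrable_rnDeriv _ _,
    fun s hs => ?_⟩
  rw [← withDensityᵥ_apply (SignedMeasure.integrable_rnDeriv _ _) hs, h, hνs s hs]

end

section

variable {α : Type*} [MeasurableSpace α] {μ : Measure α}

theorem eLpNorm_ofReal_eq {q : ℝ} (hq : 0 < q) (f : α → ℝ) :
    eLpNorm f (ENNReal.ofReal q) μ = (∫⁻ x, ‖f x‖ₑ ^ q ∂μ) ^ (1 / q) := by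
  rw [eLpNorm_eq_lintegral_rpow_enorm_toReal (by simpa using hq) ENNReal.ofReal_ne_top,
    ENNReal.toReal_ofReal hq.le]

variable [IsFiniteMeasure μ] {P : ℝ≥0∞} [Fact (1 ≤ P)]

theorem clm_simpleFunc_eq_integral {L : Lp ℝ P μ →L[ℝ] ℝ} {g : α → ℝ} (hgi : Integrable g μ)
    (hL : ∀ (s : Set α) (hs : MeasurableSet s),
      L (indicatorConstLp P hs (measure_ne_top μ _) 1) = ∫ x in s, g x ∂μ)
    (f : SimpleFunc α ℝ) : ∀ hf : MemLp f P μ, L (hf.toLp f) = ∫ x, f x * g x ∂μ := by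
  have hb : ∀ s : SimpleFunc α ℝ, ∃ c, ∀ x, ‖s x‖ ≤ c := fun s => by
    obtain ⟨c, hc⟩ := (s.finite_range.image norm).bddAbove
    exact ⟨c, fun x => hc ⟨s x, mem_range_self x, rfl⟩⟩
  have hm : ∀ s : SimpleFunc α ℝ, MemLp s P μ := fun s => by
    obtain ⟨c, hc⟩ := hb s
    exact MemLp.of_bound s.aestronglyMeasurable c (ae_of_all _ hc)
  have hi : ∀ s : SimpleFunc α ℝ, Integrable (fun x => s x * g x) μ := fun s => by
    obtain ⟨c, hc⟩ := hb s
    exact hgi.bdd_mul (c := c) s.aestronglyMeasurable (ae_of_all _ hc)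
  induction f using SimpleFunc.induction with
  | const c hs =>
    rename_i s
    intro hf
    have e : hf.toLp _ = c • indicatorConstLp P hs (measure_ne_top μ _) (1 : ℝ) := by
      ext1
      filter_upwards [hf.coeFn_toLp, Lp.coeFn_smul c
        (indicatorConstLp P hs (measure_ne_top μ _) (1 : ℝ)),
        indicatorConstLp_coeFn (p := P) (hs := hs) (hμs := measure_ne_top μ s) (c := (1 : ℝ))]
        with x h1 h2 h3
      rw [h1, h2, Pi.smul_apply, h3]
      by_cases hx : x ∈ s <;> simp [hx]
    rw [e, map_smul, hL s hs, ← integral_indicator hs, smul_eq_mul, ← integral_const_mul]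
    congr 1
    ext x
    by_cases hx : x ∈ s <;> simp [hx]
  | add hfg h₁ h₂ =>
    rename_i f₁ f₂
    intro hf
    have e : hf.toLp _ = (hm f₁).toLp f₁ + (hm f₂).toLp f₂ := (MemLp.toLp_add (hm f₁) (hm f₂)).symm
    rw [e, map_add, h₁, h₂, ← integral_add (hi f₁) (hi f₂)]
    congr 1
    ext x
    simp [add_mul]

end

section

variable {α : Type*} [MeasurableSpace α] {μ : Measure α} [IsFiniteMeasure μ] {q : ℝ}
  [Fact (1 ≤ ENNReal.ofReal q)]

theorem clm_bounded_eq_integral (hq : 0 < q) {L : Lp ℝ (ENNReal.ofReal q) μ →L[ℝ] ℝ} {g : α → ℝ}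
    (hgi : Integrable g μ)
    (hL : ∀ (s : Set α) (hs : MeasurableSet s),
      L (indicatorConstLp _ hs (measure_ne_top μ _) 1) = ∫ x in s, g x ∂μ)
    {f : α → ℝ} (hfm : Measurable f) {c : ℝ} (hc : 0 ≤ c) (hfc : ∀ᵐ x ∂μ, ‖f x‖ ≤ c)
    (hf : MemLp f (ENNReal.ofReal q) μ) : L (hf.toLp f) = ∫ x, f x * g x ∂μ := by
  have hs := hfm.stronglyMeasurable
  set s : ℕ → SimpleFunc α ℝ := fun n => hs.approxBounded c n
  have hsc : ∀ n x, ‖s n x‖ ≤ c := hs.norm_approxBounded_le hc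
  have hst : ∀ᵐ x ∂μ, Tendsto (fun n => s n x) atTop (𝓝 (f x)) := hs.tendsto_approxBounded_ae hfc
  have hsm : ∀ n, MemLp (s n) (ENNReal.ofReal q) μ := fun n =>
    MemLp.of_bound (s n).aestronglyMeasurable c (ae_of_all _ (hsc n))
  have h1 : Tendsto (fun n => (hsm n).toLp (s n)) atTop (𝓝 (hf.toLp f)) := by
    rw [Lp.tendsto_Lp_iff_tendsto_eLpNorm'']
    simp only [eLpNorm_ofReal_eq hq]
    have h2 : Tendsto (fun n => ∫⁻ x, ‖(⇑(s n) - f) x‖ₑ ^ q ∂μ) atTop (𝓝 0) := by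
      have := tendsto_lintegral_of_dominated_convergence (μ := μ)
        (F := fun n x => ‖(⇑(s n) - f) x‖ₑ ^ q) (f := fun _ => 0)
        (fun _ => ENNReal.ofReal (2 * c) ^ q)
        (fun n => (((s n).measurable.sub hfm).enorm.pow_const q))
        (fun n => by
          filter_upwards [hfc] with x hx
          refine ENNReal.rpow_le_rpow ?_ hq.le
          rw [← ofReal_norm]
          refine ENNReal.ofReal_le_ofReal ((norm_sub_le _ _).trans ?_)
          linarith [hsc n x])
        (by
          rw [lintegral_const]
          exact ENNReal.mul_ne_top (ENNReal.rpow_ne_top_of_nonneg hq.le ENNReal.ofReal_ne_top)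
            (measure_ne_top μ _))
        (by
          filter_upwards [hst] with x hx
          have h3 : Tendsto (fun n => ‖(⇑(s n) - f) x‖ₑ ^ q) atTop (𝓝 (‖f x - f x‖ₑ ^ q)) :=
            ((ENNReal.continuous_rpow_const.tendsto _).comp
              ((continuous_enorm.tendsto _).comp (hx.sub_const _)))
          simpa [hq] using h3)
      simpa using this
    have h3 := (ENNReal.continuous_rpow_const (y := 1 / q)).tendsto 0 |>.comp h2
    simpa [Function.comp_def, hq] using h3
  refine tendsto_nhds_unique ((L.continuous.tendsto _).comp h1) ?_
  simp only [Function.comp_def, clm_simpleFunc_eq_integral hgi hL]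
  refine tendsto_integral_of_dominated_convergence (fun x => c * ‖g x‖)
    (fun n => (hgi.bdd_mul (c := c) (s n).aestronglyMeasurable (ae_of_all _ (hsc n))).1)
    (hgi.norm.const_mul c) (fun n => ae_of_all _ fun x => ?_) ?_
  · rw [norm_mul]
    exact mul_le_mul_of_nonneg_right (hsc n x) (norm_nonneg _)
  · filter_upwards [hst] with x hx using hx.mul_const _

end

/-- The converse of Hölder's inequality, for the positive part. -/
theorem lintegral_ofReal_rpow_le_of_duality {α : Type*} [MeasurableSpace α] {μ : Measure α}
    [IsFiniteMeasure μ] {q r : ℝ} (hqr : q.HolderConjugate r) {g : α → ℝ} (hgm : Measurable g)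
    (hgi : Integrable g μ) {R : ℝ≥0∞}
    (h : ∀ f : α → ℝ, Measurable f → (∀ x, 0 ≤ f x) → (∃ c, ∀ x, f x ≤ c) →
      ENNReal.ofReal (∫ x, f x * g x ∂μ) ≤ R * (∫⁻ x, ‖f x‖ₑ ^ q ∂μ) ^ (1 / q)) :
    ∫⁻ x, ENNReal.ofReal (g x) ^ r ∂μ ≤ R ^ r := by
  have hq0 : 0 < q := hqr.pos
  have hr1 : 1 < r := hqr.symm.lt
  have hr0 : 0 < r := by linarith
  set w : ℕ → α → ℝ := fun n x => min (max (g x) 0) n with hw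
  have hw0 : ∀ n x, 0 ≤ w n x := fun n x => le_min (le_max_right _ _) n.cast_nonneg
  have hwm : ∀ n, Measurable (w n) := fun n => (hgm.max measurable_const).min measurable_const
  have hwq : ∀ n x, (w n x ^ (r - 1)) ^ q = w n x ^ r := fun n x => by
    rw [← Real.rpow_mul (hw0 n x), hqr.symm.sub_one_mul_conj]
  have key : ∀ n, ∫⁻ x, ENNReal.ofReal (w n x) ^ r ∂μ ≤ R ^ r := by
    intro n
    have hfb : ∀ x, w n x ^ (r - 1) ≤ (n : ℝ) ^ (r - 1) := fun x =>
      Real.rpow_le_rpow (hw0 n x) (min_le_right _ _) (by linarith)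
    have hf0 : ∀ x, 0 ≤ w n x ^ (r - 1) := fun x => Real.rpow_nonneg (hw0 n x) _
    have hfm : Measurable fun x => w n x ^ (r - 1) := (hwm n).pow_const _
    have h1 := h (fun x => w n x ^ (r - 1)) hfm hf0 ⟨_, hfb⟩
    have hi : Integrable (fun x => w n x ^ (r - 1) * g x) μ :=
      hgi.bdd_mul (c := (n : ℝ) ^ (r - 1)) hfm.aestronglyMeasurable (ae_of_all _ fun x => by
        rw [Real.norm_of_nonneg (hf0 x)]
        exact hfb x)
    have hpt : ∀ x, w n x ^ r ≤ w n x ^ (r - 1) * g x := fun x => by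
      by_cases hx : 0 < g x
      · have : w n x ≤ g x := (min_le_left _ _).trans (max_le le_rfl hx.le)
        by_cases hz : w n x = 0
        · rw [hz, Real.zero_rpow hr0.ne', Real.zero_rpow (by linarith), zero_mul]
        · have hz' : 0 < w n x := lt_of_le_of_ne (hw0 n x) (Ne.symm hz)
          calc w n x ^ r = w n x ^ (r - 1) * w n x := by
                rw [← Real.rpow_add_one hz]
                ring_nf
            _ ≤ _ := mul_le_mul_of_nonneg_left this (hf0 x)
      · have hz : w n x = 0 := by
          simp only [hw, max_eq_right (not_lt.1 hx)]
          exact min_eq_left n.cast_nonneg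
        rw [hz, Real.zero_rpow hr0.ne', Real.zero_rpow (by linarith), zero_mul]
    set J := ∫⁻ x, ENNReal.ofReal (w n x) ^ r ∂μ with hJ
    have hJq : ∫⁻ x, ‖w n x ^ (r - 1)‖ₑ ^ q ∂μ = J := by
      refine lintegral_congr fun x => ?_
      rw [Real.enorm_of_nonneg (hf0 x), ENNReal.ofReal_rpow_of_nonneg (hf0 x) hq0.le, hwq,
        ENNReal.ofReal_rpow_of_nonneg (hw0 n x) hr0.le]
    have hJle : J ≤ ENNReal.ofReal (∫ x, w n x ^ (r - 1) * g x ∂μ) := by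
      rw [ofReal_integral_eq_lintegral_ofReal hi (ae_of_all _ fun x =>
        (Real.rpow_nonneg (hw0 n x) r).trans (hpt x))]
      refine lintegral_mono fun x => ?_
      rw [ENNReal.ofReal_rpow_of_nonneg (hw0 n x) hr0.le]
      exact ENNReal.ofReal_le_ofReal (hpt x)
    have h2 : J ≤ R * J ^ (1 / q) := hJle.trans (h1.trans_eq (by rw [hJq]))
    have hJt : J ≠ ∞ := ne_top_of_le_ne_top ENNReal.ofReal_ne_top hJle
    by_cases hJ0 : J = 0
    · rw [hJ0]
      exact zero_le
    have h3 : J ^ (1 / r) ≤ R := by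
      have hJp : J ^ (1 / q) ≠ 0 := by simp [hJ0, hJt]
      have hJp' : J ^ (1 / q) ≠ ∞ := by simp [hJ0, hJt]
      rw [← ENNReal.mul_le_mul_iff_left hJp hJp', ← ENNReal.rpow_add _ _ hJ0 hJt,
        show 1 / r + 1 / q = 1 by
          have := hqr.inv_add_inv_eq_one
          rw [one_div, one_div]; linarith, ENNReal.rpow_one]
      exact h2
    calc J = (J ^ (1 / r)) ^ r := by
          rw [← ENNReal.rpow_mul, one_div_mul_cancel hr0.ne', ENNReal.rpow_one]
      _ ≤ R ^ r := ENNReal.rpow_le_rpow h3 hr0.le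
  have hmono : ∀ x, Monotone fun n => ENNReal.ofReal (w n x) ^ r := fun x n k hnk =>
    ENNReal.rpow_le_rpow (ENNReal.ofReal_le_ofReal
      (min_le_min_left _ (Nat.cast_le.2 hnk))) hr0.le
  refine le_of_tendsto' (lintegral_tendsto_of_tendsto_of_monotone
    (f := fun n x => ENNReal.ofReal (w n x) ^ r)
    (fun n => ((hwm n).ennreal_ofReal.pow_const r).aemeasurable) (ae_of_all _ hmono)
    (ae_of_all _ fun x => ?_)) key
  refine tendsto_const_nhds.congr' ?_
  filter_upwards [eventually_ge_atTop ⌈max (g x) 0⌉₊] with n hn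
  have : w n x = max (g x) 0 := min_eq_left ((Nat.le_ceil _).trans (Nat.cast_le.2 hn))
  rw [this]
  rcases le_total (g x) 0 with h0 | h0
  · rw [max_eq_right h0, ENNReal.ofReal_of_nonpos h0, ENNReal.ofReal_zero]
  · rw [max_eq_left h0]

theorem exists_density_of_bound {α V : Type*} [MeasurableSpace α] {μ : Measure α}
    [IsFiniteMeasure μ] {q r : ℝ} (hqr : q.HolderConjugate r) [AddCommGroup V] [Module ℝ V]
    (e : V →ₗ[ℝ] α → ℝ) (hem : ∀ v, Measurable (e v)) (heb : ∀ v, ∃ c, ∀ᵐ x ∂μ, ‖e v x‖ ≤ c)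
    (Λ : V →ₗ[ℝ] ℝ) {R : ℝ} (hR : 0 ≤ R)
    (h : ∀ v, ENNReal.ofReal |Λ v|
      ≤ ENNReal.ofReal R * (∫⁻ x, ‖e v x‖ₑ ^ q ∂μ) ^ (1 / q)) :
    ∃ g : α → ℝ, Measurable g ∧ Integrable g μ ∧
      ∫⁻ x, ‖g x‖ₑ ^ r ∂μ ≤ 2 * ENNReal.ofReal R ^ r ∧ ∀ v, Λ v = ∫ x, e v x * g x ∂μ := by
  have hq0 : 0 < q := hqr.pos
  have hr0 : 0 < r := hqr.symm.pos
  have : Fact (1 ≤ ENNReal.ofReal q) := ⟨by simpa using hqr.lt.le⟩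
  have hmem : ∀ v, MemLp (e v) (ENNReal.ofReal q) μ := fun v => by
    obtain ⟨c, hc⟩ := heb v
    exact MemLp.of_bound (hem v).aestronglyMeasurable c hc
  set ι : V →ₗ[ℝ] Lp ℝ (ENNReal.ofReal q) μ :=
    { toFun := fun v => (hmem v).toLp (e v)
      map_add' := fun v w => by
        rw [← MemLp.toLp_add]
        exact MemLp.toLp_congr _ _ (by rw [map_add])
      map_smul' := fun a v => by
        rw [RingHom.id_apply, ← MemLp.toLp_const_smul]
        exact MemLp.toLp_congr _ _ (by rw [map_smul]) } with hι
  obtain ⟨L, hLι, hLn⟩ := exists_clm_extension ι Λ hR (fun v => by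
    have h1 := h v
    rw [← eLpNorm_ofReal_eq hq0, ← ENNReal.ofReal_toReal (hmem v).eLpNorm_ne_top,
      ← ENNReal.ofReal_mul hR] at h1
    rw [hι]
    simp only [LinearMap.coe_mk, AddHom.coe_mk, Lp.norm_toLp]
    exact (ENNReal.ofReal_le_ofReal_iff (by positivity)).1 h1)
  obtain ⟨g, hgm, hgi, hg⟩ := exists_density_indicator ENNReal.ofReal_ne_top L
  have hdual : ∀ f : α → ℝ, Measurable f → (∀ x, 0 ≤ f x) → (∃ c, ∀ x, f x ≤ c) →
      ENNReal.ofReal |∫ x, f x * g x ∂μ|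
        ≤ ENNReal.ofReal R * (∫⁻ x, ‖f x‖ₑ ^ q ∂μ) ^ (1 / q) := by
    rintro f hf h0 ⟨c, hc⟩
    have hb : ∀ᵐ x ∂μ, ‖f x‖ ≤ max c 0 := ae_of_all _ fun x => by
      rw [Real.norm_of_nonneg (h0 x)]
      exact (hc x).trans (le_max_left _ _)
    have hfL : MemLp f (ENNReal.ofReal q) μ := MemLp.of_bound hf.aestronglyMeasurable _ hb
    rw [← clm_bounded_eq_integral hq0 hgi hg hf (le_max_right _ _) hb hfL,
      ← eLpNorm_ofReal_eq hq0, ← ENNReal.ofReal_toReal hfL.eLpNorm_ne_top,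
      ← ENNReal.ofReal_mul hR, ← Lp.norm_toLp f hfL]
    exact ENNReal.ofReal_le_ofReal ((L.le_opNorm _).trans
      (mul_le_mul_of_nonneg_right hLn (norm_nonneg _)))
  have hpos := lintegral_ofReal_rpow_le_of_duality hqr hgm hgi (R := ENNReal.ofReal R)
    fun f hf h0 hc =>
      (ENNReal.ofReal_le_ofReal (le_abs_self _)).trans (hdual f hf h0 hc)
  have hneg := lintegral_ofReal_rpow_le_of_duality hqr hgm.neg hgi.neg (R := ENNReal.ofReal R)
    fun f hf h0 hc => by
      simp only [Pi.neg_apply, mul_neg, integral_neg]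
      exact (ENNReal.ofReal_le_ofReal (neg_le_abs _)).trans (hdual f hf h0 hc)
  refine ⟨g, hgm, hgi, ?_, fun v => ?_⟩
  · calc ∫⁻ x, ‖g x‖ₑ ^ r ∂μ
        ≤ ∫⁻ x, (ENNReal.ofReal (g x) ^ r + ENNReal.ofReal ((-g) x) ^ r) ∂μ := by
          refine lintegral_mono fun x => ?_
          rw [Real.enorm_eq_ofReal_abs, Pi.neg_apply]
          rcases abs_cases (g x) with ⟨h1, -⟩ | ⟨h1, -⟩ <;> rw [h1]
          · exact le_self_add
          · exact le_add_self
      _ ≤ _ := by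
          rw [lintegral_add_left (hgm.ennreal_ofReal.pow_const r), two_mul]
          exact add_le_add hpos hneg
  · obtain ⟨c, hc⟩ := heb v
    have hc' : ∀ᵐ x ∂μ, ‖e v x‖ ≤ max c 0 := hc.mono fun x hx => hx.trans (le_max_left _ _)
    rw [← hLι v]
    exact clm_bounded_eq_integral hq0 hgi hg (hem v) (le_max_right _ _) hc' (hmem v)

/-- The interior of `QQ N T`. -/
def openQQ (N : ℕ) (T : ℝ) : Set (RN N × ℝ) := (univ.pi fun _ => Ioo (0 : ℝ) 1) ×ˢ Ioo 0 T

theorem isOpen_openQQ (N : ℕ) (T : ℝ) : IsOpen (openQQ N T) :=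
  (isOpen_set_pi finite_univ fun _ _ => isOpen_Ioo).prod isOpen_Ioo

theorem openQQ_subset (N : ℕ) (T : ℝ) : openQQ N T ⊆ QQ N T := fun _ hz =>
  ⟨⟨fun i => (hz.1 i trivial).1.le, fun i => (hz.1 i trivial).2.le⟩, hz.2⟩

theorem openQQ_ae_eq (N : ℕ) (T : ℝ) : openQQ N T =ᵐ[volume] QQ N T :=
  Measure.set_prod_ae_eq (Measure.univ_pi_Ioo_ae_eq_Icc (f := (0 : RN N)) (g := 1))
    (ae_eq_refl _)

theorem ae_QQ_of_openQQ {N : ℕ} {T : ℝ} {p : RN N × ℝ → Prop}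
    (h : ∀ᵐ z, z ∈ openQQ N T → p z) : ∀ᵐ z ∂volume.restrict (QQ N T), p z := by
  rw [← Measure.restrict_congr_set (openQQ_ae_eq N T)]
  exact (ae_restrict_iff' (isOpen_openQQ N T).measurableSet).2 h

/-- The periodic extension of the restriction of `h` to the unit cube. -/
def perExt {N : ℕ} {β : Type*} (h : RN N × ℝ → β) (x : RN N) (t : ℝ) : β :=
  h (fun i => Int.fract (x i), t)

theorem zperiodic_perExt {N : ℕ} {β : Type*} (h : RN N × ℝ → β) (t : ℝ) :
    ZPeriodic fun x => perExt h x t := fun x k => by simp [perExt]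

theorem perExt_ae_eq {N : ℕ} {β : Type*} (h : RN N × ℝ → β) (T : ℝ) :
    ∀ᵐ z ∂volume.restrict (QQ N T), perExt h z.1 z.2 = h z := by
  refine ae_QQ_of_openQQ (ae_of_all _ fun z hz => ?_)
  have : (fun i => Int.fract (z.1 i)) = z.1 := funext fun i =>
    Int.fract_eq_self.2 ⟨(hz.1 i trivial).1.le, (hz.1 i trivial).2⟩
  rw [perExt, this]

theorem exists_isTest_eq {N : ℕ} {T : ℝ} {g : RN N × ℝ → ℝ} (hg : ContDiff ℝ (⊤ : ℕ∞) g)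
    (hsupp : Function.support g ⊆ openQQ N T) :
    ∃ ψ : RN N → ℝ → ℝ, IsTest N ψ ∧ ∀ z ∈ openQQ N T, ψ z.1 z.2 = g z := by
  have hfin : LocallyFinite fun k : Fin N → ℤ =>
      Function.support fun z : RN N × ℝ => g (z + latt k) := by
    intro z₀
    refine ⟨Metric.ball z₀ 1, Metric.ball_mem_nhds _ one_pos, ?_⟩
    refine (finite_Icc (fun i => ⌊-z₀.1 i - 1⌋) (fun i => ⌈2 - z₀.1 i⌉)).subset ?_
    rintro k ⟨z, hz, hzb⟩
    have hz' := hsupp hz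
    have hd : ∀ i, |z.1 i - z₀.1 i| < 1 := fun i => by
      have h1 : dist z.1 z₀.1 < 1 := (le_max_left _ _).trans_lt hzb
      exact (dist_le_pi_dist z.1 z₀.1 i).trans_lt h1
    have hk : ∀ i, 0 < z.1 i + k i ∧ z.1 i + k i < 1 := fun i => by
      have := hz'.1 i trivial
      simpa [latt] using this
    refine ⟨fun i => ?_, fun i => ?_⟩
    · have : (⌊-z₀.1 i - 1⌋ : ℝ) ≤ k i :=
        (Int.floor_le _).trans (by linarith [(hk i).1, (abs_lt.1 (hd i)).2])
      exact_mod_cast this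
    · have : (k i : ℝ) ≤ ⌈2 - z₀.1 i⌉ :=
        le_trans (by linarith [(hk i).2, (abs_lt.1 (hd i)).1]) (Int.le_ceil _)
      exact_mod_cast this
  refine ⟨fun x t => ∑ᶠ k : Fin N → ℤ, g ((x, t) + latt k), ⟨?_, fun t x k => ?_⟩, fun z hz => ?_⟩
  · have h := contMDiff_finsum (I := modelWithCornersSelf ℝ ℝ)
      (I' := modelWithCornersSelf ℝ (RN N × ℝ)) (n := ((⊤ : ℕ∞) : WithTop ℕ∞))
      (f := fun (k : Fin N → ℤ) (z : RN N × ℝ) => g (z + latt k)) (fun k => by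
        rw [contMDiff_iff_contDiff]
        exact hg.comp (contDiff_id.add contDiff_const)) hfin
    exact h.contDiff
  · have e : ∀ l : Fin N → ℤ, ((fun i => x i + (k i : ℝ), t) : RN N × ℝ) + latt l
        = (x, t) + latt (k + l) := fun l => by
      ext <;> simp [latt, add_assoc]
    simp only [e]
    exact finsum_comp_equiv (Equiv.addLeft k) (f := fun l => g ((x, t) + latt l))
  · dsimp only
    rw [finsum_eq_single _ (0 : Fin N → ℤ) fun k hk => ?_]
    · congr 1
      ext <;> simp [latt]
    · by_contra hne
      obtain ⟨i, hi⟩ : ∃ i, k i ≠ 0 := Function.ne_iff.1 hk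
      have h1 := (hsupp (Function.mem_support.2 hne)).1 i trivial
      have h2 := hz.1 i trivial
      simp only [latt, Prod.fst_add, Pi.add_apply, mem_Ioo] at h1 h2
      apply hi
      have h3 : (-1 : ℝ) < k i := by linarith
      have h4 : (k i : ℝ) < 1 := by linarith
      have h5 : -1 < k i := by exact_mod_cast h3
      have h6 : k i < 1 := by exact_mod_cast h4
      omega

theorem ae_eq_zero_of_forall_isTest {N : ℕ} {T : ℝ} {f : RN N × ℝ → ℝ}
    (hf : IntegrableOn f (QQ N T))
    (h : ∀ ψ, IsTest N ψ → ∫ z in QQ N T, ψ z.1 z.2 * f z = 0) :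
    ∀ᵐ z ∂volume.restrict (QQ N T), f z = 0 := by
  refine ae_QQ_of_openQQ ((isOpen_openQQ N T).ae_eq_zero_of_integral_contDiff_smul_eq_zero
    (hf.mono_set (openQQ_subset N T)).locallyIntegrableOn fun g hg _ hgU => ?_)
  have hsupp := (subset_tsupport g).trans hgU
  obtain ⟨ψ, hψ, he⟩ := exists_isTest_eq hg hsupp
  rw [← h ψ hψ, ← setIntegral_congr_set (openQQ_ae_eq N T),
    ← setIntegral_eq_integral_of_forall_compl_eq_zero (s := openQQ N T)]
  · refine setIntegral_congr_fun (isOpen_openQQ N T).measurableSet fun z hz => ?_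
    simp only [he z hz, smul_eq_mul]
  · intro z hz
    rw [Function.notMem_support.1 fun hz' => hz (hsupp hz'), zero_smul]

theorem IsTest.const_smul {N : ℕ} {φ : RN N → ℝ → ℝ} (c : ℝ) (h : IsTest N φ) :
    IsTest N (c • φ) :=
  (IsTest.of_time contDiff_const (u := fun _ => c)).mul h

/-- The space of smooth periodic test functions. -/
def testSpace (N : ℕ) : Submodule ℝ (RN N → ℝ → ℝ) where
  carrier := {φ | IsTest N φ}
  add_mem' h h' := IsTest.add h h'
  zero_mem' := IsTest.of_time (contDiff_const (c := (0 : ℝ)))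
  smul_mem' c _ h := IsTest.const_smul c h

/-- Evaluation of test functions on space-time. -/
def testEval (N : ℕ) : testSpace N →ₗ[ℝ] RN N × ℝ → ℝ where
  toFun ψ z := ψ.1 z.1 z.2
  map_add' _ _ := rfl
  map_smul' _ _ := rfl

theorem isFiniteMeasure_QQ (N : ℕ) (T : ℝ) : IsFiniteMeasure (volume.restrict (QQ N T)) := by
  refine isFiniteMeasure_restrict.2 (ne_top_of_le_ne_top ?_ (measure_mono
    (prod_mono_right Ioo_subset_Icc_self)))
  exact ((isCompact_Icc (a := (0 : RN N)) (b := 1)).prod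
    (isCompact_Icc (a := (0 : ℝ)) (b := T))).measure_lt_top.ne

section

variable {N : ℕ} {T : ℝ} {m : RN N → ℝ → ℝ}

/-- Integration of test functions against `m`. -/
def pairing (hm : IntegrableOn (fun z : RN N × ℝ => m z.1 z.2) (QQ N T)) :
    testSpace N →ₗ[ℝ] ℝ where
  toFun ψ := intQ N T fun x t => m x t * ψ.1 x t
  map_add' ψ ψ' := by
    unfold intQ
    rw [← integral_add (IsTest.integrableOn_mul ψ.2 hm) (IsTest.integrableOn_mul ψ'.2 hm)]
    simp [mul_add]
  map_smul' c ψ := by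
    unfold intQ
    rw [RingHom.id_apply, smul_eq_mul, ← integral_const_mul]
    congr 1 with z
    simp only [Submodule.coe_smul, Pi.smul_apply, smul_eq_mul]
    ring

/-- Spatial partial derivatives of test functions. -/
def testPd (N : ℕ) (j : Fin N) : testSpace N →ₗ[ℝ] testSpace N where
  toFun ψ := ⟨fun x t => pd j (fun y => ψ.1 y t) x, IsTest.pd ψ.2 j⟩
  map_add' ψ ψ' := by
    ext x t
    have h : ∀ φ : testSpace N, DifferentiableAt ℝ (fun y => φ.1 y t) x := fun φ =>
      ((IsTest.differentiable φ.2).comp (f := fun y : RN N => (y, t)) (by fun_prop)) x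
    simp only [Submodule.coe_add, Pi.add_apply, pd]
    rw [fderiv_fun_add (h ψ) (h ψ')]
    rfl
  map_smul' c ψ := by
    ext x t
    have h : DifferentiableAt ℝ (fun y => ψ.1 y t) x :=
      ((IsTest.differentiable ψ.2).comp (f := fun y : RN N => (y, t)) (by fun_prop)) x
    simp only [Submodule.coe_smul, Pi.smul_apply, pd, RingHom.id_apply]
    rw [fderiv_fun_const_smul h]
    rfl

theorem exists_density_of_test_bound {q r R : ℝ} (hqr : q.HolderConjugate r) (hR : 0 ≤ R)
    (Λ : testSpace N →ₗ[ℝ] ℝ)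
    (h : ∀ ψ : testSpace N, ENNReal.ofReal |Λ ψ|
      ≤ ENNReal.ofReal R * (∫⁻ z in QQ N T, ‖ψ.1 z.1 z.2‖ₑ ^ q) ^ (1 / q)) :
    ∃ g : RN N × ℝ → ℝ, Measurable g ∧ IntegrableOn g (QQ N T) ∧
      ∫⁻ z in QQ N T, ‖g z‖ₑ ^ r ≤ 2 * ENNReal.ofReal R ^ r ∧
      ∀ ψ : testSpace N, Λ ψ = ∫ z in QQ N T, ψ.1 z.1 z.2 * g z := by
  have := isFiniteMeasure_QQ N T
  refine exists_density_of_bound hqr (testEval N)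
    (fun ψ => (IsTest.continuous ψ.2).measurable) (fun ψ => ?_) Λ hR h
  obtain ⟨M, hM⟩ := IsTest.exists_bound ψ.2 T
  exact ⟨M, (ae_restrict_iff' (measurableSet_QQ N T)).2 (ae_of_all _ hM)⟩

theorem lintegral_rpow_le_of_test_bound {q r R : ℝ} (hqr : q.HolderConjugate r) (hR : 0 ≤ R)
    (hm : IntegrableOn (fun z : RN N × ℝ => m z.1 z.2) (QQ N T))
    (h : ∀ ψ, IsTest N ψ → ENNReal.ofReal |intQ N T fun x t => m x t * ψ x t|
      ≤ ENNReal.ofReal R * (∫⁻ z in QQ N T, ‖ψ z.1 z.2‖ₑ ^ q) ^ (1 / q)) :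
    ∫⁻ z in QQ N T, ‖m z.1 z.2‖ₑ ^ r ≤ 2 * ENNReal.ofReal R ^ r := by
  obtain ⟨g, -, hgi, hgr, hg⟩ := exists_density_of_test_bound hqr hR (pairing hm)
    fun ψ => h ψ.1 ψ.2
  have hae : ∀ᵐ z ∂volume.restrict (QQ N T), m z.1 z.2 - g z = 0 := by
    refine ae_eq_zero_of_forall_isTest (hm.sub hgi) fun ψ hψ => ?_
    have h1 : intQ N T (fun x t => m x t * ψ x t) = ∫ z in QQ N T, ψ z.1 z.2 * g z :=
      hg ⟨ψ, hψ⟩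
    have h2 : IntegrableOn (fun z : RN N × ℝ => ψ z.1 z.2 * g z) (QQ N T) := by
      simpa only [mul_comm] using hψ.integrableOn_mul hgi
    rw [intQ] at h1
    rw [← sub_eq_zero.2 h1, ← integral_sub (hψ.integrableOn_mul hm) h2]
    congr 1 with z
    ring
  refine le_trans (lintegral_mono_ae ?_) hgr
  filter_upwards [hae] with z hz
  rw [sub_eq_zero.1 hz]

theorem exists_hasWeakGradQ_of_test_bound {q r R : ℝ} (hqr : q.HolderConjugate r) (hR : 0 ≤ R)
    (hm : IntegrableOn (fun z : RN N × ℝ => m z.1 z.2) (QQ N T))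
    (h : ∀ ψ, IsTest N ψ → ∀ j, ENNReal.ofReal
        |intQ N T fun x t => m x t * pd j (fun y => ψ y t) x|
      ≤ ENNReal.ofReal R * (∫⁻ z in QQ N T, ‖ψ z.1 z.2‖ₑ ^ q) ^ (1 / q)) :
    ∃ g : RN N → ℝ → RN N, (∀ t, ZPeriodic fun x => g x t) ∧ HasWeakGradQ N T m g ∧
      (∀ j, AEMeasurable (fun z : RN N × ℝ => g z.1 z.2 j) (volume.restrict (QQ N T))) ∧
      ∀ j, ∫⁻ z in QQ N T, ‖g z.1 z.2 j‖ₑ ^ r ≤ 2 * ENNReal.ofReal R ^ r := by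
  have H : ∀ j, ∃ g : RN N × ℝ → ℝ, Measurable g ∧ IntegrableOn g (QQ N T) ∧
      ∫⁻ z in QQ N T, ‖g z‖ₑ ^ r ≤ 2 * ENNReal.ofReal R ^ r ∧
      ∀ ψ : testSpace N, (pairing hm ∘ₗ testPd N j) ψ = ∫ z in QQ N T, ψ.1 z.1 z.2 * g z :=
    fun j => exists_density_of_test_bound hqr hR _ fun ψ => h ψ.1 ψ.2 j
  choose g hgm hgi hgr hg using H
  have hae : ∀ j, ∀ᵐ z ∂volume.restrict (QQ N T), perExt (g j) z.1 z.2 = g j z := fun j =>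
    perExt_ae_eq (g j) T
  refine ⟨fun x t j => -perExt (g j) x t, fun t x k => funext fun j =>
    congrArg Neg.neg (zperiodic_perExt (g j) t x k), fun Φ hΦ hper => ?_, fun j => ?_, fun j => ?_⟩
  · have hΦt : ∀ j, IsTest N fun x t => Φ x t j := fun j =>
      ⟨contDiff_pi.1 hΦ j, fun t x k => congrFun (hper t x k) j⟩
    have e1 : intQ N T (fun x t => m x t * dive (fun y => Φ y t) x)
        = ∑ j, ∫ z in QQ N T, Φ z.1 z.2 j * g j z := by
      simp only [intQ, dive, Finset.mul_sum]
      rw [integral_finsetSum _ fun j _ => ((hΦt j).pd j).integrableOn_mul hm]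
      exact Finset.sum_congr rfl fun j _ => hg j (⟨fun x t => Φ x t j, hΦt j⟩ : testSpace N)
    have e2 : intQ N T (fun x t => dotp (fun j => -perExt (g j) x t) (Φ x t))
        = -∑ j, ∫ z in QQ N T, Φ z.1 z.2 j * g j z := by
      have : ∀ᵐ z ∂volume.restrict (QQ N T), dotp (fun j => -perExt (g j) z.1 z.2) (Φ z.1 z.2)
          = -∑ j, g j z * Φ z.1 z.2 j := by
        filter_upwards [eventually_all.2 hae] with z hz
        simp [dotp, hz]
      rw [intQ, integral_congr_ae this, integral_neg,
        integral_finsetSum _ fun j _ => (hΦt j).integrableOn_mul (hgi j)]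
      simp only [mul_comm]
    rw [e1, e2, neg_neg]
  · exact ((hgm j).aemeasurable.congr ((hae j).mono fun z hz => hz.symm)).neg
  · refine le_trans (lintegral_mono_ae ?_) (hgr j)
    filter_upwards [hae j] with z hz
    rw [hz, enorm_neg]

end

theorem ofReal_rpow_integral_eq {α : Type*} [MeasurableSpace α] {μ : Measure α} {f : α → ℝ}
    {r : ℝ} (hr : 0 < r) (h0 : ∀ x, 0 ≤ f x) (hf : Integrable (fun x => f x ^ r) μ) :
    (∫⁻ x, ‖f x‖ₑ ^ r ∂μ) ^ (1 / r) = ENNReal.ofReal ((∫ x, f x ^ r ∂μ) ^ (1 / r)) := by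
  have h1 : ∀ x, 0 ≤ f x ^ r := fun x => Real.rpow_nonneg (h0 x) r
  rw [← ENNReal.ofReal_rpow_of_nonneg (integral_nonneg h1) (by positivity),
    ofReal_integral_eq_lintegral_ofReal hf (ae_of_all _ h1)]
  congr 2 with x
  rw [Real.enorm_of_nonneg (h0 x), ENNReal.ofReal_rpow_of_nonneg (h0 x) hr.le]

theorem integrable_rpow_of_lintegral_le {α : Type*} [MeasurableSpace α] {μ : Measure α}
    {f : α → ℝ} {r K R : ℝ} (hr : 0 < r) (hK : 0 ≤ K) (hR : 0 ≤ R) (h0 : ∀ x, 0 ≤ f x)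
    (hf : AEMeasurable f μ)
    (h : ∫⁻ x, ‖f x‖ₑ ^ r ∂μ ≤ ENNReal.ofReal K * ENNReal.ofReal R ^ r) :
    Integrable (fun x => f x ^ r) μ ∧ (∫ x, f x ^ r ∂μ) ^ (1 / r) ≤ K ^ (1 / r) * R := by
  have hi : Integrable (fun x => f x ^ r) μ := by
    refine ⟨(hf.pow_const r).aestronglyMeasurable, ?_⟩
    refine lt_of_le_of_lt ?_ (h.trans_lt (ENNReal.mul_lt_top ENNReal.ofReal_lt_top
      (ENNReal.rpow_lt_top_of_nonneg hr.le ENNReal.ofReal_ne_top)))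
    refine lintegral_mono fun x => ?_
    rw [Real.enorm_of_nonneg (h0 x), Real.enorm_of_nonneg (Real.rpow_nonneg (h0 x) r),
      ENNReal.ofReal_rpow_of_nonneg (h0 x) hr.le]
  refine ⟨hi, ?_⟩
  rw [← ENNReal.ofReal_le_ofReal_iff (by positivity), ← ofReal_rpow_integral_eq hr h0 hi]
  refine (ENNReal.rpow_le_rpow h (by positivity)).trans (le_of_eq ?_)
  rw [ENNReal.mul_rpow_of_nonneg _ _ (by positivity), ← ENNReal.rpow_mul,
    mul_one_div_cancel hr.ne', ENNReal.rpow_one, ENNReal.ofReal_mul (by positivity),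
    ENNReal.ofReal_rpow_of_nonneg hK (by positivity)]

theorem IsTest.continuous_euclNorm_grad {N : ℕ} {φ : RN N → ℝ → ℝ} (h : IsTest N φ) :
    Continuous fun z : RN N × ℝ => euclNorm (grad (fun y => φ y z.2) z.1) :=
  Real.continuous_sqrt.comp (continuous_finsetSum _ fun i _ => (h.pd i).continuous.pow 2)

theorem IsTest.integrableOn_euclNorm_grad_rpow {N : ℕ} {φ : RN N → ℝ → ℝ} (h : IsTest N φ)
    (T : ℝ) {q : ℝ} (hq : 0 ≤ q) :
    IntegrableOn (fun z : RN N × ℝ => euclNorm (grad (fun y => φ y z.2) z.1) ^ q) (QQ N T) :=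
  ((h.continuous_euclNorm_grad.rpow_const fun _ => Or.inr hq).continuousOn.integrableOn_compact
    ((isCompact_Icc (a := (0 : RN N)) (b := 1)).prod
      (isCompact_Icc (a := (0 : ℝ)) (b := T)))).mono_set (prod_mono_right Ioo_subset_Icc_self)

theorem FPSol.time_deriv_le {N : ℕ} {T γ' p q K₀ R : ℝ} {m₀ : RN N → ℝ} {m : RN N → ℝ → ℝ}
    {A : RN N → ℝ → RN N} (hs : FPSol N T γ' m₀ m A) (hd : FPData N K₀ m₀) (hT : 0 < T)
    (hp : 1 < p) (hγ' : 1 < γ') (hq : 1 < q)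
    (hsum : 1 / γ' + 1 / (p * (γ' / (γ' - 1))) + 1 / q = 1)
    (hmp : IntegrableOn (fun z : RN N × ℝ => m z.1 z.2 ^ p) (QQ N T)) (hR : 0 ≤ R)
    (hb : ∀ ψ, IsTest N ψ → ∀ j, ENNReal.ofReal
        |intQ N T fun x t => m x t * pd j (fun y => ψ y t) x|
      ≤ ENNReal.ofReal R * (∫⁻ z in QQ N T, ‖ψ z.1 z.2‖ₑ ^ q) ^ (1 / q))
    {φ : RN N → ℝ → ℝ} (hφ : IsTest N φ) (hφ0 : ∀ x, φ x 0 = 0) (hφT : ∀ x, φ x T = 0) :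
    |intQ N T (fun x t => m x t * deriv (φ x) t)|
      ≤ (N * R + fluxNorm N T γ' p m A)
        * (intQ N T (fun x t => euclNorm (grad (fun y => φ y t) x) ^ q)) ^ (1 / q) := by
  have hq0 : 0 < q := by linarith
  set G : ℝ := (intQ N T (fun x t => euclNorm (grad (fun y => φ y t) x) ^ q)) ^ (1 / q) with hG
  have hG0 : 0 ≤ G := Real.rpow_nonneg (integral_nonneg fun z =>
    Real.rpow_nonneg (euclNorm_nonneg _) _) _
  have hGe : (∫⁻ z in QQ N T, ‖euclNorm (grad (fun y => φ y z.2) z.1)‖ₑ ^ q) ^ (1 / q)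
      = ENNReal.ofReal G :=
    ofReal_rpow_integral_eq hq0 (fun _ => euclNorm_nonneg _)
      (hφ.integrableOn_euclNorm_grad_rpow T hq0.le)
  have hF := hs.flux_le hp hγ' hq hsum hmp hφ
  rw [hGe, ← ENNReal.ofReal_mul (fluxNorm_nonneg hs.nonneg), ENNReal.ofReal_le_ofReal_iff
    (mul_nonneg (fluxNorm_nonneg hs.nonneg) hG0)] at hF
  have hL : ∀ j, |intQ N T fun x t => m x t
      * pd j (fun y => pd j (fun y => φ y t) y) x| ≤ R * G := fun j => by
    have h1 := hb _ (hφ.pd j) j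
    have h2 : (∫⁻ z in QQ N T, ‖pd j (fun y => φ y z.2) z.1‖ₑ ^ q) ^ (1 / q)
        ≤ ENNReal.ofReal G := by
      rw [← hGe]
      refine ENNReal.rpow_le_rpow (lintegral_mono fun z => ENNReal.rpow_le_rpow ?_ hq0.le)
        (by positivity)
      rw [Real.enorm_of_nonneg (euclNorm_nonneg _), Real.enorm_eq_ofReal_abs]
      exact ENNReal.ofReal_le_ofReal (abs_le_euclNorm (grad (fun y => φ y z.2) z.1) j)
    have h3 := h1.trans (mul_le_mul le_rfl h2 zero_le zero_le)
    rwa [← ENNReal.ofReal_mul hR, ENNReal.ofReal_le_ofReal_iff (mul_nonneg hR hG0)] at h3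
  have e1 : intQ N T (fun x t => m x t * (deriv (φ x) t + lap (fun y => φ y t) x))
      = intQ N T (fun x t => m x t * deriv (φ x) t)
        + ∑ j, intQ N T fun x t => m x t * pd j (fun y => pd j (fun y => φ y t) y) x := by
    simp only [intQ, mul_add]
    rw [integral_add (hφ.deriv.integrableOn_mul hs.int_m) (hφ.lap.integrableOn_mul hs.int_m)]
    simp only [lap, Finset.mul_sum]
    rw [integral_finsetSum _ fun j _ => ((hφ.pd j).pd j).integrableOn_mul hs.int_m]
  have hid := hs.test_identity hd hT hφ hφT
  rw [e1] at hid
  simp only [hφ0, mul_zero, integral_zero, add_zero] at hid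
  have hsumle : |∑ j, intQ N T fun x t => m x t
      * pd j (fun y => pd j (fun y => φ y t) y) x| ≤ N * (R * G) :=
    (Finset.abs_sum_le_sum_abs _ _).trans ((Finset.sum_le_sum fun j _ => hL j).trans (by simp))
  rw [show intQ N T (fun x t => m x t * deriv (φ x) t)
      = -(∑ j, intQ N T fun x t => m x t * pd j (fun y => pd j (fun y => φ y t) y) x)
        - intQ N T (fun x t => m x t * dotp (A x t) (grad (fun y => φ y t) x)) by linarith]
  refine (abs_sub _ _).trans ?_
  rw [abs_neg]
  linarith

/-- **Proposition 2.4**: Sobolev regularity for the Fokker–Planck equation: if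
`m ∈ L^p(Q)` then `m` has a weak gradient in `L^r(Q)`, `1/r = 1/γ' + (1-1/γ')/p`, with
`‖m‖_r + ‖∇m‖_r ≤ C(E^{1/γ'} ‖m‖_p^{1/γ} + 1)` and the corresponding bound on `∂_t m`. -/
theorem fokker_planck_sobolev (N : ℕ) (hN : 1 ≤ N) (T : ℝ) (hT : 0 < T) (p γ' K₀ : ℝ)
    (hp : 1 < p) (hγ' : 1 < γ') (hK₀ : 0 ≤ K₀) :
    ∃ C > (0:ℝ), ∀ r : ℝ, 1 / r = 1 / γ' + (1 - 1 / γ') * (1 / p) →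
      ∀ (m₀ : RN N → ℝ) (m : RN N → ℝ → ℝ) (A : RN N → ℝ → RN N),
        FPData N K₀ m₀ → FPSol N T γ' m₀ m A →
        IntegrableOn (fun q : RN N × ℝ => m q.1 q.2 ^ p) (QQ N T) →
        ∃ g : RN N → ℝ → RN N,
          (∀ t, ZPeriodic fun x => g x t) ∧
          HasWeakGradQ N T m g ∧
          IntegrableOn (fun q : RN N × ℝ => m q.1 q.2 ^ r) (QQ N T) ∧
          IntegrableOn (fun q : RN N × ℝ => euclNorm (g q.1 q.2) ^ r) (QQ N T) ∧
          (intQ N T (fun x t => m x t ^ r)) ^ (1 / r)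
              + (intQ N T (fun x t => euclNorm (g x t) ^ r)) ^ (1 / r)
            ≤ C * ((intQ N T (fun x t => euclNorm (A x t) ^ γ' * m x t)) ^ (1 / γ')
                * (intQ N T (fun x t => m x t ^ p)) ^ (1 / (p * (γ' / (γ' - 1)))) + 1) ∧
          ∀ φ : RN N → ℝ → ℝ, IsTest N φ → (∀ x, φ x 0 = 0) → (∀ x, φ x T = 0) →
            |intQ N T (fun x t => m x t * deriv (φ x) t)|
              ≤ C * ((intQ N T (fun x t => euclNorm (A x t) ^ γ' * m x t)) ^ (1 / γ')
                  * (intQ N T (fun x t => m x t ^ p)) ^ (1 / (p * (γ' / (γ' - 1)))) + 1)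
                * (intQ N T (fun x t =>
                    euclNorm (grad (fun y => φ y t) x) ^ (r / (r - 1)))) ^ ((r - 1) / r) := by
  set r₀ : ℝ := 1 / (1 / γ' + (1 - 1 / γ') * (1 / p)) with hr₀
  have hg1 : 1 / γ' < 1 := (div_lt_one (by linarith)).2 hγ'
  have hp1 : 1 / p < 1 := (div_lt_one (by linarith)).2 hp
  have hg0 : 0 < 1 / γ' := one_div_pos.2 (by linarith)
  have hp0 : 0 < 1 / p := one_div_pos.2 (by linarith)
  have hinv : 1 / r₀ = 1 / γ' + (1 - 1 / γ') * (1 / p) := by rw [hr₀, one_div_one_div]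
  have hinv0 : 0 < 1 / r₀ := by rw [hinv]; nlinarith
  have hinv1 : 1 / r₀ < 1 := by rw [hinv]; nlinarith
  have hr0 : 0 < r₀ := one_div_pos.1 hinv0
  have hr1 : 1 < r₀ := by rwa [div_lt_one hr0] at hinv1
  have hqr : (r₀ / (r₀ - 1)).HolderConjugate r₀ :=
    (Real.HolderConjugate.conjExponent hr1).symm
  have hq : 1 < r₀ / (r₀ - 1) := hqr.lt
  have hq1 : 1 / (r₀ / (r₀ - 1)) = (r₀ - 1) / r₀ := one_div_div _ _
  have hsum : 1 / γ' + 1 / (p * (γ' / (γ' - 1))) + 1 / (r₀ / (r₀ - 1)) = 1 := by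
    rw [hq1, sub_div, div_self hr0.ne', hinv]
    have h1 : γ' - 1 ≠ 0 := by linarith
    have h2 : γ' ≠ 0 := by linarith
    have h3 : p ≠ 0 := by linarith
    field_simp
    ring
  obtain ⟨C, hC, H⟩ := exists_test_bound (N := N) hT hp hγ' hq hK₀ hsum
  set K : ℝ := N ^ (r₀ - 1) * (N * 2) with hK
  have hK0 : 0 ≤ K := by positivity
  have hk1 : 0 ≤ (2 : ℝ) ^ (1 / r₀) := by positivity
  have hk2 : 0 ≤ K ^ (1 / r₀) := by positivity
  refine ⟨(2 ^ (1 / r₀) + K ^ (1 / r₀)) * C + N * C + 1, by positivity,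
    fun r hr m₀ m A hd hs hmp => ?_⟩
  obtain rfl : r = r₀ := by rw [hr₀, ← hr, one_div_one_div]
  have hF0 : 0 ≤ fluxNorm N T γ' p m A := fluxNorm_nonneg hs.nonneg
  set X : ℝ := fluxNorm N T γ' p m A + 1 with hX
  have hR : 0 ≤ C * X := by positivity
  have hpd : ∀ ψ, IsTest N ψ → ∀ j, _ := fun ψ hψ j =>
    H m₀ m A hd hs hmp ψ hψ _ (Or.inr ⟨j, rfl⟩)
  have hmr := lintegral_rpow_le_of_test_bound hqr hR hs.int_m fun ψ hψ =>
    H m₀ m A hd hs hmp ψ hψ ψ (Or.inl rfl)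
  obtain ⟨g, hgper, hgw, hgm, hgr⟩ := exists_hasWeakGradQ_of_test_bound hqr hR hs.int_m hpd
  obtain ⟨hmi, hmle⟩ := integrable_rpow_of_lintegral_le (K := 2) hr0 zero_le_two hR
    (fun z : RN N × ℝ => hs.nonneg z.1 z.2) hs.int_m.1.aemeasurable (by simpa using hmr)
  have hgen : AEMeasurable (fun z : RN N × ℝ => euclNorm (g z.1 z.2))
      (volume.restrict (QQ N T)) :=
    Real.continuous_sqrt.measurable.comp_aemeasurable
      (Finset.aemeasurable_fun_sum _ fun j _ => (hgm j).pow_const 2)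
  obtain ⟨hgi, hgle⟩ := integrable_rpow_of_lintegral_le hr0 hK0 hR
    (fun z : RN N × ℝ => euclNorm_nonneg (g z.1 z.2)) hgen (by
      refine (lintegral_euclNorm_rpow_le hr1.le _ hgm).trans ?_
      refine (mul_le_mul le_rfl (Finset.sum_le_sum fun j _ => hgr j) zero_le zero_le).trans ?_
      rw [Finset.sum_const, Finset.card_univ, Fintype.card_fin, nsmul_eq_mul, hK,
        ENNReal.ofReal_mul (p := (N : ℝ) ^ (r₀ - 1)) (by positivity),
        ENNReal.ofReal_mul (p := (N : ℝ)) (by positivity),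
        ← ENNReal.ofReal_rpow_of_nonneg (by positivity) (by linarith), ENNReal.ofReal_natCast,
        ENNReal.ofReal_ofNat]
      simp only [mul_assoc, le_refl])
  have hX0 : 0 ≤ X := by positivity
  have hNC : 0 ≤ N * C := by positivity
  refine ⟨g, hgper, hgw, hmi, hgi, (add_le_add hmle hgle).trans ?_, fun φ hφ hφ0 hφT => ?_⟩
  · change _ ≤ _ * X
    nlinarith
  · have h := hs.time_deriv_le hd hT hp hγ' hq hsum hmp hR hpd hφ hφ0 hφT
    rw [hq1] at h
    refine h.trans (mul_le_mul_of_nonneg_right ?_ (Real.rpow_nonneg (integral_nonneg fun z =>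
      Real.rpow_nonneg (euclNorm_nonneg _) _) _))
    change _ ≤ _ * X
    nlinarith [mul_nonneg (mul_nonneg hk1 hC) hX0, mul_nonneg (mul_nonneg hk2 hC) hX0]
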